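/- arXiv:2206.10037 — 2 statements merged into one kernel-verified Lean document; each statement's English description precedes it below -/
import Mathlib

section
/- There exists an absolute constant C > 0 such that for every integer N ≥ 16, every subset A ⊆ {1, …, N} containing no nontrivial three-term arithmetic progression satisfies |A| ≤ C·N/log log N; that is, r_3(N) = O(N/log log N). -/
open Finset

/-- The additive character `t ↦ exp (2πit)`. -/
noncomputable def expTwoPi (t : ℝ) : ℂ := Complex.exp (((2 * Real.pi * t : ℝ) : ℂ) * Complex.I)

lemma expTwoPi_add (s t : ℝ) : expTwoPi (s + t) = expTwoPi s * expTwoPi t := by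
  unfold expTwoPi
  rw [← Complex.exp_add]
  congr 1
  push_cast
  ring

lemma norm_expTwoPi (t : ℝ) : ‖expTwoPi t‖ = 1 := Complex.norm_exp_ofReal_mul_I _

lemma expTwoPi_int (n : ℤ) : expTwoPi n = 1 := by
  unfold expTwoPi
  rw [Complex.exp_eq_one_iff]
  exact ⟨n, by push_cast; ring⟩

lemma expTwoPi_zero : expTwoPi 0 = 1 := by
  simpa using expTwoPi_int 0

lemma expTwoPi_nat_mul (n : ℕ) (t : ℝ) : expTwoPi (n * t) = expTwoPi t ^ n := by
  unfold expTwoPi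
  rw [← Complex.exp_nat_mul]
  congr 1
  push_cast
  ring

lemma conj_expTwoPi (t : ℝ) : (starRingEnd ℂ) (expTwoPi t) = expTwoPi (-t) := by
  unfold expTwoPi
  rw [← Complex.exp_conj, map_mul, Complex.conj_ofReal, Complex.conj_I]
  congr 1
  push_cast
  ring

lemma norm_expTwoPi_sub_one_le (t : ℝ) : ‖expTwoPi t - 1‖ ≤ 2 * Real.pi * |t| := by
  unfold expTwoPi
  rw [mul_comm]
  refine (Real.norm_exp_I_mul_ofReal_sub_one_le).trans_eq ?_
  rw [Real.norm_eq_abs, abs_mul, abs_of_pos Real.two_pi_pos]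

/-- Orthogonality of the characters `r ↦ exp (2πikr/M)`. -/
lemma sum_expTwoPi (M : ℕ) (k : ℤ) (hk : |k| < M) :
    ∑ r ∈ range M, expTwoPi (k * (r / M)) = if k = 0 then (M : ℂ) else 0 := by
  split_ifs with h
  · simp [h, expTwoPi_zero]
  · have hM : (0 : ℝ) < M := by exact_mod_cast (abs_nonneg k).trans_lt hk
    have hpow (r : ℕ) : expTwoPi (k * (r / M)) = expTwoPi (k / M) ^ r := by
      rw [← expTwoPi_nat_mul]
      congr 1
      ring
    have hne : expTwoPi (k / M) ≠ 1 := by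
      unfold expTwoPi
      rw [Ne, Complex.exp_eq_one_iff]
      rintro ⟨n, hn⟩
      have h1 : ((2 * Real.pi * (k / M) : ℝ) : ℂ) = ((2 * Real.pi * n : ℝ) : ℂ) := by
        apply mul_right_cancel₀ Complex.I_ne_zero
        rw [hn]
        push_cast
        ring
      have h2 : (k : ℝ) / M = n := mul_left_cancel₀ Real.two_pi_pos.ne' (Complex.ofReal_injective h1)
      rw [div_eq_iff hM.ne'] at h2
      have h3 : k = n * M := by exact_mod_cast h2
      exact h (Int.eq_zero_of_abs_lt_dvd ⟨n, by rw [h3]; ring⟩ hk)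
    simp_rw [hpow]
    rw [geom_sum_eq hne, ← expTwoPi_nat_mul, mul_div_cancel₀ _ hM.ne', expTwoPi_int]
    simp

/-- Parseval's identity for a finite set of integers of diameter less than `M`. -/
lemma sum_norm_sq_expTwoPi (M : ℕ) (A : Finset ℤ) (hA : ∀ x ∈ A, ∀ z ∈ A, |x - z| < M) :
    ∑ r ∈ range M, ‖∑ x ∈ A, expTwoPi (x * (r / M))‖ ^ 2 = M * A.card := by
  apply Complex.ofReal_injective
  push_cast
  have h (r : ℕ) : ((‖∑ x ∈ A, expTwoPi (x * (r / M))‖ : ℂ)) ^ 2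
      = ∑ x ∈ A, ∑ z ∈ A, expTwoPi (((x - z : ℤ) : ℝ) * (r / M)) := by
    rw [← Complex.mul_conj', map_sum, sum_mul_sum]
    refine sum_congr rfl fun x _ => sum_congr rfl fun z _ => ?_
    rw [conj_expTwoPi, ← expTwoPi_add]
    congr 1
    push_cast
    ring
  simp_rw [h]
  rw [sum_comm]
  have h' : ∀ x ∈ A, ∑ r ∈ range M, ∑ z ∈ A, expTwoPi (((x - z : ℤ) : ℝ) * (r / M)) = M := by
    intro x hx
    rw [sum_comm, sum_congr rfl fun z hz => sum_expTwoPi M (x - z) (hA x hx z hz)]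
    simp [sub_eq_zero, hx]
  rw [sum_congr rfl h']
  simp [mul_comm]

/-- The number of solutions of `x + z = 2y` with `x, z ∈ A`, weighted by `f y`, is controlled by
the largest value of the Fourier transform of `f`. -/
lemma abs_sum_midpoint_le (N : ℕ) (A : Finset ℤ) (hA : A ⊆ Icc 1 (N : ℤ)) (f : ℤ → ℝ) (B : ℝ)
    (hB : ∀ θ : ℝ, ‖∑ y ∈ Icc 1 (N : ℤ), (f y : ℂ) * expTwoPi (y * θ)‖ ≤ B) :
    |∑ x ∈ A, ∑ z ∈ A, ∑ y ∈ Icc 1 (N : ℤ), if x + z = 2 * y then f y else 0| ≤ B * A.card := by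
  rcases Nat.eq_zero_or_pos N with rfl | hN
  · have : A = ∅ := by simpa using hA
    simp [this]
  obtain ⟨M, hM⟩ : ∃ M : ℕ, M = 2 * N := ⟨_, rfl⟩
  have hM0 : (0 : ℝ) < M := by
    rw [hM]; positivity
  have key : ∑ r ∈ range M, (∑ x ∈ A, expTwoPi (x * (r / M))) * (∑ z ∈ A, expTwoPi (z * (r / M))) *
        (∑ y ∈ Icc 1 (N : ℤ), (f y : ℂ) * expTwoPi (y * (-2 * (r / M))))
      = ((M * ∑ x ∈ A, ∑ z ∈ A, ∑ y ∈ Icc 1 (N : ℤ), if x + z = 2 * y then f y else 0 : ℝ) : ℂ) := by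
    have h (r : ℕ) : (∑ x ∈ A, expTwoPi (x * (r / M))) * (∑ z ∈ A, expTwoPi (z * (r / M))) *
        (∑ y ∈ Icc 1 (N : ℤ), (f y : ℂ) * expTwoPi (y * (-2 * (r / M))))
        = ∑ x ∈ A, ∑ z ∈ A, ∑ y ∈ Icc 1 (N : ℤ),
          (f y : ℂ) * expTwoPi (((x + z - 2 * y : ℤ) : ℝ) * (r / M)) := by
      rw [sum_mul_sum, sum_mul]
      refine sum_congr rfl fun x _ => ?_
      rw [sum_mul]
      refine sum_congr rfl fun z _ => ?_
      rw [mul_sum]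
      refine sum_congr rfl fun y _ => ?_
      rw [mul_left_comm, ← expTwoPi_add, ← expTwoPi_add]
      congr 2
      push_cast
      ring
    simp_rw [h]
    simp only [Complex.ofReal_mul, Complex.ofReal_sum, Complex.ofReal_natCast]
    rw [sum_comm, mul_sum]
    refine sum_congr rfl fun x hx => ?_
    rw [sum_comm, mul_sum]
    refine sum_congr rfl fun z hz => ?_
    rw [sum_comm, mul_sum]
    refine sum_congr rfl fun y hy => ?_
    have hx' := mem_Icc.1 (hA hx)
    have hz' := mem_Icc.1 (hA hz)
    have hy' := mem_Icc.1 hy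
    rw [← mul_sum, sum_expTwoPi M _ (by rw [abs_lt]; omega)]
    by_cases hc : x + z = 2 * y
    · simp [hc, mul_comm]
    · have hc' : x + z - 2 * y ≠ 0 := by omega
      simp [hc, hc']
  have hle := congrArg norm key
  rw [Complex.norm_real, Real.norm_eq_abs, abs_mul, abs_of_pos hM0] at hle
  refine le_of_mul_le_mul_left ?_ hM0
  rw [← hle]
  refine (norm_sum_le _ _).trans ?_
  calc _ ≤ ∑ r ∈ range M, ‖∑ x ∈ A, expTwoPi (x * (r / M))‖ ^ 2 * B := by
        refine sum_le_sum fun r _ => ?_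
        rw [norm_mul, norm_mul, ← sq]
        exact mul_le_mul_of_nonneg_left (hB _) (by positivity)
    _ = _ := by
        rw [← sum_mul, sum_norm_sq_expTwoPi M A]
        · ring
        · intro x hx z hz
          have hx' := mem_Icc.1 (hA hx)
          have hz' := mem_Icc.1 (hA hz)
          rw [abs_lt]; omega

/-- At least half of the pairs of elements of a finite set of integers have an integral midpoint. -/
lemma card_sq_le_two_mul_card_even (A : Finset ℤ) :
    (A.card : ℝ) ^ 2 ≤ 2 * ∑ x ∈ A, ∑ z ∈ A, if Even (x + z) then (1 : ℝ) else 0 := by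
  have h1 : ∀ x z : ℤ, (if Even (x + z) then (1 : ℝ) else 0) =
      (1 + (if Even x then 1 else -1) * (if Even z then 1 else -1)) / 2 := by
    intro x z
    by_cases hx : Even x <;> by_cases hz : Even z <;> simp [hx, hz, Int.even_add]
  simp_rw [h1, ← sum_div, sum_add_distrib, ← mul_sum, ← sum_mul]
  have := sq_nonneg (∑ x ∈ A, if Even x then (1 : ℝ) else -1)
  simp only [sum_const, nsmul_eq_mul, mul_one]
  linarith

lemma sum_midpoint_balanced_le (N : ℕ) (A : Finset ℤ) (hA : A ⊆ Icc 1 (N : ℤ))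
    (hAP : ¬ ∃ x y : ℤ, y ≠ 0 ∧ x ∈ A ∧ x + y ∈ A ∧ x + 2 * y ∈ A) (δ : ℝ) (hδ : 0 ≤ δ) :
    ∑ x ∈ A, ∑ z ∈ A, ∑ y ∈ Icc 1 (N : ℤ),
      (if x + z = 2 * y then (if y ∈ A then 1 else 0) - δ else 0) ≤
      A.card - δ * A.card ^ 2 / 2 := by
  have h : ∀ x ∈ A, ∀ z ∈ A, ∑ y ∈ Icc 1 (N : ℤ),
      (if x + z = 2 * y then (if y ∈ A then 1 else 0) - δ else 0) ≤
      (if x = z then 1 else 0) - δ * (if Even (x + z) then 1 else 0) := by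
    intro x hx z hz
    by_cases he : Even (x + z)
    · obtain ⟨m, hm⟩ := he
      have hx' := mem_Icc.1 (hA hx)
      have hz' := mem_Icc.1 (hA hz)
      rw [sum_eq_single m]
      · have hc : x + z = 2 * m := by omega
        rw [if_pos hc, if_pos (show Even (x + z) from ⟨m, hm⟩), mul_one]
        gcongr
        split_ifs with hmA hxz hxz
        · exact le_rfl
        · refine absurd ⟨x, m - x, by omega, hx, ?_, ?_⟩ hAP
          · simpa using hmA
          · convert hz using 1
            omega
        · exact zero_le_one
        · exact le_rfl
      · intro y _ hy
        rw [if_neg (by omega)]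
      · intro hm'
        exact absurd (mem_Icc.2 (by omega)) hm'
    · rw [sum_eq_zero]
      · rw [if_neg he]
        split_ifs <;> simp
      · intro y _
        rw [if_neg fun hc => he ⟨y, by omega⟩]
  refine (sum_le_sum fun x hx => sum_le_sum fun z hz => h x hx z hz).trans ?_
  simp_rw [sum_sub_distrib, ← mul_sum]
  have h2 := mul_le_mul_of_nonneg_left (card_sq_le_two_mul_card_even A) hδ
  have h3 : ∑ x ∈ A, ∑ z ∈ A, (if x = z then (1 : ℝ) else 0) = A.card := by
    simp
  rw [h3]
  linarith

/-- The balanced function of a progression-free set has a large Fourier coefficient. -/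
lemma exists_large_fourier (N : ℕ) (A : Finset ℤ) (hA : A ⊆ Icc 1 (N : ℤ))
    (hAP : ¬ ∃ x y : ℤ, y ≠ 0 ∧ x ∈ A ∧ x + y ∈ A ∧ x + 2 * y ∈ A) (δ : ℝ) (hδ : 0 < δ)
    (hcard : (A.card : ℝ) = δ * N) (hN : 4 < δ ^ 2 * N) :
    ∃ θ : ℝ, δ ^ 2 * N / 4 <
      ‖∑ y ∈ Icc 1 (N : ℤ), (((if y ∈ A then 1 else 0) - δ : ℝ) : ℂ) * expTwoPi (y * θ)‖ := by
  by_contra! hB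
  have h1 := (abs_le.1 (abs_sum_midpoint_le N A hA _ _ hB)).1
  have h2 := sum_midpoint_balanced_le N A hA hAP δ hδ.le
  have hN0 : (0 : ℝ) < N := by
    by_contra! h
    nlinarith [sq_nonneg δ]
  rw [hcard] at h1 h2
  have h3 : 0 < δ * N := by positivity
  have h4 := h1.trans h2
  nlinarith

/-- If `f` has a large exponential sum and the character is nearly constant on progressions of
difference `q` and length `L`, then `f` has large sum on one such progression. -/
lemma exists_large_sum_on_progression (N q L : ℕ) (f : ℤ → ℝ)
    (hf : ∀ y, |f y| ≤ 1) (hsupp : ∀ y, y ∉ Icc 1 (N : ℤ) → f y = 0)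
    (hsum : ∑ y ∈ Icc 1 (N : ℤ), f y = 0) (θ ε η : ℝ) (hη : 0 ≤ η)
    (hθ : ∀ j < L, ‖expTwoPi ((q * j : ℕ) * θ) - 1‖ ≤ ε)
    (hbig : L * (N * (2 * η + ε)) + 4 * (q * L * L) <
      L * ‖∑ y ∈ Icc 1 (N : ℤ), (f y : ℂ) * expTwoPi (y * θ)‖) :
    ∃ x : ℤ, 1 ≤ x ∧ x + q * L ≤ N + q ∧ η * L ≤ ∑ j ∈ range L, f (x + q * j) := by
  by_contra! hcon
  set I : Finset ℤ := Icc (1 - q * L) N with hI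
  have shift {E : Type} [AddCommMonoid E] (g : ℤ → E)
      (hg : ∀ y, y ∉ Icc 1 (N : ℤ) → g y = 0) (j : ℕ) (hj : j < L) :
      ∑ x ∈ I, g (x + q * j) = ∑ y ∈ Icc 1 (N : ℤ), g y := by
    have hqj : (q : ℤ) * j ≤ q * L := by gcongr
    have hqj0 : (0 : ℤ) ≤ q * j := by positivity
    have himg : ∑ x ∈ I, g (x + q * j) = ∑ y ∈ I.map (addRightEmbedding ((q : ℤ) * j)), g y := by
      rw [sum_map]; rfl
    rw [himg]
    symm
    refine sum_subset ?_ fun y _ hy => hg y hy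
    intro y hy
    rw [mem_Icc] at hy
    rw [mem_map]
    refine ⟨y - q * j, ?_, by simp⟩
    rw [hI, mem_Icc]
    constructor <;> linarith
  set G : ℤ → ℝ := fun x => ∑ j ∈ range L, f (x + q * j) with hG
  have hGsum : ∑ x ∈ I, G x = 0 := by
    rw [hG, sum_comm, sum_eq_zero]
    intro j hj
    rw [shift f hsupp j (mem_range.1 hj), hsum]
  have hGle (x : ℤ) : |G x| ≤ L := by
    refine (abs_sum_le_sum_abs _ _).trans ((sum_le_sum fun j _ => hf _).trans ?_)
    simp
  have hfabs : ∑ y ∈ Icc 1 (N : ℤ), |f y| ≤ N := by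
    refine (sum_le_sum fun j _ => hf _).trans ?_
    simp
  have hlow : L * ‖∑ y ∈ Icc 1 (N : ℤ), (f y : ℂ) * expTwoPi (y * θ)‖ ≤
      ∑ x ∈ I, |G x| + L * (N * ε) := by
    have h1 : (L : ℂ) * ∑ y ∈ Icc 1 (N : ℤ), (f y : ℂ) * expTwoPi (y * θ) =
        ∑ x ∈ I, ∑ j ∈ range L, (f (x + q * j) : ℂ) * expTwoPi ((x + q * j : ℤ) * θ) := by
      rw [sum_comm, sum_congr rfl fun j hj =>
        shift (fun y : ℤ => (f y : ℂ) * expTwoPi (y * θ)) (fun y hy => by simp [hsupp y hy]) j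
          (mem_range.1 hj)]
      simp
    have h2 (x : ℤ) : ‖∑ j ∈ range L, (f (x + q * j) : ℂ) * expTwoPi ((x + q * j : ℤ) * θ)‖ ≤
        |G x| + ∑ j ∈ range L, |f (x + q * j)| * ε := by
      have h3 : ∑ j ∈ range L, (f (x + q * j) : ℂ) * expTwoPi ((x + q * j : ℤ) * θ) =
          expTwoPi (x * θ) * ((G x : ℂ) +
            ∑ j ∈ range L, (f (x + q * j) : ℂ) * (expTwoPi ((q * j : ℕ) * θ) - 1)) := by
        rw [hG]
        push_cast
        rw [← sum_add_distrib, mul_sum]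
        refine sum_congr rfl fun j _ => ?_
        rw [add_mul, expTwoPi_add]
        ring
      rw [h3, norm_mul, norm_expTwoPi, one_mul]
      refine (norm_add_le _ _).trans ?_
      rw [Complex.norm_real, Real.norm_eq_abs]
      gcongr
      refine (norm_sum_le _ _).trans (sum_le_sum fun j hj => ?_)
      rw [norm_mul, Complex.norm_real, Real.norm_eq_abs]
      exact mul_le_mul_of_nonneg_left (hθ j (mem_range.1 hj)) (abs_nonneg _)
    have h4 : (L : ℝ) * ‖∑ y ∈ Icc 1 (N : ℤ), (f y : ℂ) * expTwoPi (y * θ)‖ =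
        ‖(L : ℂ) * ∑ y ∈ Icc 1 (N : ℤ), (f y : ℂ) * expTwoPi (y * θ)‖ := by
      rw [norm_mul, Complex.norm_natCast]
    rw [h4, h1]
    refine (norm_sum_le _ _).trans ((sum_le_sum fun x _ => h2 x).trans ?_)
    rw [sum_add_distrib]
    gcongr
    rw [sum_comm]
    calc ∑ j ∈ range L, ∑ x ∈ I, |f (x + q * j)| * ε ≤ ∑ j ∈ range L, (N : ℝ) * ε := by
          refine sum_le_sum fun j hj => ?_
          rw [← sum_mul, shift (fun y => |f y|) (fun y hy => by simp [hsupp y hy]) j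
            (mem_range.1 hj)]
          exact mul_le_mul_of_nonneg_right hfabs ((norm_nonneg _).trans (hθ j (mem_range.1 hj)))
      _ = L * (N * ε) := by simp
  have hup : ∑ x ∈ I, (|G x| + G x) ≤ N * (2 * (η * L)) + (2 * (q * L)) * (2 * L) := by
    have hpt : ∀ x ∈ I, |G x| + G x ≤ (if x ∈ Icc 1 (N : ℤ) then 2 * (η * L) else 0) +
        (if x ∈ Icc (1 - (q : ℤ) * L) 0 ∪ Ioc ((N : ℤ) - q * L) N then 2 * (L : ℝ) else 0) := by
      intro x hx
      have hηL : 0 ≤ η * L := by positivity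
      rw [hI, mem_Icc] at hx
      by_cases hb : x ∈ Icc (1 - (q : ℤ) * L) 0 ∪ Ioc ((N : ℤ) - q * L) N
      · rw [if_pos hb]
        have h5 := hGle x
        have h6 := le_abs_self (G x)
        split_ifs <;> linarith
      · rw [if_neg hb, add_zero]
        simp only [mem_union, mem_Icc, mem_Ioc, not_or, not_and, not_le] at hb
        have hx1 : 1 ≤ x := by
          by_contra! h
          have := hb.1 hx.1
          omega
        have hx2 : x + q * L ≤ N := by
          by_contra! h
          have := hb.2 (by linarith)
          omega
        rw [if_pos (mem_Icc.2 ⟨hx1, hx.2⟩)]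
        have h7 : G x < η * L := hcon x hx1 (by linarith [Int.natCast_nonneg q])
        rcases abs_cases (G x) with h | h <;> linarith
    refine (sum_le_sum hpt).trans ?_
    rw [sum_add_distrib, ← sum_filter, ← sum_filter, sum_const, sum_const, nsmul_eq_mul,
      nsmul_eq_mul]
    have hc1 : ((I.filter fun x => x ∈ Icc 1 (N : ℤ)).card : ℝ) ≤ N := by
      have : (I.filter fun x => x ∈ Icc 1 (N : ℤ)).card ≤ (Icc 1 (N : ℤ)).card :=
        card_le_card fun x hx => (mem_filter.1 hx).2
      rw [Int.card_Icc] at this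
      exact_mod_cast this.trans (by omega)
    have hc2 : ((I.filter fun x =>
        x ∈ Icc (1 - (q : ℤ) * L) 0 ∪ Ioc ((N : ℤ) - q * L) N).card : ℝ) ≤ 2 * (q * L) := by
      have h8 := (card_le_card fun x hx => (mem_filter.1 hx).2 :
        (I.filter fun x => x ∈ Icc (1 - (q : ℤ) * L) 0 ∪ Ioc ((N : ℤ) - q * L) N).card ≤ _).trans
          (card_union_le _ _)
      rw [Int.card_Icc, Int.card_Ioc] at h8
      have h9 : ((q : ℤ) * L) = ((q * L : ℕ) : ℤ) := by push_cast; ring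
      rw [h9] at h8
      have h10 := h8.trans (by omega : _ ≤ 2 * (q * L))
      push_cast at *
      exact_mod_cast h10
    gcongr
  rw [sum_add_distrib, hGsum] at hup
  have : (L : ℝ) * (N * (2 * η + ε)) = N * (2 * (η * L)) + L * (N * ε) := by ring
  have : (2 * ((q : ℝ) * L)) * (2 * L) = 4 * (q * L * L) := by ring
  linarith

/-- Density increment: a progression-free set of density `δ` has density at least `δ + δ² / 32` on
some progression of length `L`, where `L` is about `N ^ (1 / 4)`. -/
lemma density_increment (N L : ℕ) (A : Finset ℤ) (hA : A ⊆ Icc 1 (N : ℤ))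
    (hAP : ¬ ∃ x y : ℤ, y ≠ 0 ∧ x ∈ A ∧ x + y ∈ A ∧ x + 2 * y ∈ A) (δ : ℝ) (hδ : 0 < δ)
    (hδ1 : δ ≤ 1) (hcard : (A.card : ℝ) = δ * N) (hLN : L ^ 4 ≤ N) (hL : 64 ≤ δ ^ 2 * L) :
    ∃ A' : Finset ℤ, A' ⊆ Icc 1 (L : ℤ) ∧
      (¬ ∃ x y : ℤ, y ≠ 0 ∧ x ∈ A' ∧ x + y ∈ A' ∧ x + 2 * y ∈ A') ∧
      (δ + δ ^ 2 / 32) * L ≤ A'.card := by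
  have hδ2 : 0 < δ ^ 2 := by positivity
  have hL0 : (0 : ℝ) < L := by
    by_contra! h
    nlinarith
  have hL1 : 1 ≤ L := by exact_mod_cast hL0
  have hLN' : (L : ℝ) ^ 4 ≤ N := by exact_mod_cast hLN
  have hL64 : (64 : ℝ) ≤ L := by nlinarith
  have hN0 : (0 : ℝ) < N := lt_of_lt_of_le (by positivity) hLN'
  have hLleN : (L : ℝ) ≤ N := by
    refine le_trans ?_ hLN'
    exact le_self_pow₀ (by linarith) (by norm_num)
  obtain ⟨θ, hθ⟩ := exists_large_fourier N A hA hAP δ hδ hcard (by nlinarith)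
  obtain ⟨q, hq0, hqL, hq⟩ := Real.exists_nat_abs_mul_sub_round_le θ (n := L ^ 2) (by positivity)
  set f : ℤ → ℝ := fun y => if y ∈ Icc 1 (N : ℤ) then (if y ∈ A then 1 else 0) - δ else 0 with hf
  have hfval : ∀ y ∈ Icc 1 (N : ℤ), f y = (if y ∈ A then 1 else 0) - δ := fun y hy => if_pos hy
  have hqj : ∀ j < L, ‖expTwoPi ((q * j : ℕ) * θ) - 1‖ ≤ 2 * Real.pi / L := by
    intro j hj
    have h1 : ((q * j : ℕ) : ℝ) * θ = j * (q * θ - round (q * θ)) + ((j * round (q * θ) : ℤ) : ℝ) := by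
      push_cast
      ring
    rw [h1, expTwoPi_add, expTwoPi_int, mul_one]
    refine (norm_expTwoPi_sub_one_le _).trans ?_
    rw [div_eq_mul_inv]
    gcongr
    rw [abs_mul, Nat.abs_cast]
    have hjL : (j : ℝ) ≤ L := by exact_mod_cast hj.le
    calc (j : ℝ) * |q * θ - round (q * θ)| ≤ L * (1 / ((L ^ 2 : ℕ) + 1)) := by gcongr
      _ ≤ L * (1 / L ^ 2) := by
        gcongr
        push_cast
        linarith
      _ = (L : ℝ)⁻¹ := by field_simp
  obtain ⟨x, hx1, hxN, hx⟩ := exists_large_sum_on_progression N q L f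
    (by
      intro y
      simp only [hf]
      split_ifs <;> rw [abs_le] <;> constructor <;> linarith)
    (fun y hy => if_neg hy)
    (by
      rw [sum_congr rfl hfval, sum_sub_distrib, ← sum_filter, filter_mem_eq_inter,
        inter_eq_right.2 hA]
      simp [hcard, mul_comm])
    θ (2 * Real.pi / L) (δ ^ 2 / 32) (by positivity) hqj
    (by
      rw [sum_congr rfl fun y hy => by rw [hfval y hy]]
      refine lt_of_le_of_lt ?_ (mul_lt_mul_of_pos_left hθ hL0)
      have h1 : 2 * Real.pi / L ≤ δ ^ 2 / 8 := by
        rw [div_le_div_iff₀ hL0 (by norm_num)]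
        have := Real.pi_lt_four
        linarith
      have h2 : (q : ℝ) * L ≤ δ ^ 2 * N / 64 := by
        have h3 : (q : ℝ) ≤ L ^ 2 := by exact_mod_cast hqL
        have h4 : (q : ℝ) * L ≤ L ^ 2 * L := by gcongr
        have h5 : 64 * (L : ℝ) ^ 3 ≤ (δ ^ 2 * L) * L ^ 3 := by gcongr
        have h6 : δ ^ 2 * (L : ℝ) ^ 4 ≤ δ ^ 2 * N := by gcongr
        nlinarith
      have h7 : (N : ℝ) * (2 * (δ ^ 2 / 32) + 2 * Real.pi / L) ≤
          N * (2 * (δ ^ 2 / 32) + δ ^ 2 / 8) := by gcongr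
      have h8 := mul_le_mul_of_nonneg_left h7 hL0.le
      have h9 := mul_le_mul_of_nonneg_right h2 hL0.le
      nlinarith)
  have hq1 : (1 : ℤ) ≤ q := by exact_mod_cast hq0
  refine ⟨(Icc 1 (L : ℤ)).filter fun j => x + q * (j - 1) ∈ A, filter_subset _ _, ?_, ?_⟩
  · rintro ⟨a, b, hb, h1, h2, h3⟩
    refine hAP ⟨x + q * (a - 1), q * b, mul_ne_zero (by omega) hb, (mem_filter.1 h1).2, ?_, ?_⟩
    · convert (mem_filter.1 h2).2 using 1
      ring
    · convert (mem_filter.1 h3).2 using 1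
      ring
  · have hterm : ∀ j ∈ range L, f (x + q * j) = (if x + q * (j : ℤ) ∈ A then 1 else 0) - δ := by
      intro j hj
      apply hfval
      have hjL : (j : ℤ) + 1 ≤ L := by exact_mod_cast mem_range.1 hj
      rw [mem_Icc]
      constructor
      · have : (0 : ℤ) ≤ q * j := by positivity
        linarith
      · nlinarith
    have hcard' : ((((Icc 1 (L : ℤ)).filter fun j => x + q * (j - 1) ∈ A).card : ℕ) : ℝ) =
        ∑ j ∈ range L, if x + q * (j : ℤ) ∈ A then (1 : ℝ) else 0 := by
      rw [card_filter]
      push_cast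
      symm
      refine sum_bij (fun (j : ℕ) _ => (j : ℤ) + 1) ?_ ?_ ?_ ?_
      · intro j hj
        have := mem_range.1 hj
        rw [mem_Icc]
        omega
      · intro a _ b _ h
        omega
      · intro b hb
        rw [mem_Icc] at hb
        exact ⟨(b - 1).toNat, mem_range.2 (by omega), by omega⟩
      · intro j _
        simp
    rw [sum_congr rfl hterm, sum_sub_distrib, ← hcard'] at hx
    simp only [sum_const, card_range, nsmul_eq_mul] at hx
    linarith

/-- Roth's theorem in the form `log N ≤ exp (C / δ)`. -/
lemma log_le_exp_of_progressionFree (N : ℕ) : ∀ A : Finset ℤ, A ⊆ Icc 1 (N : ℤ) →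
    (¬ ∃ x y : ℤ, y ≠ 0 ∧ x ∈ A ∧ x + y ∈ A ∧ x + 2 * y ∈ A) → A.Nonempty →
    Real.log N ≤ Real.exp (330 * (N / A.card)) := by
  induction N using Nat.strong_induction_on with
  | _ N ih =>
  intro A hA hAP hne
  have hcA : (0 : ℝ) < A.card := by exact_mod_cast hne.card_pos
  have hcN : (A.card : ℝ) ≤ N := by
    have := card_le_card hA
    rw [Int.card_Icc] at this
    exact_mod_cast this.trans (by omega)
  have hN0 : (0 : ℝ) < N := hcA.trans_le hcN
  obtain ⟨δ, hδdef⟩ : ∃ δ : ℝ, δ = A.card / N := ⟨_, rfl⟩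
  have hδ : 0 < δ := by rw [hδdef]; positivity
  have hδ1 : δ ≤ 1 := by rw [hδdef]; exact (div_le_one hN0).2 hcN
  have hcard : (A.card : ℝ) = δ * N := by rw [hδdef]; field_simp
  have hinv : (N : ℝ) / A.card = 1 / δ := by rw [hδdef, one_div_div]
  rw [hinv]
  obtain ⟨L, hL1, hL2⟩ : ∃ L : ℕ, L ^ 4 ≤ N ∧ N < (L + 1) ^ 4 := by
    refine ⟨Nat.sqrt (Nat.sqrt N), ?_, ?_⟩
    · have h1 := Nat.sqrt_le' (Nat.sqrt N)
      have h2 := Nat.sqrt_le' N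
      calc _ = (Nat.sqrt (Nat.sqrt N) ^ 2) ^ 2 := by ring
        _ ≤ Nat.sqrt N ^ 2 := by gcongr
        _ ≤ N := h2
    · have h1 := Nat.succ_le_succ_sqrt' (Nat.sqrt N)
      have h2 := Nat.succ_le_succ_sqrt' N
      calc N < N + 1 := Nat.lt_succ_self N
        _ ≤ (Nat.sqrt N + 1) ^ 2 := h2
        _ ≤ ((Nat.sqrt (Nat.sqrt N) + 1) ^ 2) ^ 2 := by gcongr
        _ = _ := by ring
  have hlog : Real.log N ≤ 4 * Real.log (L + 1) := by
    have h : (N : ℝ) ≤ (L + 1) ^ 4 := by exact_mod_cast hL2.le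
    have := Real.log_le_log hN0 h
    rwa [Real.log_pow] at this
  by_cases hL : 64 ≤ δ ^ 2 * L
  · have hL64 : (64 : ℝ) ≤ L := by 
      have h : δ ^ 2 * L ≤ 1 * L := by
        gcongr
        exact pow_le_one₀ hδ.le hδ1
      linarith
    obtain ⟨A', hA', hAP', hcard'⟩ := density_increment N L A hA hAP δ hδ hδ1 hcard hL1 hL
    have hLN : L < N := by
      have h64 : 64 ≤ L := by exact_mod_cast hL64
      exact lt_of_lt_of_le (lt_self_pow₀ (by omega) (by norm_num)) hL1
    have hpos : (0 : ℝ) < (δ + δ ^ 2 / 32) * L := by positivity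
    have hne' : A'.Nonempty := by
      rw [← card_pos]
      exact_mod_cast hpos.trans_le hcard'
    have h1 := ih L hLN A' hA' hAP' hne'
    have h2 : (L : ℝ) / A'.card ≤ 1 / δ - 1 / 33 := by
      calc (L : ℝ) / A'.card ≤ L / ((δ + δ ^ 2 / 32) * L) := by gcongr
        _ = 1 / (δ + δ ^ 2 / 32) := by field_simp
        _ ≤ 1 / δ - 1 / 33 := by
          rw [div_sub_div _ _ hδ.ne' (by norm_num), div_le_div_iff₀ (by positivity) (by positivity)]
          nlinarith [mul_pos hδ hδ, mul_nonneg (mul_pos hδ hδ).le (sub_nonneg.2 hδ1)]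
    have h3 : Real.log (L + 1) ≤ 2 * Real.log L := by
      have h : (L : ℝ) + 1 ≤ L ^ 2 := by nlinarith
      have := Real.log_le_log (by positivity) h
      rwa [Real.log_pow] at this
    have h8 : (8 : ℝ) ≤ Real.exp 10 := by linarith [Real.add_one_le_exp (10 : ℝ)]
    calc Real.log N ≤ 8 * Real.log L := by linarith
      _ ≤ Real.exp 10 * Real.exp (330 * (1 / δ - 1 / 33)) := by
        have h4 : Real.log L ≤ Real.exp (330 * (1 / δ - 1 / 33)) := h1.trans (by gcongr)
        gcongr
      _ = Real.exp (330 * (1 / δ)) := by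
        rw [← Real.exp_add]
        congr 1
        ring
  · push Not at hL
    have h1 : Real.log (L + 1) ≤ L := by
      have := Real.log_le_sub_one_of_pos (show (0 : ℝ) < L + 1 by positivity)
      linarith
    have h2 : (L : ℝ) ≤ 64 / δ ^ 2 := by
      rw [le_div_iff₀ (by positivity)]
      linarith
    have h3 := Real.quadratic_le_exp_of_nonneg (show 0 ≤ 330 * (1 / δ) by positivity)
    have h4 : 0 ≤ 1 / δ := by positivity
    have h5 : 64 / δ ^ 2 = 64 * (1 / δ) ^ 2 := by ring
    nlinarith [sq_nonneg (1 / δ)]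

/-- Roth's theorem: `r₃(N) = O(N / log log N)`. -/
theorem roth_theorem :
    ∃ C : ℝ, 0 < C ∧ ∀ N : ℕ, 16 ≤ N → ∀ A : Finset ℤ, A ⊆ Finset.Icc 1 (N : ℤ) →
      (¬ ∃ x y : ℤ, y ≠ 0 ∧ x ∈ A ∧ x + y ∈ A ∧ x + 2 * y ∈ A) →
      (A.card : ℝ) ≤ C * N / Real.log (Real.log N) := by
  refine ⟨330, by norm_num, fun N hN A hA hAP => ?_⟩
  have hlog : 1 < Real.log N := by
    rw [Real.lt_log_iff_exp_lt (by positivity)]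
    have h : (16 : ℝ) ≤ N := by exact_mod_cast hN
    linarith [Real.exp_one_lt_three]
  have hloglog : 0 < Real.log (Real.log N) := Real.log_pos hlog
  rcases A.eq_empty_or_nonempty with rfl | hne
  · simp only [card_empty, Nat.cast_zero]
    positivity
  have hcA : (0 : ℝ) < A.card := by exact_mod_cast hne.card_pos
  have h := log_le_exp_of_progressionFree N A hA hAP hne
  rw [← Real.log_le_iff_le_exp (by linarith), ← mul_div_assoc, le_div_iff₀ hcA] at h
  rw [le_div_iff₀ hloglog]
  linarith
end

section
/- There exist absolute constants c > 0 and C > 0 such that for every integer N ≥ 2, every subset A ⊆ {1, …, N} containing no nontrivial three-term arithmetic progression satisfies |A| ≤ C·N/(log N)^{1+c}; that is, r_3(N) = O(N/(log N)^{1+c}). -/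
namespace KelleyMeka

open Finset
open scoped Pointwise

set_option linter.unusedSectionVars false
set_option linter.unusedDecidableInType false
set_option linter.unusedFintypeInType false

variable {G : Type*} [AddCommGroup G] [Fintype G] [DecidableEq G]

/-- The difference convolution `x ↦ ∑ y, f (x + y) f y`. -/
def diffConv (f : G → ℝ) (x : G) : ℝ := ∑ y, f (x + y) * f y

/-- The sum convolution `x ↦ ∑ y, f (x - y) f y`. -/
def sumConv (f : G → ℝ) (x : G) : ℝ := ∑ y, f (x - y) * f y

lemma sumConv_shift (f : G → ℝ) (e d₁ d₂ : G) :
    sumConv f (e + d₁ - d₂) = ∑ z, f (e + d₁ - z) * f (z - d₂) := by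
  unfold sumConv
  refine Fintype.sum_equiv (Equiv.addRight d₂) _ _ fun y => ?_
  simp only [Equiv.coe_addRight, add_sub_cancel_right]
  congr 2
  abel

lemma diffConv_shift (f : G → ℝ) (e d₁ d₂ : G) :
    diffConv f (d₁ - d₂) = ∑ z, f (e + d₁ - z) * f (e + d₂ - z) := by
  unfold diffConv
  refine Fintype.sum_equiv (Equiv.subLeft (e + d₂)) _ _ fun y => ?_
  simp only [Equiv.subLeft_apply]
  congr 2 <;> abel

lemma diffConv_shift' (f : G → ℝ) (d₁ d₂ : G) :
    diffConv f (d₁ - d₂) = ∑ z, f (z - d₁) * f (z - d₂) := by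
  unfold diffConv
  refine Fintype.sum_equiv (Equiv.addRight d₁) _ _ fun y => ?_
  simp only [Equiv.coe_addRight, add_sub_cancel_right]
  rw [mul_comm]
  congr 2; abel

lemma sum_pow_eq_sum_prod (f : G → ℝ) (p : ℕ) :
    (∑ a, f a) ^ p = ∑ z : Fin p → G, ∏ i, f (z i) := by
  have := Finset.prod_univ_sum (fun _ : Fin p => (univ : Finset G)) (fun _ a => f a)
  simpa [Fintype.piFinset_univ] using this

lemma sum_sq_eq_moment (u : G → G → ℝ) (D : Finset G) (p : ℕ) :
    ∑ z : Fin p → G, (∑ d ∈ D, ∏ i, u d (z i)) ^ 2 =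
      ∑ d₁ ∈ D, ∑ d₂ ∈ D, (∑ z, u d₁ z * u d₂ z) ^ p := by
  simp_rw [sum_pow_eq_sum_prod, sq, sum_mul_sum, prod_mul_distrib]
  rw [sum_comm]
  refine sum_congr rfl fun d₁ _ => ?_
  rw [sum_comm]

lemma diffConv_moment_nonneg (f : G → ℝ) (D : Finset G) (p : ℕ) :
    0 ≤ ∑ d₁ ∈ D, ∑ d₂ ∈ D, (diffConv f (d₁ - d₂)) ^ p := by
  simp_rw [diffConv_shift' f]
  rw [← sum_sq_eq_moment (fun d z => f (z - d))]
  positivity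

lemma sumConv_moment_le (f : G → ℝ) (D : Finset G) (e : G) (p : ℕ) :
    ∑ d₁ ∈ D, ∑ d₂ ∈ D, (sumConv f (e + d₁ - d₂)) ^ p ≤
      ∑ d₁ ∈ D, ∑ d₂ ∈ D, (diffConv f (d₁ - d₂)) ^ p := by
  set R := ∑ d₁ ∈ D, ∑ d₂ ∈ D, (diffConv f (d₁ - d₂)) ^ p with hR
  have h1 : ∑ z : Fin p → G, (∑ d ∈ D, ∏ i, f (e + d - z i)) ^ 2 = R := by
    rw [sum_sq_eq_moment (fun d z => f (e + d - z)), hR]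
    simp_rw [← diffConv_shift f e]
  have h2 : ∑ z : Fin p → G, (∑ d ∈ D, ∏ i, f (z i - d)) ^ 2 = R := by
    rw [sum_sq_eq_moment (fun d z => f (z - d)), hR]
    simp_rw [← diffConv_shift' f]
  have h3 : ∑ d₁ ∈ D, ∑ d₂ ∈ D, (sumConv f (e + d₁ - d₂)) ^ p =
      ∑ z : Fin p → G, (∑ d ∈ D, ∏ i, f (e + d - z i)) * (∑ d ∈ D, ∏ i, f (z i - d)) := by
    simp_rw [sumConv_shift, sum_pow_eq_sum_prod, sum_mul_sum, prod_mul_distrib]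
    symm
    rw [sum_comm]
    refine sum_congr rfl fun d₁ _ => ?_
    rw [sum_comm]
  have h4 := sum_mul_sq_le_sq_mul_sq univ
    (fun z : Fin p → G => ∑ d ∈ D, ∏ i, f (e + d - z i)) (fun z => ∑ d ∈ D, ∏ i, f (z i - d))
  rw [h1, h2, ← h3, ← sq] at h4
  exact abs_le_of_sq_le_sq' h4 (diffConv_moment_nonneg f D p) |>.2

lemma pow_le_choose_mul (k p : ℕ) (hk : 1 ≤ k) : k ^ p ≤ (k * p).choose p := by
  induction p with
  | zero => simp
  | succ p ih =>
    obtain ⟨n, hn⟩ : ∃ n, k * (p + 1) = n + 1 := ⟨k * (p + 1) - 1, by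
      have : 1 ≤ k * (p + 1) := Nat.mul_pos hk (by omega)
      omega⟩
    have hle : k * p ≤ n := by nlinarith
    have h1 := Nat.add_one_mul_choose_eq n p
    rw [← hn] at h1
    have h2 : (k * (p + 1)).choose (p + 1) = k * n.choose p := by
      have : (p + 1) * (k * (p + 1)).choose (p + 1) = (p + 1) * (k * n.choose p) := by
        rw [mul_comm, ← h1]; ring
      exact Nat.eq_of_mul_eq_mul_left (by omega) this
    rw [h2, pow_succ, mul_comm]
    exact Nat.mul_le_mul_left _ (ih.trans (Nat.choose_le_choose p hle))

lemma unbalancing {ι : Type*} (s : Finset ι) (h : ι → ℝ) (p : ℕ)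
    (hnn : ∀ k, 0 ≤ ∑ i ∈ s, h i ^ k) (hp : (s.card : ℝ) * (1 / 4) ^ p ≤ ∑ i ∈ s, h i ^ p) :
    (2 : ℝ) ^ p * s.card ≤ ∑ i ∈ s, (h i + 1) ^ (8 * p + 1) := by
  have h1 : ∑ i ∈ s, (h i + 1) ^ (8 * p + 1) =
      ∑ k ∈ range (8 * p + 1 + 1), ((8 * p + 1).choose k : ℝ) * ∑ i ∈ s, h i ^ k := by
    simp_rw [add_pow, one_pow, mul_one]
    rw [sum_comm]
    refine sum_congr rfl fun k _ => ?_
    rw [mul_sum]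
    exact sum_congr rfl fun _ _ => mul_comm _ _
  rw [h1]
  have h2 : ((8 * p + 1).choose p : ℝ) * ∑ i ∈ s, h i ^ p ≤
      ∑ k ∈ range (8 * p + 1 + 1), ((8 * p + 1).choose k : ℝ) * ∑ i ∈ s, h i ^ k :=
    single_le_sum (f := fun k => ((8 * p + 1).choose k : ℝ) * ∑ i ∈ s, h i ^ k)
      (fun k _ => mul_nonneg (by positivity) (hnn k)) (by simp; omega)
  refine le_trans ?_ h2
  have h3 : (8 : ℝ) ^ p ≤ ((8 * p + 1).choose p : ℝ) := by
    have := (pow_le_choose_mul 8 p (by norm_num)).trans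
      (Nat.choose_le_choose p (Nat.le_succ (8 * p)))
    exact_mod_cast this
  calc (2 : ℝ) ^ p * s.card = 8 ^ p * (s.card * (1 / 4) ^ p) := by
        rw [show (2 : ℝ) = 8 * (1 / 4) by norm_num, mul_pow]; ring
    _ ≤ _ := mul_le_mul h3 hp (by positivity) (by positivity)

/-- The real-valued indicator function of a finite set. -/
def ind (A : Finset G) (x : G) : ℝ := if x ∈ A then 1 else 0

/-- The number of representations of `x` as a difference of two elements of `A`. -/
def rep (A : Finset G) (x : G) : ℕ := (A.filter fun a => a + x ∈ A).card

lemma ind_nonneg (A : Finset G) (x : G) : 0 ≤ ind A x := by unfold ind; split_ifs <;> norm_num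

lemma ind_le_one (A : Finset G) (x : G) : ind A x ≤ 1 := by unfold ind; split_ifs <;> norm_num

lemma sum_ind (A : Finset G) : ∑ x, ind A x = A.card := by simp [ind]

lemma diffConv_ind (A : Finset G) (x : G) : diffConv (ind A) x = rep A x := by
  unfold diffConv rep ind
  simp_rw [mul_ite, mul_one, mul_zero, ← sum_filter]
  simp [add_comm x]

lemma sum_ind_add_mul (A P : Finset G) (x : G) (h : ∀ a ∈ A, a - x ∈ P) :
    ∑ y, ind A (x + y) * ind P y = A.card := by
  rw [← sum_ind, ← Equiv.sum_comp (Equiv.addLeft x) (ind A)]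
  refine sum_congr rfl fun y _ => ?_
  simp only [Equiv.coe_addLeft]
  by_cases hy : x + y ∈ A
  · have := h _ hy
    rw [add_sub_cancel_left] at this
    simp [ind, hy, this]
  · simp [ind, hy]

lemma sum_ind_sub_mul (A P : Finset G) (x : G) (h : ∀ a ∈ A, x - a ∈ P) :
    ∑ y, ind A (x - y) * ind P y = A.card := by
  rw [← sum_ind, ← Equiv.sum_comp (Equiv.subLeft x) (ind A)]
  refine sum_congr rfl fun y _ => ?_
  simp only [Equiv.subLeft_apply]
  by_cases hy : x - y ∈ A
  · have := h _ hy
    rw [sub_sub_cancel] at this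
    simp [ind, hy, this]
  · simp [ind, hy]

lemma sum_ind_mul_le (P : Finset G) (g : G → G) : ∑ y, ind P (g y) * ind P y ≤ P.card := by
  rw [← sum_ind]
  exact sum_le_sum fun y _ => mul_le_of_le_one_left (ind_nonneg _ _) (ind_le_one _ _)

lemma diffConv_balanced_le (A P : Finset G) (a : ℝ) (ha : a * A.card = P.card) (x : G)
    (h : ∀ b ∈ A, b - x ∈ P) (h' : ∀ b ∈ A, b + x ∈ P) :
    diffConv (fun y => a * ind A y - ind P y) x ≤ a ^ 2 * rep A x - P.card := by
  have e : diffConv (fun y => a * ind A y - ind P y) x =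
      a ^ 2 * diffConv (ind A) x - a * ∑ y, ind A (x + y) * ind P y
        - a * ∑ y, ind P (x + y) * ind A y + ∑ y, ind P (x + y) * ind P y := by
    unfold diffConv
    simp_rw [mul_sum, ← sum_sub_distrib, ← sum_add_distrib]
    exact sum_congr rfl fun y _ => by ring
  have e2 : ∑ y, ind P (x + y) * ind A y = A.card := by
    rw [← sum_ind]
    refine sum_congr rfl fun y _ => ?_
    by_cases hy : y ∈ A
    · have := h' _ hy
      rw [add_comm] at this
      simp [ind, hy, this]
    · simp [ind, hy]
  rw [e, sum_ind_add_mul A P x h, e2, diffConv_ind, ha]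
  have := sum_ind_mul_le P (fun y => x + y)
  linarith

lemma sumConv_balanced_le (A P : Finset G) (a : ℝ) (ha : a * A.card = P.card) (x : G)
    (h : ∀ b ∈ A, x - b ∈ P) :
    sumConv (fun y => a * ind A y - ind P y) x ≤ a ^ 2 * sumConv (ind A) x - P.card := by
  have e : sumConv (fun y => a * ind A y - ind P y) x =
      a ^ 2 * sumConv (ind A) x - a * ∑ y, ind A (x - y) * ind P y
        - a * ∑ y, ind P (x - y) * ind A y + ∑ y, ind P (x - y) * ind P y := by
    unfold sumConv
    simp_rw [mul_sum, ← sum_sub_distrib, ← sum_add_distrib]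
    exact sum_congr rfl fun y _ => by ring
  have e2 : ∑ y, ind P (x - y) * ind A y = A.card := by
    rw [← sum_ind]
    refine sum_congr rfl fun y _ => ?_
    by_cases hy : y ∈ A
    · have := h _ hy
      simp [ind, hy, this]
    · simp [ind, hy]
  rw [e, sum_ind_sub_mul A P x h, e2, ha]
  have := sum_ind_mul_le P (fun y => x - y)
  linarith

lemma sum_sumConv_le_card (A C : Finset G)
    (hfree : ∀ a ∈ A, ∀ b ∈ A, ∀ c ∈ C, a + b = c + c → a = c) :
    ∑ c ∈ C, sumConv (ind A) (c + c) ≤ C.card := by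
  rw [card_eq_sum_ones, Nat.cast_sum]
  refine sum_le_sum fun c hc => ?_
  unfold sumConv
  rw [sum_eq_single c]
  · push_cast
    exact mul_le_one₀ (ind_le_one _ _) (ind_nonneg _ _) (ind_le_one _ _)
  · intro b _ hb
    by_cases h1 : c + c - b ∈ A
    · by_cases h2 : b ∈ A
      · exact absurd (hfree b h2 _ h1 c hc (by abel)) hb
      · simp [ind, h2]
    · simp [ind, h1]
  · simp

/-- If `A` is free of progressions with middle term in `C`, the differences of `D'` see a large
moment of the difference convolution of `A`. -/
lemma moment_of_free (A P C D D' E : Finset G) (γ : ℝ) (p : ℕ) (hp : Even p) (hγ : 0 < γ)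
    (hinj : Function.Injective fun c : G => c + c) (hA : A.Nonempty) (hC : C.Nonempty)
    (hCD : ∀ c ∈ C, c + c ∈ D)
    (hP : ∀ a ∈ A, ∀ x ∈ D, x - a ∈ P)
    (hP' : ∀ a ∈ A, ∀ d₁ ∈ D', ∀ d₂ ∈ D', a + (d₁ - d₂) ∈ P)
    (hE : ∀ x ∈ D, ∀ d₁ ∈ D', ∀ d₂ ∈ D', x - d₁ + d₂ ∈ E)
    (hED : E.card ≤ 2 * D.card)
    (hCγ : γ * D.card ≤ C.card)
    (hfree : ∀ a ∈ A, ∀ b ∈ A, ∀ c ∈ C, a + b = c + c → a = c)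
    (hW : 2 * (P.card : ℝ) ≤ (A.card : ℝ) ^ 2)
    (hpγ : 2 / γ ≤ 2 ^ p) :
    (2 : ℝ) ^ p * (D'.card : ℝ) ^ 2 ≤
      ∑ d₁ ∈ D', ∑ d₂ ∈ D', (P.card * rep A (d₁ - d₂) / (A.card : ℝ) ^ 2) ^ (8 * p + 1) := by
  classical
  rcases D'.eq_empty_or_nonempty with rfl | hD'
  · simp
  have hApos : (0 : ℝ) < A.card := by exact_mod_cast hA.card_pos
  have hCpos : (0 : ℝ) < C.card := by exact_mod_cast hC.card_pos
  have hDpos : (0 : ℝ) < D.card := by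
    obtain ⟨c, hc⟩ := hC
    exact_mod_cast card_pos.2 ⟨_, hCD c hc⟩
  have hPpos : (0 : ℝ) < P.card := by
    obtain ⟨c, hc⟩ := hC
    obtain ⟨a, ha⟩ := hA
    exact_mod_cast card_pos.2 ⟨_, hP a ha _ (hCD c hc)⟩
  set W : ℝ := (P.card : ℝ) with hWdef
  set a : ℝ := W / A.card with ha
  have haA : a * A.card = W := by rw [ha]; field_simp
  set f : G → ℝ := fun y => a * ind A y - ind P y with hf
  set R := ∑ d₁ ∈ D', ∑ d₂ ∈ D', (diffConv f (d₁ - d₂)) ^ p with hR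
  -- the average of the sum convolution over `2 • C` is quite negative
  have h1 : ∑ c ∈ C, sumConv f (c + c) ≤ - (C.card * (W / 2)) := by
    have : ∑ c ∈ C, sumConv f (c + c) ≤ ∑ c ∈ C, (a ^ 2 * sumConv (ind A) (c + c) - W) :=
      sum_le_sum fun c hc => sumConv_balanced_le A P a haA _ fun b hb => hP b hb _ (hCD c hc)
    refine this.trans ?_
    rw [sum_sub_distrib, ← mul_sum, sum_const, nsmul_eq_mul]
    have h2 := sum_sumConv_le_card A C hfree
    have h3 : a ^ 2 ≤ W / 2 := by
      rw [ha, div_pow, div_le_iff₀ (by positivity)]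
      nlinarith
    have h4 : a ^ 2 * ∑ c ∈ C, sumConv (ind A) (c + c) ≤ W / 2 * C.card := by
      refine (mul_le_mul_of_nonneg_left h2 (by positivity)).trans ?_
      exact mul_le_mul_of_nonneg_right h3 (by positivity)
    linarith
  have h2 : C.card * (W / 2) ^ p ≤ ∑ c ∈ C, (sumConv f (c + c)) ^ p := by
    have hJ := Real.pow_arith_mean_le_arith_mean_pow_of_even C (fun _ => 1 / (C.card : ℝ))
      (fun c => sumConv f (c + c)) (fun _ _ => by positivity)
      (by simp [hCpos.ne']) hp
    rw [← mul_sum, ← mul_sum] at hJ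
    have h5 : (W / 2) ^ p ≤ (1 / (C.card : ℝ) * ∑ c ∈ C, sumConv f (c + c)) ^ p := by
      rw [← hp.neg_pow (1 / (C.card : ℝ) * ∑ c ∈ C, sumConv f (c + c))]
      refine pow_le_pow_left₀ (by positivity) ?_ p
      rw [← mul_neg, one_div, ← div_eq_inv_mul, le_div_iff₀ hCpos]
      linarith
    have h6 := h5.trans hJ
    rw [one_div, ← div_eq_inv_mul, le_div_iff₀ hCpos] at h6
    linarith
  have h3 : ∑ c ∈ C, (sumConv f (c + c)) ^ p ≤ ∑ x ∈ D, (sumConv f x) ^ p := by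
    rw [← sum_image (s := C) (g := fun c => c + c) (f := fun x => (sumConv f x) ^ p)
      (fun x _ y _ h => hinj h)]
    refine sum_le_sum_of_subset_of_nonneg ?_ fun _ _ _ => hp.pow_nonneg _
    intro x hx
    obtain ⟨c, hc, rfl⟩ := mem_image.1 hx
    exact hCD c hc
  have h4 : (D'.card : ℝ) ^ 2 * ∑ x ∈ D, (sumConv f x) ^ p ≤ E.card * R := by
    have : ∀ d₁ ∈ D', ∀ d₂ ∈ D', ∑ x ∈ D, (sumConv f x) ^ p ≤
        ∑ e ∈ E, (sumConv f (e + d₁ - d₂)) ^ p := by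
      intro d₁ hd₁ d₂ hd₂
      calc ∑ x ∈ D, (sumConv f x) ^ p
          = ∑ e ∈ D.image (fun x => x - d₁ + d₂), (sumConv f (e + d₁ - d₂)) ^ p := by
            rw [sum_image]
            · refine sum_congr rfl fun x _ => ?_
              congr 2; abel
            · intro x _ y _ h; simpa using h
        _ ≤ _ := by
            refine sum_le_sum_of_subset_of_nonneg ?_ fun _ _ _ => hp.pow_nonneg _
            intro x hx
            obtain ⟨c, hc, rfl⟩ := mem_image.1 hx
            exact hE c hc _ hd₁ _ hd₂
    calc (D'.card : ℝ) ^ 2 * ∑ x ∈ D, (sumConv f x) ^ p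
        = ∑ d₁ ∈ D', ∑ d₂ ∈ D', ∑ x ∈ D, (sumConv f x) ^ p := by
          simp only [sum_const, nsmul_eq_mul]; ring
      _ ≤ ∑ d₁ ∈ D', ∑ d₂ ∈ D', ∑ e ∈ E, (sumConv f (e + d₁ - d₂)) ^ p :=
          sum_le_sum fun d₁ h₁ => sum_le_sum fun d₂ h₂ => this d₁ h₁ d₂ h₂
      _ = ∑ e ∈ E, ∑ d₁ ∈ D', ∑ d₂ ∈ D', (sumConv f (e + d₁ - d₂)) ^ p := by
          symm
          rw [sum_comm]
          refine sum_congr rfl fun d₁ _ => ?_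
          rw [sum_comm]
      _ ≤ ∑ e ∈ E, R := sum_le_sum fun e _ => sumConv_moment_le f D' e p
      _ = E.card * R := by simp
  have hRnn : 0 ≤ R := diffConv_moment_nonneg f D' p
  have h5 : (D'.card : ℝ) ^ 2 * (W / 4) ^ p ≤ R := by
    have hE' : (E.card : ℝ) ≤ 2 * D.card := by exact_mod_cast hED
    have h6 : (D'.card : ℝ) ^ 2 * (γ * D.card * (W / 2) ^ p) ≤ 2 * D.card * R := by
      refine le_trans ?_ (h4.trans (mul_le_mul_of_nonneg_right hE' hRnn))
      refine mul_le_mul_of_nonneg_left ?_ (by positivity)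
      refine le_trans ?_ (h2.trans h3)
      exact mul_le_mul_of_nonneg_right hCγ (by positivity)
    have h7 : (D'.card : ℝ) ^ 2 * ((γ / 2) * (W / 2) ^ p) ≤ R := by
      have : D.card * ((D'.card : ℝ) ^ 2 * ((γ / 2) * (W / 2) ^ p)) ≤ D.card * R := by
        nlinarith
      exact le_of_mul_le_mul_left this hDpos
    refine le_trans (mul_le_mul_of_nonneg_left ?_ (by positivity)) h7
    have h8 : (1 / 2 : ℝ) ^ p ≤ γ / 2 := by
      rw [one_div, inv_pow, inv_le_comm₀ (by positivity) (by positivity)]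
      simpa using hpγ
    calc (W / 4) ^ p = (1 / 2) ^ p * (W / 2) ^ p := by rw [← mul_pow]; congr 1; ring
      _ ≤ _ := mul_le_mul_of_nonneg_right h8 (by positivity)
  have h6 := unbalancing (D' ×ˢ D') (fun x => diffConv f (x.1 - x.2) / W) p
    (fun k => by
      simp_rw [div_pow, ← sum_div, sum_product]
      exact div_nonneg (diffConv_moment_nonneg f D' k) (by positivity))
    (by
      simp_rw [div_pow, ← sum_div, sum_product]
      rw [le_div_iff₀ (by positivity), card_product]
      push_cast
      calc _ = (D'.card : ℝ) ^ 2 * (W / 4) ^ p := by simp only [div_pow, one_pow]; ring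
        _ ≤ _ := h5)
  rw [card_product, sum_product] at h6
  push_cast at h6
  rw [sq]
  refine h6.trans (sum_le_sum fun d₁ h₁ => sum_le_sum fun d₂ h₂ => ?_)
  refine (show Odd (8 * p + 1) from ⟨4 * p, by ring⟩).strictMono_pow.monotone ?_
  have := diffConv_balanced_le A P a haA (d₁ - d₂)
    (fun b hb => by
      have := hP' b hb d₂ h₂ d₁ h₁
      rwa [← neg_sub d₁ d₂, ← sub_eq_add_neg] at this)
    (fun b hb => hP' b hb d₁ h₁ d₂ h₂)
  calc diffConv f (d₁ - d₂) / W + 1 ≤ (a ^ 2 * rep A (d₁ - d₂) - W) / W + 1 := by gcongr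
    _ = W * rep A (d₁ - d₂) / (A.card : ℝ) ^ 2 := by rw [ha]; field_simp; ring

/-- Passing from differences of `D'` to differences between a translate of `D'` and `Y`. -/
lemma moment_translate (u : G → ℝ) (hu : ∀ x, 0 ≤ u x) (D' P' Y : Finset G) (m : ℕ) (Q : ℝ)
    (hD' : D'.Nonempty) (hY : ∀ d ∈ D', ∀ b ∈ Y, d - b ∈ P') (hP' : P'.card ≤ 2 * D'.card)
    (hQ : Q * (D'.card : ℝ) ^ 2 ≤ ∑ d₁ ∈ D', ∑ d₂ ∈ D', u (d₁ - d₂) ^ m) (hQ0 : 0 ≤ Q) :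
    ∃ t : G, Q / 2 * D'.card * Y.card ≤ ∑ d ∈ D', ∑ b ∈ Y, u (d - t - b) ^ m := by
  by_contra! hcon
  have hD'pos : (0 : ℝ) < D'.card := by exact_mod_cast hD'.card_pos
  rcases Y.eq_empty_or_nonempty with rfl | hYne
  · simpa using hcon 0
  have hne : P'.Nonempty := by
    obtain ⟨d, hd⟩ := hD'
    obtain ⟨b, hb⟩ := hYne
    exact ⟨_, hY d hd b hb⟩
  have h1 : (Y.card : ℝ) * ∑ d₁ ∈ D', ∑ d₂ ∈ D', u (d₁ - d₂) ^ m ≤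
      ∑ t ∈ P', ∑ d ∈ D', ∑ b ∈ Y, u (d - t - b) ^ m := by
    calc (Y.card : ℝ) * ∑ d₁ ∈ D', ∑ d₂ ∈ D', u (d₁ - d₂) ^ m
        = ∑ d₁ ∈ D', ∑ b ∈ Y, ∑ d₂ ∈ D', u (d₁ - d₂) ^ m := by
          simp only [sum_const, nsmul_eq_mul, mul_sum]
      _ ≤ ∑ d₁ ∈ D', ∑ b ∈ Y, ∑ t ∈ P', u (d₁ - t - b) ^ m := by
          refine sum_le_sum fun d₁ _ => sum_le_sum fun b hb => ?_
          calc ∑ d₂ ∈ D', u (d₁ - d₂) ^ m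
              = ∑ t ∈ D'.image (fun d => d - b), u (d₁ - t - b) ^ m := by
                rw [sum_image]
                · refine sum_congr rfl fun x _ => ?_
                  congr 2; abel
                · intro x _ y _ h; simpa using h
            _ ≤ _ := by
                refine sum_le_sum_of_subset_of_nonneg ?_ fun _ _ _ => pow_nonneg (hu _) _
                intro x hx
                obtain ⟨c, hc, rfl⟩ := mem_image.1 hx
                exact hY c hc b hb
      _ = _ := by
          symm
          rw [sum_comm]
          refine sum_congr rfl fun d₁ _ => ?_
          rw [sum_comm]
  have h2 : ∑ t ∈ P', ∑ d ∈ D', ∑ b ∈ Y, u (d - t - b) ^ m <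
      ∑ t ∈ P', Q / 2 * D'.card * Y.card := sum_lt_sum_of_nonempty hne fun t _ => hcon t
  rw [sum_const, nsmul_eq_mul] at h2
  have h3 : (P'.card : ℝ) ≤ 2 * D'.card := by exact_mod_cast hP'
  have h4 : (P'.card : ℝ) * (Q / 2 * D'.card * Y.card) ≤
      2 * D'.card * (Q / 2 * D'.card * Y.card) :=
    mul_le_mul_of_nonneg_right h3 (by positivity)
  have h5 := mul_le_mul_of_nonneg_left hQ (show (0 : ℝ) ≤ Y.card by positivity)
  nlinarith

/-- The elements of `X` all of whose translates by the entries of `s` lie in `A`. -/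
def sieve (A X : Finset G) {m : ℕ} (s : Fin m → G) : Finset G :=
  X.filter fun x => ∀ i, x + s i ∈ A

lemma prod_ind {m : ℕ} (A : Finset G) (z : Fin m → G) :
    ∏ i, ind A (z i) = if ∀ i, z i ∈ A then 1 else 0 := by
  simp only [ind]
  rw [Finset.prod_ite_zero]
  simp

lemma card_sieve (A X : Finset G) {m : ℕ} (s : Fin m → G) :
    ((sieve A X s).card : ℝ) = ∑ x ∈ X, ∏ i, ind A (x + s i) := by
  simp_rw [prod_ind, sieve]
  simp

lemma sum_card_sieve (A X : Finset G) (m : ℕ) :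
    ∑ s : Fin m → G, ((sieve A X s).card : ℝ) = X.card * (A.card : ℝ) ^ m := by
  simp_rw [card_sieve]
  rw [sum_comm]
  have : ∀ x ∈ X, ∑ s : Fin m → G, ∏ i, ind A (x + s i) = (A.card : ℝ) ^ m := by
    intro x _
    have h : ∑ z, ind A (x + z) = A.card :=
      (Equiv.sum_comp (Equiv.addLeft x) (ind A)).trans (sum_ind A)
    rw [← sum_pow_eq_sum_prod (fun z => ind A (x + z)), h]
  rw [sum_congr rfl this]
  simp

lemma sum_ind_mul_ind (A : Finset G) (x y : G) :
    ∑ z, ind A (x + z) * ind A (y + z) = rep A (x - y) := by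
  rw [← diffConv_ind, diffConv]
  refine Fintype.sum_equiv (Equiv.addLeft y) _ _ fun z => ?_
  simp only [Equiv.coe_addLeft]
  congr 2; abel

lemma sum_sieve_pairs (A X Y : Finset G) (m : ℕ) (w : G → G → ℝ) :
    ∑ s : Fin m → G, ∑ x ∈ sieve A X s, ∑ y ∈ sieve A Y s, w x y =
      ∑ x ∈ X, ∑ y ∈ Y, w x y * (rep A (x - y) : ℝ) ^ m := by
  have h : ∀ s : Fin m → G, ∑ x ∈ sieve A X s, ∑ y ∈ sieve A Y s, w x y =
      ∑ x ∈ X, ∑ y ∈ Y, w x y * ∏ i, (ind A (x + s i) * ind A (y + s i)) := by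
    intro s
    simp only [sieve, sum_filter, prod_mul_distrib, prod_ind]
    refine sum_congr rfl fun x _ => ?_
    split_ifs with hx
    · refine sum_congr rfl fun y _ => ?_
      split_ifs <;> simp
    · simp
  simp_rw [h]
  rw [sum_comm]
  refine sum_congr rfl fun x _ => ?_
  rw [sum_comm]
  refine sum_congr rfl fun y _ => ?_
  rw [← mul_sum, ← sum_pow_eq_sum_prod (fun z => ind A (x + z) * ind A (y + z)), sum_ind_mul_ind]

/-- Dependent random choice. -/
lemma sifting (A X Y : Finset G) (m : ℕ) (W θ Q : ℝ) (hW : 0 < W) (hA : A.Nonempty)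
    (hX : X.Nonempty) (hY : Y.Nonempty) (hθ : 0 ≤ θ) (hQ : 1 ≤ Q) (hθQ : 2048 * θ ^ m ≤ Q)
    (hmom : Q * X.card * Y.card ≤
      ∑ x ∈ X, ∑ y ∈ Y, (W * rep A (x - y) / (A.card : ℝ) ^ 2) ^ m) :
    ∃ A₁ ⊆ X, ∃ A₂ ⊆ Y, (1 / 4) * (A.card / W) ^ m * X.card ≤ A₁.card ∧
      (1 / 4) * (A.card / W) ^ m * Y.card ≤ A₂.card ∧
      512 * (∑ x ∈ A₁, ∑ y ∈ A₂,
        if θ * ((A.card : ℝ) ^ 2 / W) ≤ rep A (x - y) then (0 : ℝ) else 1) ≤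
        A₁.card * A₂.card := by
  set N : ℝ := (A.card : ℝ) with hN
  have hNpos : 0 < N := by rw [hN]; exact_mod_cast hA.card_pos
  have hXpos : (0 : ℝ) < X.card := by exact_mod_cast hX.card_pos
  have hYpos : (0 : ℝ) < Y.card := by exact_mod_cast hY.card_pos
  set Λ : ℝ := N ^ 2 / W with hΛ
  have hΛpos : 0 < Λ := by positivity
  set bad : G → G → ℝ := fun x y => if θ * Λ ≤ rep A (x - y) then (0 : ℝ) else 1 with hbad
  set τ : ℝ := (1 / 4) * (N / W) ^ m with hτ
  by_contra! hcon
  set T := ∑ x ∈ X, ∑ y ∈ Y, (rep A (x - y) : ℝ) ^ m with hT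
  have hTlow : Q * X.card * Y.card * Λ ^ m ≤ T := by
    have : T = (∑ x ∈ X, ∑ y ∈ Y, (W * rep A (x - y) / N ^ 2) ^ m) * Λ ^ m := by
      simp_rw [hT, sum_mul, ← mul_pow]
      refine sum_congr rfl fun x _ => sum_congr rfl fun y _ => ?_
      congr 1
      rw [hΛ]; field_simp
    rw [this]
    exact mul_le_mul_of_nonneg_right hmom (by positivity)
  have hsum : ∑ s : Fin m → G, ((sieve A X s).card : ℝ) * (sieve A Y s).card = T := by
    have := sum_sieve_pairs A X Y m (fun _ _ => 1)
    simpa [hT] using this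
  have hbadsum : ∑ s : Fin m → G, ∑ x ∈ sieve A X s, ∑ y ∈ sieve A Y s, bad x y ≤
      X.card * Y.card * (θ ^ m * Λ ^ m) := by
    rw [sum_sieve_pairs]
    calc _ ≤ ∑ x ∈ X, ∑ y ∈ Y, θ ^ m * Λ ^ m := by
          refine sum_le_sum fun x _ => sum_le_sum fun y _ => ?_
          simp only [hbad]
          split_ifs with h
          · simp; positivity
          · rw [one_mul, ← mul_pow]
            exact pow_le_pow_left₀ (by positivity) (le_of_not_ge h) m
      _ = _ := by simp only [sum_const, nsmul_eq_mul]; ring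
  have hpt : ∀ s : Fin m → G, ((sieve A X s).card : ℝ) * (sieve A Y s).card ≤
      512 * (∑ x ∈ sieve A X s, ∑ y ∈ sieve A Y s, bad x y)
        + τ * X.card * (sieve A Y s).card + τ * Y.card * (sieve A X s).card := by
    intro s
    have hb : 0 ≤ ∑ x ∈ sieve A X s, ∑ y ∈ sieve A Y s, bad x y :=
      sum_nonneg fun x _ => sum_nonneg fun y _ => by simp only [hbad]; split_ifs <;> norm_num
    by_cases h1 : τ * X.card ≤ (sieve A X s).card
    · by_cases h2 : τ * Y.card ≤ (sieve A Y s).card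
      · have := hcon (sieve A X s) (filter_subset _ _) (sieve A Y s) (filter_subset _ _) h1 h2
        have : 0 ≤ τ * X.card * (sieve A Y s).card := by positivity
        have : 0 ≤ τ * Y.card * (sieve A X s).card := by positivity
        linarith
      · have h3 := mul_le_mul_of_nonneg_right (le_of_not_ge h2)
          (show (0 : ℝ) ≤ (sieve A X s).card by positivity)
        have : 0 ≤ τ * X.card * (sieve A Y s).card := by positivity
        linarith
    · have h3 := mul_le_mul_of_nonneg_right (le_of_not_ge h1)
          (show (0 : ℝ) ≤ (sieve A Y s).card by positivity)
      have : 0 ≤ τ * Y.card * (sieve A X s).card := by positivity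
      linarith
  have hall := sum_le_sum fun s (_ : s ∈ (univ : Finset (Fin m → G))) => hpt s
  rw [hsum, sum_add_distrib, sum_add_distrib, ← mul_sum, ← mul_sum, ← mul_sum,
    sum_card_sieve, sum_card_sieve] at hall
  have hτN : τ * N ^ m = Λ ^ m / 4 := by
    rw [hτ, hΛ, mul_assoc, ← mul_pow]
    ring_nf
  have e1 : τ * X.card * (Y.card * N ^ m) = X.card * Y.card * (Λ ^ m / 4) := by
    rw [← hτN]; ring
  have e2 : τ * Y.card * (X.card * N ^ m) = X.card * Y.card * (Λ ^ m / 4) := by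
    rw [← hτN]; ring
  rw [e1, e2] at hall
  have hU : 0 < X.card * Y.card * Λ ^ m := by positivity
  have h1 : (X.card * Y.card * Λ ^ m) * (2048 * θ ^ m) ≤ (X.card * Y.card * Λ ^ m) * Q :=
    mul_le_mul_of_nonneg_left hθQ hU.le
  have h2 : (X.card * Y.card * Λ ^ m) * 1 ≤ (X.card * Y.card * Λ ^ m) * Q :=
    mul_le_mul_of_nonneg_left hQ hU.le
  nlinarith

lemma hoeffding_upper {ι : Type*} [DecidableEq ι] (Y : Finset ι) (X : ι → ℝ)
    (hX : ∀ y ∈ Y, |X y| ≤ 1) (hX0 : ∑ y ∈ Y, X y = 0) (k : ℕ) (ε : ℝ) (hε : 0 < ε) (hε1 : ε ≤ 1) :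
    (((Fintype.piFinset fun _ : Fin k => Y).filter fun a => ε * k < ∑ i, X (a i)).card : ℝ) ≤
      (Y.card : ℝ) ^ k * Real.exp (-(ε ^ 2 * k / 4)) := by
  set s : ℝ := ε / 2 with hs
  have h1 : ∑ y ∈ Y, Real.exp (s * X y) ≤ Y.card * Real.exp (s ^ 2) := by
    have : ∀ y ∈ Y, Real.exp (s * X y) ≤ 1 + s * X y + s ^ 2 := by
      intro y hy
      have hb : |s * X y| ≤ 1 := by
        rw [abs_mul, abs_of_pos (by positivity)]
        nlinarith [hX y hy, abs_nonneg (X y)]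
      have h2 := (abs_le.1 (Real.abs_exp_sub_one_sub_id_le hb)).2
      have h3 : (s * X y) ^ 2 ≤ s ^ 2 := by
        rw [mul_pow]
        have : X y ^ 2 ≤ 1 := by
          rw [← sq_abs]; exact pow_le_one₀ (abs_nonneg _) (hX y hy)
        nlinarith [sq_nonneg s]
      linarith
    calc ∑ y ∈ Y, Real.exp (s * X y) ≤ ∑ y ∈ Y, (1 + s * X y + s ^ 2) := sum_le_sum this
      _ = Y.card * (s ^ 2 + 1) := by
          rw [sum_add_distrib, sum_add_distrib, ← mul_sum, hX0]; simp; ring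
      _ ≤ _ := mul_le_mul_of_nonneg_left (Real.add_one_le_exp _) (by positivity)
  have h2 : ∑ a ∈ Fintype.piFinset fun _ : Fin k => Y, Real.exp (s * ∑ i, X (a i)) =
      (∑ y ∈ Y, Real.exp (s * X y)) ^ k := by
    have := Finset.prod_univ_sum (fun _ : Fin k => Y) (fun _ y => Real.exp (s * X y))
    simp only [prod_const, card_univ, Fintype.card_fin] at this
    rw [this]
    refine sum_congr rfl fun a _ => ?_
    rw [mul_sum, Real.exp_sum]
  have h3 : (((Fintype.piFinset fun _ : Fin k => Y).filter
      fun a => ε * k < ∑ i, X (a i)).card : ℝ) * Real.exp (s * (ε * k)) ≤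
      (∑ y ∈ Y, Real.exp (s * X y)) ^ k := by
    rw [← h2, ← nsmul_eq_mul, ← sum_const]
    refine (sum_le_sum fun a ha => ?_).trans
      (sum_le_sum_of_subset_of_nonneg (filter_subset _ _) fun _ _ _ => (Real.exp_pos _).le)
    exact Real.exp_le_exp.2 (mul_le_mul_of_nonneg_left (mem_filter.1 ha).2.le (by positivity))
  have h4 : (∑ y ∈ Y, Real.exp (s * X y)) ^ k ≤ (Y.card * Real.exp (s ^ 2)) ^ k :=
    pow_le_pow_left₀ (sum_nonneg fun _ _ => (Real.exp_pos _).le) h1 k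
  rw [← le_div_iff₀ (Real.exp_pos _)] at h3
  refine h3.trans ?_
  rw [div_le_iff₀ (Real.exp_pos _)]
  refine h4.trans (le_of_eq ?_)
  rw [mul_pow, ← Real.exp_nat_mul, mul_assoc, ← Real.exp_add]
  congr 2
  rw [hs]; ring

lemma hoeffding {ι : Type*} [DecidableEq ι] (Y : Finset ι) (X : ι → ℝ)
    (hX : ∀ y ∈ Y, |X y| ≤ 1) (hX0 : ∑ y ∈ Y, X y = 0) (k : ℕ) (ε : ℝ) (hε : 0 < ε) (hε1 : ε ≤ 1) :
    (((Fintype.piFinset fun _ : Fin k => Y).filter fun a => ε * k < |∑ i, X (a i)|).card : ℝ) ≤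
      (Y.card : ℝ) ^ k * (2 * Real.exp (-(ε ^ 2 * k / 4))) := by
  have h1 := hoeffding_upper Y X hX hX0 k ε hε hε1
  have h2 := hoeffding_upper Y (fun y => - X y) (by simpa using hX) (by simp [hX0]) k ε hε hε1
  have h3 : ((Fintype.piFinset fun _ : Fin k => Y).filter fun a => ε * k < |∑ i, X (a i)|) ⊆
      ((Fintype.piFinset fun _ : Fin k => Y).filter fun a => ε * k < ∑ i, X (a i)) ∪
      ((Fintype.piFinset fun _ : Fin k => Y).filter fun a => ε * k < ∑ i, - X (a i)) := by
    intro a ha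
    rw [mem_filter] at ha
    rw [mem_union, mem_filter, mem_filter, sum_neg_distrib]
    rcases lt_abs.1 ha.2 with h | h
    · exact Or.inl ⟨ha.1, h⟩
    · exact Or.inr ⟨ha.1, h⟩
  have h4 := (card_le_card h3).trans (card_union_le _ _)
  have h5 := (Nat.cast_le (α := ℝ)).2 h4
  push_cast at h5
  linarith

/-- The average of `f` over `z - Y`. -/
noncomputable def localAvg (Y : Finset G) (f : G → ℝ) (z : G) : ℝ :=
  (∑ y ∈ Y, f (z - y)) / Y.card

lemma localAvg_nonneg (Y : Finset G) (f : G → ℝ) (hf : ∀ x, 0 ≤ f x) (z : G) :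
    0 ≤ localAvg Y f z := div_nonneg (sum_nonneg fun _ _ => hf _) (by positivity)

lemma localAvg_le_one (Y : Finset G) (f : G → ℝ) (hf : ∀ x, f x ≤ 1) (z : G) :
    localAvg Y f z ≤ 1 := by
  refine div_le_one_of_le₀ ?_ (by positivity)
  refine (sum_le_sum fun y _ => hf (z - y)).trans ?_
  simp

/-- Croot–Sisask almost periodicity, in measure. -/
lemma croot_sisask (f : G → ℝ) (hf0 : ∀ x, 0 ≤ f x) (hf1 : ∀ x, f x ≤ 1)
    (Y T₀ Z : Finset G) (hY : Y.Nonempty) (hT₀ : T₀.Nonempty) (K : ℝ)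
    (hK : ((Y + T₀).card : ℝ) ≤ K * Y.card) (ε θ : ℝ) (hε : 0 < ε) (hε1 : ε ≤ 1) (hθ : 0 < θ)
    (k : ℕ) (hk0 : 0 < k) (hk : 2 * Real.exp (-(ε ^ 2 * k / 4)) ≤ θ / 2) :
    ∃ T ⊆ T₀, (T₀.card : ℝ) ≤ 2 * K ^ k * T.card ∧ ∀ t ∈ T, ∀ t' ∈ T,
      ((Z.filter fun z => z + (t - t') ∈ Z ∧
        2 * ε < |localAvg Y f (z + (t - t')) - localAvg Y f z|).card : ℝ) ≤ 2 * θ * Z.card := by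
  classical
  have hYpos : (0 : ℝ) < Y.card := by exact_mod_cast hY.card_pos
  have hT₀pos : (0 : ℝ) < T₀.card := by exact_mod_cast hT₀.card_pos
  have hkpos : (0 : ℝ) < k := by exact_mod_cast hk0
  set g := localAvg Y f with hg
  set P : Finset (Fin k → G) := Fintype.piFinset fun _ : Fin k => Y with hP
  have hPcard : (P.card : ℝ) = (Y.card : ℝ) ^ k := by simp [hP]
  set emp : (Fin k → G) → G → ℝ := fun a z => (∑ i, f (z - a i)) / k with hemp
  set bad : (Fin k → G) → Finset G := fun a => Z.filter fun z => ε < |emp a z - g z| with hbad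
  set good : Finset (Fin k → G) := P.filter fun a => ((bad a).card : ℝ) ≤ θ * Z.card with hgood
  have hz : ∀ z : G, ((P.filter fun a => ε < |emp a z - g z|).card : ℝ) ≤
      (Y.card : ℝ) ^ k * (θ / 2) := by
    intro z
    have := hoeffding Y (fun y => f (z - y) - g z)
      (fun y _ => by
        have h1 := hf0 (z - y)
        have h2 := hf1 (z - y)
        have h3 := localAvg_nonneg Y f hf0 z
        have h4 := localAvg_le_one Y f hf1 z
        rw [abs_le]; constructor <;> linarith)
      (by
        rw [sum_sub_distrib, sum_const, nsmul_eq_mul, hg, localAvg]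
        field_simp
        simp) k ε hε hε1
    have h2 : (P.filter fun a => ε < |emp a z - g z|) =
        P.filter fun a => ε * k < |∑ i, (f (z - a i) - g z)| := by
      refine filter_congr fun a _ => ?_
      have : ∑ i, (f (z - a i) - g z) = k * (emp a z - g z) := by
        rw [sum_sub_distrib, hemp]
        simp
        field_simp
      rw [this, abs_mul, abs_of_pos hkpos, mul_comm ε]
      exact (mul_lt_mul_iff_right₀ hkpos).symm
    rw [h2]
    exact this.trans (mul_le_mul_of_nonneg_left hk (by positivity))
  have hgoodcard : (Y.card : ℝ) ^ k / 2 ≤ good.card := by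
    rcases Z.eq_empty_or_nonempty with hZ | hZ
    · have : good = P := by
        rw [hgood]
        refine filter_true_of_mem fun a _ => ?_
        simp [hbad, hZ]
      rw [this, hPcard]
      have : 0 < (Y.card : ℝ) ^ k := by positivity
      linarith
    have hZpos : (0 : ℝ) < Z.card := by exact_mod_cast hZ.card_pos
    have h1 : ∑ a ∈ P, ((bad a).card : ℝ) ≤ Z.card * ((Y.card : ℝ) ^ k * (θ / 2)) := by
      have : ∑ a ∈ P, ((bad a).card : ℝ) =
          ∑ z ∈ Z, ((P.filter fun a => ε < |emp a z - g z|).card : ℝ) := by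
        simp only [hbad, card_filter]
        push_cast
        exact sum_comm
      rw [this, ← nsmul_eq_mul, ← sum_const]
      exact sum_le_sum fun z _ => hz z
    have h2 : ((P.filter fun a => ¬ ((bad a).card : ℝ) ≤ θ * Z.card).card : ℝ) * (θ * Z.card) ≤
        ∑ a ∈ P, ((bad a).card : ℝ) := by
      rw [← nsmul_eq_mul, ← sum_const]
      refine (sum_le_sum fun a ha => ?_).trans
        (sum_le_sum_of_subset_of_nonneg (filter_subset _ _) fun _ _ _ => by positivity)
      exact (not_le.1 (mem_filter.1 ha).2).le
    have h3 := card_filter_add_card_filter_not (s := P)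
      (fun a => ((bad a).card : ℝ) ≤ θ * Z.card)
    have h4 : (good.card : ℝ) +
        ((P.filter fun a => ¬ ((bad a).card : ℝ) ≤ θ * Z.card).card : ℝ) = (Y.card : ℝ) ^ k := by
      rw [← hPcard]; exact_mod_cast h3
    have h5 : ((P.filter fun a => ¬ ((bad a).card : ℝ) ≤ θ * Z.card).card : ℝ) ≤
        (Y.card : ℝ) ^ k / 2 := by
      have h6 := h2.trans h1
      have h7 : (θ * Z.card) * ((P.filter fun a => ¬ ((bad a).card : ℝ) ≤ θ * Z.card).card : ℝ) ≤
        (θ * Z.card) * ((Y.card : ℝ) ^ k / 2) := by linarith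
      exact le_of_mul_le_mul_left h7 (by positivity)
    linarith
  set S : Finset (Fin k → G) := Fintype.piFinset fun _ : Fin k => Y + T₀ with hS
  have hScard : (S.card : ℝ) ≤ K ^ k * (Y.card : ℝ) ^ k := by
    rw [← mul_pow]
    simp only [hS, Fintype.card_piFinset, prod_const, card_univ, Fintype.card_fin]
    push_cast
    exact pow_le_pow_left₀ (by positivity) hK k
  have hKpos : 0 < K := by
    have h1 : (0 : ℝ) < (Y + T₀).card := by exact_mod_cast (hY.add hT₀).card_pos
    have := h1.trans_le hK
    exact pos_of_mul_pos_left this hYpos.le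
  have hSne : S.Nonempty := by
    rw [hS, Fintype.piFinset_nonempty]
    exact fun _ => hY.add hT₀
  obtain ⟨b, -, hb⟩ : ∃ b ∈ S, (T₀.card : ℝ) / (2 * K ^ k) ≤
      ((T₀.filter fun t => (fun i => b i - t) ∈ good).card : ℝ) := by
    refine exists_le_of_sum_le hSne ?_
    have h1 : (T₀.card : ℝ) * good.card ≤
        ∑ b ∈ S, ((T₀.filter fun t => (fun i => b i - t) ∈ good).card : ℝ) := by
      have : ∑ b ∈ S, ((T₀.filter fun t => (fun i => b i - t) ∈ good).card : ℝ) =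
          ∑ t ∈ T₀, ((S.filter fun b => (fun i => b i - t) ∈ good).card : ℝ) := by
        simp only [card_filter]
        push_cast
        exact sum_comm
      rw [this, ← nsmul_eq_mul, ← sum_const]
      refine sum_le_sum fun t ht => ?_
      have : (good.image fun a => fun i => a i + t) ⊆
          S.filter fun b => (fun i => b i - t) ∈ good := by
        intro c hc
        obtain ⟨a, ha, rfl⟩ := mem_image.1 hc
        rw [mem_filter]
        refine ⟨?_, by simpa using ha⟩
        rw [hS, Fintype.mem_piFinset]
        intro i
        have := (mem_filter.1 ha).1
        rw [hP, Fintype.mem_piFinset] at this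
        exact add_mem_add (this i) ht
      have h2 := card_le_card this
      rw [card_image_of_injective] at h2
      · exact_mod_cast h2
      · intro a a' h
        funext i
        simpa using congrFun h i
    refine le_trans ?_ h1
    rw [sum_const, nsmul_eq_mul]
    calc (S.card : ℝ) * (T₀.card / (2 * K ^ k))
        ≤ (K ^ k * (Y.card : ℝ) ^ k) * (T₀.card / (2 * K ^ k)) :=
          mul_le_mul_of_nonneg_right hScard (by positivity)
      _ = T₀.card * ((Y.card : ℝ) ^ k / 2) := by field_simp
      _ ≤ _ := mul_le_mul_of_nonneg_left hgoodcard (by positivity)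
  refine ⟨T₀.filter fun t => (fun i => b i - t) ∈ good, filter_subset _ _, ?_, ?_⟩
  · rw [div_le_iff₀ (by positivity)] at hb
    linarith
  · intro t ht t' ht'
    have h1 := (mem_filter.1 (mem_filter.1 ht).2).2
    have h2 := (mem_filter.1 (mem_filter.1 ht').2).2
    set B₁ := bad (fun i => b i - t) with hB₁
    set B₂ := bad (fun i => b i - t') with hB₂
    have hsub : (Z.filter fun z => z + (t - t') ∈ Z ∧ 2 * ε < |g (z + (t - t')) - g z|) ⊆
        B₁ ∪ B₂.image fun z => z - (t - t') := by
      intro z hz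
      obtain ⟨hzZ, hzZ', hlt⟩ := mem_filter.1 hz
      rw [mem_union]
      by_contra! hcon
      have e1 : |emp (fun i => b i - t) z - g z| ≤ ε := by
        by_contra! h
        exact hcon.1 (mem_filter.2 ⟨hzZ, h⟩)
      have e2 : |emp (fun i => b i - t') (z + (t - t')) - g (z + (t - t'))| ≤ ε := by
        by_contra! h
        exact hcon.2 (mem_image.2 ⟨z + (t - t'), mem_filter.2 ⟨hzZ', h⟩, by abel⟩)
      have e3 : emp (fun i => b i - t') (z + (t - t')) = emp (fun i => b i - t) z := by
        simp only [hemp]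
        congr 1
        refine sum_congr rfl fun i _ => ?_
        congr 1; abel
      rw [e3] at e2
      rw [abs_le] at e1 e2
      have : |g (z + (t - t')) - g z| ≤ 2 * ε := by
        rw [abs_le]; constructor <;> linarith
      linarith
    have h3 := (card_le_card hsub).trans (card_union_le _ _)
    have h4 : (B₂.image fun z => z - (t - t')).card ≤ B₂.card := card_image_le
    have h5 : ((Z.filter fun z => z + (t - t') ∈ Z ∧ 2 * ε < |g (z + (t - t')) - g z|).card : ℝ) ≤
        B₁.card + B₂.card := by exact_mod_cast h3.trans (by omega)
    linarith

lemma almost_period_step (g : G → ℝ) (hg0 : ∀ x, 0 ≤ g x) (hg1 : ∀ x, g x ≤ 1)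
    (A₁ Z : Finset G) (ε θ : ℝ) (hε : 0 ≤ ε) (s : G)
    (hs : ((Z.filter fun z => z + s ∈ Z ∧ 2 * ε < |g (z + s) - g z|).card : ℝ) ≤ 2 * θ * Z.card)
    (w : G) (h₁ : ∀ a ∈ A₁, a + w ∈ Z) (h₂ : ∀ a ∈ A₁, a + (w + s) ∈ Z) :
    |∑ a ∈ A₁, g (a + (w + s)) - ∑ a ∈ A₁, g (a + w)| ≤ 2 * ε * A₁.card + 2 * θ * Z.card := by
  rw [← sum_sub_distrib]
  refine (abs_sum_le_sum_abs _ _).trans ?_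
  have h : ∀ a ∈ A₁, |g (a + (w + s)) - g (a + w)| ≤ 2 * ε +
      if 2 * ε < |g (a + w + s) - g (a + w)| then 1 else 0 := by
    intro a _
    rw [← add_assoc]
    split_ifs with hc
    · have : |g (a + w + s) - g (a + w)| ≤ 1 := by
        rw [abs_le]; constructor <;> linarith [hg0 (a + w + s), hg1 (a + w + s), hg0 (a + w),
          hg1 (a + w)]
      linarith
    · linarith
  refine (sum_le_sum h).trans ?_
  rw [sum_add_distrib, sum_const, nsmul_eq_mul, sum_boole]
  have h3 : ((A₁.filter fun a => 2 * ε < |g (a + w + s) - g (a + w)|).card : ℝ) ≤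
      (Z.filter fun z => z + s ∈ Z ∧ 2 * ε < |g (z + s) - g z|).card := by
    norm_cast
    refine card_le_card_of_injOn (fun a => a + w) ?_ (by intro a _ b _ h; simpa using h)
    intro a ha
    rw [mem_coe, mem_filter] at ha
    rw [mem_coe, mem_filter]
    exact ⟨h₁ a ha.1, by rw [add_assoc]; exact h₂ a ha.1, ha.2⟩
  linarith

lemma almost_period_iterate (g : G → ℝ) (hg0 : ∀ x, 0 ≤ g x) (hg1 : ∀ x, g x ≤ 1)
    (A₁ Z T : Finset G) (ε θ : ℝ) (hε : 0 ≤ ε)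
    (hT : ∀ t ∈ T, ∀ t' ∈ T,
      ((Z.filter fun z => z + (t - t') ∈ Z ∧ 2 * ε < |g (z + (t - t')) - g z|).card : ℝ) ≤
        2 * θ * Z.card) (n : ℕ)
    (hZ : ∀ k ≤ n, ∀ s u : Fin k → G, (∀ i, s i ∈ T) → (∀ i, u i ∈ T) → ∀ a ∈ A₁,
      a + ∑ i, (s i - u i) ∈ Z)
    (s u : Fin n → G) (hs : ∀ i, s i ∈ T) (hu : ∀ i, u i ∈ T) :
    |∑ a ∈ A₁, g (a + ∑ i, (s i - u i)) - ∑ a ∈ A₁, g a| ≤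
      n * (2 * ε * A₁.card + 2 * θ * Z.card) := by
  induction n with
  | zero => simp
  | succ n ih =>
    have h1 := ih (fun k hk => hZ k (by omega)) (fun i => s i.castSucc) (fun i => u i.castSucc)
      (fun i => hs _) (fun i => hu _)
    have h2 := almost_period_step g hg0 hg1 A₁ Z ε θ hε _
      (hT _ (hs (Fin.last n)) _ (hu (Fin.last n)))
      (∑ i : Fin n, (s i.castSucc - u i.castSucc))
      (hZ n (by omega) _ _ (fun i => hs _) (fun i => hu _))
      (by
        have := hZ (n + 1) le_rfl s u hs hu
        simpa only [Fin.sum_univ_castSucc] using this)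
    simp only [Fin.sum_univ_castSucc]
    rw [abs_le] at h1 h2 ⊢
    push_cast
    constructor <;> linarith [h1.1, h1.2, h2.1, h2.2]

/-- The character sum of a set. -/
noncomputable def charSum (A : Finset G) (γ : AddChar G ℂ) : ℂ := ∑ a ∈ A, γ a

lemma conj_charSum (A : Finset G) (γ : AddChar G ℂ) :
    (starRingEnd ℂ) (charSum A γ) = ∑ a ∈ A, γ (-a) := by
  rw [charSum, map_sum]
  exact sum_congr rfl fun a _ => (AddChar.map_neg_eq_conj γ a).symm

lemma norm_charSum_le (A : Finset G) (γ : AddChar G ℂ) : ‖charSum A γ‖ ≤ A.card := by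
  refine (norm_sum_le _ _).trans ?_
  simp

lemma sum_norm_charSum_sq (A : Finset G) :
    ∑ γ : AddChar G ℂ, ‖charSum A γ‖ ^ 2 = Fintype.card G * A.card := by
  have : ((∑ γ : AddChar G ℂ, ‖charSum A γ‖ ^ 2 : ℝ) : ℂ) = Fintype.card G * A.card := by
    push_cast
    have h : ∀ γ : AddChar G ℂ, (‖charSum A γ‖ : ℂ) ^ 2 = ∑ a ∈ A, ∑ b ∈ A, γ (a - b) := by
      intro γ
      rw [← Complex.mul_conj', conj_charSum, charSum, sum_mul_sum]
      simp_rw [sub_eq_add_neg, AddChar.map_add_eq_mul]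
    simp_rw [h]
    rw [sum_comm]
    have h2 : ∀ a ∈ A, ∑ γ : AddChar G ℂ, ∑ b ∈ A, γ (a - b) = Fintype.card G := by
      intro a ha
      rw [sum_comm]
      simp_rw [AddChar.sum_apply_eq_ite, sub_eq_zero]
      rw [sum_ite_eq]
      simp [ha]
    rw [sum_congr rfl h2]
    simp [mul_comm]
  exact_mod_cast this

lemma sum_norm_charSum_mul (A B : Finset G) :
    ∑ γ : AddChar G ℂ, ‖charSum A γ‖ * ‖charSum B γ‖ ≤
      Fintype.card G * √(A.card * B.card) := by
  refine abs_le_of_sq_le_sq' ?_ (by positivity) |>.2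
  refine (sum_mul_sq_le_sq_mul_sq _ _ _).trans ?_
  rw [sum_norm_charSum_sq, sum_norm_charSum_sq, mul_pow, Real.sq_sqrt (by positivity)]
  apply le_of_eq; ring

lemma card_mul_ind (S : Finset G) (x : G) :
    (Fintype.card G : ℂ) * (ind S x : ℝ) =
      ∑ γ : AddChar G ℂ, γ x * (starRingEnd ℂ) (charSum S γ) := by
  simp_rw [conj_charSum, mul_sum, ← AddChar.map_add_eq_mul]
  rw [sum_comm]
  simp_rw [AddChar.sum_apply_eq_ite, ← sub_eq_add_neg, sub_eq_zero]
  rw [sum_ite_eq]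
  unfold ind
  split_ifs <;> simp

lemma addChar_map_sum {ι : Type*} (γ : AddChar G ℂ) (s : Finset ι) (f : ι → G) :
    γ (∑ i ∈ s, f i) = ∏ i ∈ s, γ (f i) := by
  classical
  induction s using Finset.induction_on with
  | empty => simp
  | insert a s ha ih => rw [sum_insert ha, prod_insert ha, AddChar.map_add_eq_mul, ih]

/-- The number of representations of points of `S - v` as `a - b + ∑ (sᵢ - uᵢ)`. -/
noncomputable def smoothCount (S A₁ A₂ T : Finset G) (j : ℕ) (v : G) : ℝ :=
  ∑ s ∈ Fintype.piFinset fun _ : Fin j => T, ∑ u ∈ Fintype.piFinset fun _ : Fin j => T,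
    ∑ a ∈ A₁, ∑ b ∈ A₂, ind S (a - b + ∑ i, (s i - u i) + v)

lemma smoothCount_fourier (S A₁ A₂ T : Finset G) (j : ℕ) (v : G) :
    (Fintype.card G : ℂ) * (smoothCount S A₁ A₂ T j v : ℝ) =
      ∑ γ : AddChar G ℂ, γ v * ((starRingEnd ℂ) (charSum S γ) *
        (charSum A₁ γ * (starRingEnd ℂ) (charSum A₂ γ) *
          (charSum T γ ^ j * (starRingEnd ℂ) (charSum T γ) ^ j))) := by
  unfold smoothCount
  push_cast
  simp_rw [mul_sum, card_mul_ind]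
  have h : ∀ γ : AddChar G ℂ, ∑ s ∈ Fintype.piFinset fun _ : Fin j => T,
      ∑ u ∈ Fintype.piFinset fun _ : Fin j => T, ∑ a ∈ A₁, ∑ b ∈ A₂,
        γ (a - b + ∑ i, (s i - u i) + v) =
      γ v * (charSum A₁ γ * (starRingEnd ℂ) (charSum A₂ γ) *
          (charSum T γ ^ j * (starRingEnd ℂ) (charSum T γ) ^ j)) := by
    intro γ
    have e1 : charSum T γ ^ j = ∑ s ∈ Fintype.piFinset fun _ : Fin j => T, ∏ i, γ (s i) := by
      rw [charSum, sum_pow' ]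
    have e2 : (starRingEnd ℂ) (charSum T γ) ^ j =
        ∑ u ∈ Fintype.piFinset fun _ : Fin j => T, ∏ i, γ (- u i) := by
      rw [conj_charSum, sum_pow']
    rw [e1, e2, conj_charSum, charSum]
    have e3 : ∀ (s u : Fin j → G) (a b : G), γ (a - b + ∑ i, (s i - u i) + v) =
        (∏ i, γ (s i)) * ((∏ i, γ (- u i)) * (γ a * (γ (-b) * γ v))) := by
      intro s u a b
      rw [AddChar.map_add_eq_mul, AddChar.map_add_eq_mul, sub_eq_add_neg, AddChar.map_add_eq_mul,
        addChar_map_sum, ← mul_assoc (∏ i, γ (s i)), ← prod_mul_distrib]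
      simp_rw [sub_eq_add_neg, AddChar.map_add_eq_mul]
      ring
    simp_rw [e3, ← mul_sum, ← sum_mul]
    ring
  have h' : ∀ γ : AddChar G ℂ, γ v * ((starRingEnd ℂ) (charSum S γ) *
        (charSum A₁ γ * (starRingEnd ℂ) (charSum A₂ γ) *
          (charSum T γ ^ j * (starRingEnd ℂ) (charSum T γ) ^ j))) =
      (∑ s ∈ Fintype.piFinset fun _ : Fin j => T,
      ∑ u ∈ Fintype.piFinset fun _ : Fin j => T, ∑ a ∈ A₁, ∑ b ∈ A₂,
        γ (a - b + ∑ i, (s i - u i) + v)) * (starRingEnd ℂ) (charSum S γ) := by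
    intro γ
    rw [h]; ring
  rw [sum_congr rfl fun γ _ => h' γ]
  simp_rw [sum_mul]
  symm
  rw [sum_comm]
  refine sum_congr rfl fun s _ => ?_
  rw [sum_comm]
  refine sum_congr rfl fun u _ => ?_
  rw [sum_comm]
  refine sum_congr rfl fun a _ => ?_
  rw [sum_comm]

lemma smoothCount_sub_le (S A₁ A₂ T : Finset G) (j : ℕ) (v : G) (e : ℝ)
    (he : ∀ γ : AddChar G ℂ, ‖charSum T γ‖ ^ (2 * j) * ‖γ v - 1‖ ≤ e * T.card ^ (2 * j)) :
    |smoothCount S A₁ A₂ T j v - smoothCount S A₁ A₂ T j 0| ≤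
      e * T.card ^ (2 * j) * A₂.card * √(S.card * A₁.card) := by
  have hG : (0 : ℝ) < Fintype.card G := by exact_mod_cast Fintype.card_pos
  have he0 : 0 ≤ e * T.card ^ (2 * j) := le_trans (by positivity) (he 0)
  have h1 : (Fintype.card G : ℂ) *
      ((smoothCount S A₁ A₂ T j v - smoothCount S A₁ A₂ T j 0 : ℝ) : ℂ) =
      ∑ γ : AddChar G ℂ, (γ v - 1) * ((starRingEnd ℂ) (charSum S γ) *
        (charSum A₁ γ * (starRingEnd ℂ) (charSum A₂ γ) *
          (charSum T γ ^ j * (starRingEnd ℂ) (charSum T γ) ^ j))) := by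
    push_cast
    rw [mul_sub, smoothCount_fourier, smoothCount_fourier, ← sum_sub_distrib]
    refine sum_congr rfl fun γ _ => ?_
    rw [AddChar.map_zero_eq_one]; ring
  have h2 : (Fintype.card G : ℝ) * |smoothCount S A₁ A₂ T j v - smoothCount S A₁ A₂ T j 0| ≤
      ∑ γ : AddChar G ℂ, ‖charSum S γ‖ * ‖charSum A₁ γ‖ * (A₂.card * (e * T.card ^ (2 * j))) := by
    have := congrArg norm h1
    rw [norm_mul, Complex.norm_natCast, Complex.norm_real, Real.norm_eq_abs] at this
    rw [this]
    refine (norm_sum_le _ _).trans (sum_le_sum fun γ _ => ?_)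
    simp only [norm_mul, norm_pow, RCLike.norm_conj]
    have e1 := he γ
    have e2 := norm_charSum_le A₂ γ
    calc ‖γ v - 1‖ * (‖charSum S γ‖ * (‖charSum A₁ γ‖ * ‖charSum A₂ γ‖ *
          (‖charSum T γ‖ ^ j * ‖charSum T γ‖ ^ j)))
        = ‖charSum S γ‖ * ‖charSum A₁ γ‖ *
          (‖charSum A₂ γ‖ * (‖charSum T γ‖ ^ (2 * j) * ‖γ v - 1‖)) := by ring
      _ ≤ _ := by gcongr
  rw [← sum_mul] at h2
  have h3 := sum_norm_charSum_mul S A₁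
  have h4 := h2.trans (mul_le_mul_of_nonneg_right h3 (by positivity))
  refine le_of_mul_le_mul_left (h4.trans (le_of_eq ?_)) hG
  ring

/-- Almost periodicity bootstrapped by Fourier analysis to a translate of `V`. -/
lemma exists_translate_dense (S A₁ A₂ T V Z : Finset G) (j : ℕ) (ε θ e δ : ℝ) (hε : 0 ≤ ε)
    (hA₁ : A₁.Nonempty) (hA₂ : A₂.Nonempty) (hTne : T.Nonempty)
    (hT : ∀ t ∈ T, ∀ t' ∈ T, ((Z.filter fun z => z + (t - t') ∈ Z ∧
      2 * ε < |localAvg A₂ (ind S) (z + (t - t')) - localAvg A₂ (ind S) z|).card : ℝ) ≤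
        2 * θ * Z.card)
    (hZ : ∀ k ≤ j, ∀ s u : Fin k → G, (∀ i, s i ∈ T) → (∀ i, u i ∈ T) → ∀ a ∈ A₁,
      a + ∑ i, (s i - u i) ∈ Z)
    (he : ∀ v ∈ V, ∀ γ : AddChar G ℂ,
      ‖charSum T γ‖ ^ (2 * j) * ‖γ v - 1‖ ≤ e * T.card ^ (2 * j))
    (hS : (1 - δ) * (A₁.card * A₂.card) ≤ ∑ a ∈ A₁, ∑ b ∈ A₂, ind S (a - b)) :
    ∃ z, (1 - δ - j * (2 * ε + 2 * θ * (Z.card / A₁.card)) - e * √(S.card / A₁.card)) * V.card ≤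
      ∑ v ∈ V, ind S (z + v) := by
  have hA₁' : (0 : ℝ) < A₁.card := by exact_mod_cast hA₁.card_pos
  have hA₂' : (0 : ℝ) < A₂.card := by exact_mod_cast hA₂.card_pos
  have hT' : (0 : ℝ) < T.card := by exact_mod_cast hTne.card_pos
  set g := localAvg A₂ (ind S) with hg
  have hga : ∀ w, ∑ b ∈ A₂, ind S (w - b) = A₂.card * g w := by
    intro w
    rw [hg, localAvg]; field_simp
  set η := j * (2 * ε + 2 * θ * (Z.card / A₁.card)) with hη
  have h0 : (1 - δ - η) * (T.card ^ (2 * j) * (A₁.card * A₂.card)) ≤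
      smoothCount S A₁ A₂ T j 0 := by
    have h1 : ∀ s ∈ Fintype.piFinset fun _ : Fin j => T,
        ∀ u ∈ Fintype.piFinset fun _ : Fin j => T, (1 - δ - η) * (A₁.card * A₂.card) ≤
          ∑ a ∈ A₁, ∑ b ∈ A₂, ind S (a - b + ∑ i, (s i - u i) + 0) := by
      intro s hs u hu
      rw [Fintype.mem_piFinset] at hs hu
      have h2 := almost_period_iterate g (localAvg_nonneg _ _ (ind_nonneg S))
        (localAvg_le_one _ _ (ind_le_one S)) A₁ Z T ε θ hε hT j hZ s u hs hu
      have h3 : ∑ a ∈ A₁, ∑ b ∈ A₂, ind S (a - b + ∑ i, (s i - u i) + 0) =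
          A₂.card * ∑ a ∈ A₁, g (a + ∑ i, (s i - u i)) := by
        rw [mul_sum]
        refine sum_congr rfl fun a _ => ?_
        rw [← hga]
        refine sum_congr rfl fun b _ => ?_
        congr 1; abel
      have h4 : ∑ a ∈ A₁, ∑ b ∈ A₂, ind S (a - b) = A₂.card * ∑ a ∈ A₁, g a := by
        rw [mul_sum]
        exact sum_congr rfl fun a _ => hga a
      rw [h3]
      rw [h4] at hS
      have h5 := mul_le_mul_of_nonneg_left (abs_le.1 h2).1 hA₂'.le
      have h6 : η * (A₁.card * A₂.card) =
          A₂.card * (j * (2 * ε * A₁.card + 2 * θ * Z.card)) := by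
        rw [hη]; field_simp
      nlinarith
    have h2 := sum_le_sum fun s hs => sum_le_sum fun u hu => h1 s hs u hu
    refine le_trans (le_of_eq ?_) h2
    simp only [sum_const, nsmul_eq_mul, Fintype.card_piFinset_const]
    push_cast
    ring
  have hv : ∀ v ∈ V, (1 - δ - η - e * √(S.card / A₁.card)) *
      (T.card ^ (2 * j) * (A₁.card * A₂.card)) ≤ smoothCount S A₁ A₂ T j v := by
    intro v hv
    have h1 := smoothCount_sub_le S A₁ A₂ T j v e (he v hv)
    have h2 : √((S.card : ℝ) * A₁.card) = √(S.card / A₁.card) * A₁.card := by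
      rw [← Real.sqrt_sq hA₁'.le, ← Real.sqrt_mul (by positivity), Real.sqrt_sq hA₁'.le]
      congr 1; field_simp
    rw [h2] at h1
    have h3 := (abs_le.1 h1).1
    nlinarith
  by_contra! hcon
  have hVne : V.Nonempty := by
    by_contra h
    rw [not_nonempty_iff_eq_empty] at h
    subst h
    have := hcon 0
    simp at this
  have h1 := sum_le_sum hv
  have h2 : ∑ v ∈ V, smoothCount S A₁ A₂ T j v =
      ∑ s ∈ Fintype.piFinset fun _ : Fin j => T, ∑ u ∈ Fintype.piFinset fun _ : Fin j => T,
        ∑ a ∈ A₁, ∑ b ∈ A₂, ∑ v ∈ V, ind S (a - b + ∑ i, (s i - u i) + v) := by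
    unfold smoothCount
    rw [sum_comm]
    refine sum_congr rfl fun s _ => ?_
    rw [sum_comm]
    refine sum_congr rfl fun u _ => ?_
    rw [sum_comm]
    refine sum_congr rfl fun a _ => ?_
    rw [sum_comm]
  have h3 : ∑ s ∈ Fintype.piFinset fun _ : Fin j => T,
      ∑ u ∈ Fintype.piFinset fun _ : Fin j => T,
        ∑ a ∈ A₁, ∑ b ∈ A₂, ∑ v ∈ V, ind S (a - b + ∑ i, (s i - u i) + v) <
      ∑ s ∈ Fintype.piFinset fun _ : Fin j => T, ∑ u ∈ Fintype.piFinset fun _ : Fin j => T,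
        ∑ a ∈ A₁, ∑ b ∈ A₂, (1 - δ - η - e * √(S.card / A₁.card)) * V.card := by
    have hP : (Fintype.piFinset fun _ : Fin j => T).Nonempty :=
      Fintype.piFinset_nonempty.2 fun _ => hTne
    exact sum_lt_sum_of_nonempty hP fun s _ => sum_lt_sum_of_nonempty hP fun u _ =>
      sum_lt_sum_of_nonempty hA₁ fun a _ => sum_lt_sum_of_nonempty hA₂ fun b _ => hcon _
  rw [h2] at h1
  have h4 := h1.trans_lt h3
  simp only [sum_const, nsmul_eq_mul, Fintype.card_piFinset_const] at h4
  push_cast at h4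
  refine absurd h4 (not_lt.2 (le_of_eq ?_))
  ring

/-- If most translates of a point by `V` are popular differences then some translate of `V`
has large intersection with `A`. -/
lemma exists_dense_translate (A V : Finset G) (z : G) (L q : ℝ) (hA : A.Nonempty) (hL : 0 ≤ L)
    (h : q * V.card ≤ ∑ v ∈ V, ind (univ.filter fun x => L ≤ rep A x) (z + v)) :
    ∃ x, q * V.card * L ≤ A.card * ((V.filter fun v => x + v ∈ A).card : ℝ) := by
  have h1 : q * V.card * L ≤ ∑ v ∈ V, (rep A (z + v) : ℝ) := by
    refine (mul_le_mul_of_nonneg_right h hL).trans ?_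
    rw [sum_mul]
    refine sum_le_sum fun v _ => ?_
    unfold ind
    split_ifs with hc
    · simpa using hc
    · simp
  have h2 : ∑ v ∈ V, rep A (z + v) = ∑ a ∈ A, (V.filter fun v => a + z + v ∈ A).card := by
    simp_rw [rep, card_filter]
    rw [sum_comm]
    simp_rw [add_assoc]
  have h3 : ∃ a ∈ A, (∑ v ∈ V, (rep A (z + v) : ℝ)) / A.card ≤
      ((V.filter fun v => a + z + v ∈ A).card : ℝ) := by
    refine exists_le_of_sum_le hA ?_
    have hA' : (0 : ℝ) < A.card := by exact_mod_cast hA.card_pos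
    rw [sum_const, nsmul_eq_mul, mul_div_cancel₀ _ hA'.ne']
    exact_mod_cast h2.le
  obtain ⟨a, _, ha⟩ := h3
  refine ⟨a + z, h1.trans ?_⟩
  have hA' : (0 : ℝ) < A.card := by exact_mod_cast hA.card_pos
  rw [div_le_iff₀ hA'] at ha
  linarith

/-- A family of characters whose nontrivial `{-1, 0, 1}`-combinations have small Fourier
coefficients on `B`. -/
def Dissociated (B : Finset G) (σ : ℝ) {n : ℕ} (l : Fin n → AddChar G ℂ) : Prop :=
  ∀ ε ∈ Fintype.piFinset fun _ : Fin n => ({-1, 0, 1} : Finset ℤ), ε ≠ 0 →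
    ‖charSum B (∑ i, ε i • l i)‖ ≤ σ * B.card

lemma riesz_sum_le (B : Finset G) (σ : ℝ) {n : ℕ} (l : Fin n → AddChar G ℂ)
    (hl : Dissociated B σ l) (ω : Fin n → ℂ) (hω : ∀ i, ‖ω i‖ = 1) (s : ℝ) (hs : 0 ≤ s)
    (hσ : 0 ≤ σ) :
    ∑ x ∈ B, ∏ i, (Real.cosh s + (ω i * l i x).re * Real.sinh s) ≤
      (Real.cosh s ^ n + σ * Real.exp s ^ n) * B.card := by
  have hsinh : 0 ≤ Real.sinh s := Real.sinh_nonneg_iff.2 hs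
  have hcosh : 0 < Real.cosh s := Real.cosh_pos s
  set c : Fin n → ℤ → ℂ := fun i e => if e = 0 then (Real.cosh s : ℂ) else
    (Real.sinh s / 2 : ℝ) * ω i ^ e with hc
  have hterm : ∀ x i, ((Real.cosh s + (ω i * l i x).re * Real.sinh s : ℝ) : ℂ) =
      ∑ e ∈ ({-1, 0, 1} : Finset ℤ), c i e * (l i x) ^ e := by
    intro x i
    have h1 : ‖ω i * l i x‖ = 1 := by simp [hω]
    have h2 : (ω i * l i x)⁻¹ = (starRingEnd ℂ) (ω i * l i x) := Complex.inv_eq_conj h1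
    have h3 : (((ω i * l i x).re : ℝ) : ℂ) = (ω i * l i x + (ω i * l i x)⁻¹) / 2 := by
      rw [h2, Complex.re_eq_add_conj]
    rw [sum_insert (by decide), sum_insert (by decide), sum_singleton]
    simp only [hc]
    rw [Complex.ofReal_add, Complex.ofReal_mul, h3, mul_inv]
    simp
    ring
  have hsum : ((∑ x ∈ B, ∏ i, (Real.cosh s + (ω i * l i x).re * Real.sinh s) : ℝ) : ℂ) =
      ∑ ε ∈ Fintype.piFinset fun _ : Fin n => ({-1, 0, 1} : Finset ℤ),
        (∏ i, c i (ε i)) * charSum B (∑ i, ε i • l i) := by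
    rw [Complex.ofReal_sum]
    simp_rw [Complex.ofReal_prod, hterm, prod_univ_sum]
    rw [sum_comm]
    refine sum_congr rfl fun ε _ => ?_
    rw [charSum, mul_sum]
    refine sum_congr rfl fun x _ => ?_
    rw [AddChar.sum_apply, ← prod_mul_distrib]
    simp
  have h0 : (0 : Fin n → ℤ) ∈ Fintype.piFinset fun _ : Fin n => ({-1, 0, 1} : Finset ℤ) := by
    rw [Fintype.mem_piFinset]; intro i; simp
  have hnorm : ∀ ε ∈ Fintype.piFinset fun _ : Fin n => ({-1, 0, 1} : Finset ℤ),
      ‖(∏ i, c i (ε i)) * charSum B (∑ i, ε i • l i)‖ ≤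
        (if ε = 0 then Real.cosh s ^ n * B.card else 0) +
          (∏ i, ‖c i (ε i)‖) * (σ * B.card) := by
    intro ε hε
    rw [norm_mul, norm_prod]
    split_ifs with h
    · subst h
      have h1 : ∏ i, ‖c i ((0 : Fin n → ℤ) i)‖ = Real.cosh s ^ n := by
        simp [hc]
        rw [← Complex.ofReal_cosh, Complex.norm_real, Real.norm_eq_abs, abs_of_pos hcosh]
      rw [h1]
      have h2 := norm_charSum_le B (∑ i, (0 : Fin n → ℤ) i • l i)
      have h3 : 0 ≤ Real.cosh s ^ n * (σ * B.card) := by positivity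
      have h4 := mul_le_mul_of_nonneg_left h2 (pow_nonneg hcosh.le n)
      linarith
    · rw [zero_add]
      exact mul_le_mul_of_nonneg_left (hl ε hε h) (by positivity)
  have hprod : ∑ ε ∈ Fintype.piFinset fun _ : Fin n => ({-1, 0, 1} : Finset ℤ),
      (∏ i, ‖c i (ε i)‖) = Real.exp s ^ n := by
    rw [← prod_univ_sum (fun _ : Fin n => ({-1, 0, 1} : Finset ℤ)) (fun i e => ‖c i e‖)]
    have : ∀ i, ∑ e ∈ ({-1, 0, 1} : Finset ℤ), ‖c i e‖ = Real.exp s := by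
      intro i
      have e1 : ‖c i (-1)‖ = Real.sinh s / 2 := by
        have : c i (-1) = (Real.sinh s / 2 : ℝ) * ω i ^ (-1 : ℤ) := by
          simp only [hc]; rw [if_neg (by decide)]
        rw [this, norm_mul, norm_zpow, hω, Complex.norm_real, Real.norm_eq_abs,
          abs_of_nonneg (by positivity)]; simp
      have e2 : ‖c i 1‖ = Real.sinh s / 2 := by
        have : c i 1 = (Real.sinh s / 2 : ℝ) * ω i ^ (1 : ℤ) := by
          simp only [hc]; rw [if_neg (by decide)]
        rw [this, norm_mul, norm_zpow, hω, Complex.norm_real, Real.norm_eq_abs,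
          abs_of_nonneg (by positivity)]; simp
      have e3 : ‖c i 0‖ = Real.cosh s := by
        have : c i 0 = (Real.cosh s : ℝ) := by simp [hc]
        rw [this, Complex.norm_real, Real.norm_eq_abs, abs_of_pos hcosh]
      rw [sum_insert (by decide), sum_insert (by decide), sum_singleton, e1, e2, e3,
        ← Real.cosh_add_sinh]
      ring
    rw [prod_congr rfl fun i _ => this i]
    simp
  calc ∑ x ∈ B, ∏ i, (Real.cosh s + (ω i * l i x).re * Real.sinh s)
      ≤ ‖((∑ x ∈ B, ∏ i, (Real.cosh s + (ω i * l i x).re * Real.sinh s) : ℝ) : ℂ)‖ := by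
        rw [Complex.norm_real]; exact le_abs_self _
    _ ≤ _ := by
        rw [hsum]
        refine (norm_sum_le _ _).trans ((sum_le_sum hnorm).trans (le_of_eq ?_))
        rw [sum_add_distrib, ← sum_mul, hprod, sum_ite_eq' , if_pos h0]
        ring

lemma dissociated_card (T B : Finset G) (hTB : T ⊆ B) (hT : T.Nonempty) (M : ℝ)
    (hM : (B.card : ℝ) ≤ M * T.card) {n : ℕ} (l : Fin n → AddChar G ℂ) 
    (hl : Dissociated B (Real.exp (-n)) l) (hspec : ∀ i, (T.card : ℝ) / 2 ≤ ‖charSum T (l i)‖) :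
    Real.exp (n / 8) ≤ 2 * M := by
  have hT' : (0 : ℝ) < T.card := by exact_mod_cast hT.card_pos
  have hM0 : 0 ≤ M := by
    by_contra! h
    have : (0 : ℝ) ≤ B.card := by positivity
    nlinarith
  set ω : Fin n → ℂ := fun i => (starRingEnd ℂ) (charSum T (l i)) / ‖charSum T (l i)‖ with hωd
  have hpos : ∀ i, 0 < ‖charSum T (l i)‖ := fun i => by linarith [hspec i]
  have hω : ∀ i, ‖ω i‖ = 1 := by
    intro i
    rw [hωd]; simp only
    rw [norm_div, RCLike.norm_conj, Complex.norm_real, norm_norm, div_self (hpos i).ne']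
  have hre : ∀ i, ∑ x ∈ T, (ω i * l i x).re = ‖charSum T (l i)‖ := by
    intro i
    rw [← Complex.re_sum, ← mul_sum]
    change ((starRingEnd ℂ) (charSum T (l i)) / ‖charSum T (l i)‖ * charSum T (l i)).re = _
    rw [div_mul_eq_mul_div, Complex.conj_mul', pow_two, mul_div_assoc, div_self, mul_one,
      Complex.ofReal_re]
    exact_mod_cast (hpos i).ne'
  have hup : ∑ x ∈ B, Real.exp (1 / 2 * ∑ i, (ω i * l i x).re) ≤
      (Real.cosh (1 / 2) ^ n + Real.exp (-n) * Real.exp (1 / 2) ^ n) * B.card := by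
    refine le_trans (sum_le_sum fun x _ => ?_)
      (riesz_sum_le B _ l hl ω hω (1 / 2) (by norm_num) (Real.exp_pos _).le)
    rw [mul_sum, Real.exp_sum]
    refine prod_le_prod (fun i _ => (Real.exp_pos _).le) fun i _ => ?_
    rw [mul_comm]
    refine Real.exp_mul_le_cosh_add_mul_sinh ?_ _
    refine (Complex.abs_re_le_norm _).trans ?_
    simp [hω]
  have hlow : Real.exp (n / 4) * T.card ≤ ∑ x ∈ T, Real.exp (1 / 2 * ∑ i, (ω i * l i x).re) := by
    have h1 : ∀ x ∈ T, Real.exp (n / 4) * (1 + (1 / 2 * ∑ i, (ω i * l i x).re - n / 4)) ≤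
        Real.exp (1 / 2 * ∑ i, (ω i * l i x).re) := by
      intro x _
      have := Real.add_one_le_exp (1 / 2 * ∑ i, (ω i * l i x).re - n / 4)
      calc _ ≤ Real.exp (n / 4) * Real.exp (1 / 2 * ∑ i, (ω i * l i x).re - n / 4) := by
            gcongr; linarith
        _ = _ := by rw [← Real.exp_add]; congr 1; ring
    refine le_trans ?_ (sum_le_sum h1)
    rw [← mul_sum]
    refine mul_le_mul_of_nonneg_left ?_ (Real.exp_pos _).le
    rw [sum_add_distrib, sum_sub_distrib, ← mul_sum, sum_comm]
    simp_rw [hre]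
    have h2 : ∑ _i : Fin n, (T.card : ℝ) / 2 ≤ ∑ i, ‖charSum T (l i)‖ :=
      sum_le_sum fun i _ => hspec i
    simp only [sum_const, card_univ, Fintype.card_fin, nsmul_eq_mul] at h2 ⊢
    linarith
  have hc : Real.cosh (1 / 2) ^ n ≤ Real.exp (n / 8) := by
    calc Real.cosh (1 / 2) ^ n ≤ Real.exp ((1 / 2) ^ 2 / 2) ^ n :=
          pow_le_pow_left₀ (Real.cosh_pos _).le (Real.cosh_le_exp_half_sq _) n
      _ = _ := by rw [← Real.exp_nat_mul]; congr 1; ring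
  have hd : Real.exp (-n) * Real.exp (1 / 2) ^ n ≤ Real.exp (n / 8) := by
    rw [← Real.exp_nat_mul, ← Real.exp_add, Real.exp_le_exp]
    have : (0 : ℝ) ≤ n := by positivity
    linarith
  have hfin : Real.exp (n / 4) * T.card ≤ (2 * Real.exp (n / 8)) * (M * T.card) := by
    refine hlow.trans ((sum_le_sum_of_subset_of_nonneg hTB fun _ _ _ => (Real.exp_pos _).le).trans
      (hup.trans ?_))
    have : (0 : ℝ) ≤ B.card := by positivity
    have e := Real.exp_pos ((n : ℝ) / 8)
    exact mul_le_mul (by linarith) hM this (by linarith)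
  have he : Real.exp ((n : ℝ) / 4) = Real.exp (n / 8) * Real.exp (n / 8) := by
    rw [← Real.exp_add]; congr 1; ring
  rw [he] at hfin
  have e := Real.exp_pos ((n : ℝ) / 8)
  have h1 : (Real.exp (n / 8) * T.card) * Real.exp ((n : ℝ) / 8) ≤
      (Real.exp (n / 8) * T.card) * (2 * M) := by linarith
  exact le_of_mul_le_mul_left h1 (by positivity)

lemma norm_charSum_mul_sub_le (B : Finset G) (ψ : AddChar G ℂ) (v : G) :
    ‖charSum B ψ‖ * ‖ψ v - 1‖ ≤ 2 * ((B.filter fun t => t + v ∉ B).card : ℝ) := by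
  have h1 : charSum B ψ * (ψ v - 1) =
      ∑ t ∈ B.filter (fun t => t + v ∉ B), ψ (t + v) -
        ∑ t ∈ B.filter (fun t => t - v ∉ B), ψ t := by
    have e1 : charSum B ψ * ψ v = ∑ t ∈ B.filter (fun t => t + v ∈ B), ψ (t + v) +
        ∑ t ∈ B.filter (fun t => t + v ∉ B), ψ (t + v) := by
      rw [sum_filter_add_sum_filter_not, charSum, sum_mul]
      exact sum_congr rfl fun t _ => (AddChar.map_add_eq_mul _ _ _).symm
    have e2 : charSum B ψ = ∑ t ∈ B.filter (fun t => t - v ∈ B), ψ t +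
        ∑ t ∈ B.filter (fun t => t - v ∉ B), ψ t := by
      rw [sum_filter_add_sum_filter_not, charSum]
    have e3 : ∑ t ∈ B.filter (fun t => t + v ∈ B), ψ (t + v) =
        ∑ t ∈ B.filter (fun t => t - v ∈ B), ψ t := by
      refine sum_bij' (fun t _ => t + v) (fun t _ => t - v) ?_ ?_ ?_ ?_ ?_ <;>
        simp +contextual
    rw [mul_sub, mul_one, e1, e3]
    rw [e2]
    ring
  have h2 : (B.filter fun t => t - v ∉ B).card = (B.filter fun t => t + v ∉ B).card := by
    have a1 := card_filter_add_card_filter_not (s := B) (fun t => t - v ∈ B)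
    have a2 := card_filter_add_card_filter_not (s := B) (fun t => t + v ∈ B)
    have a3 : (B.filter fun t => t - v ∈ B).card = (B.filter fun t => t + v ∈ B).card := by
      refine card_bij' (fun t _ => t - v) (fun t _ => t + v) ?_ ?_ ?_ ?_ <;> simp +contextual
    omega
  rw [← norm_mul, h1]
  refine (norm_sub_le _ _).trans ?_
  have b1 : ‖∑ t ∈ B.filter (fun t => t + v ∉ B), ψ (t + v)‖ ≤
      (B.filter fun t => t + v ∉ B).card := (norm_sum_le _ _).trans (by simp)
  have b2 : ‖∑ t ∈ B.filter (fun t => t - v ∉ B), ψ t‖ ≤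
      (B.filter fun t => t - v ∉ B).card := (norm_sum_le _ _).trans (by simp)
  rw [h2] at b2
  linarith

lemma norm_mul_sub_one_le (z w : ℂ) (hz : ‖z‖ = 1) : ‖z * w - 1‖ ≤ ‖z - 1‖ + ‖w - 1‖ := by
  have : z * w - 1 = z * (w - 1) + (z - 1) := by ring
  rw [this]
  refine (norm_add_le _ _).trans ?_
  rw [norm_mul, hz]; linarith

lemma norm_prod_sub_one_le {ι : Type*} (s : Finset ι) (z : ι → ℂ) (κ : ℝ)
    (hz : ∀ i ∈ s, ‖z i‖ = 1) (hκ : ∀ i ∈ s, ‖z i - 1‖ ≤ κ) :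
    ‖∏ i ∈ s, z i - 1‖ ≤ s.card * κ := by
  classical
  induction s using Finset.induction_on with
  | empty => simp
  | insert a s ha ih =>
    rw [prod_insert ha, card_insert_of_notMem ha]
    have h1 := norm_mul_sub_one_le (z a) (∏ i ∈ s, z i) (hz a (mem_insert_self _ _))
    have h2 := ih (fun i hi => hz i (mem_insert_of_mem hi))
      (fun i hi => hκ i (mem_insert_of_mem hi))
    have h3 := hκ a (mem_insert_self _ _)
    push_cast; linarith

lemma norm_inv_sub_one (z : ℂ) (hz : ‖z‖ = 1) : ‖z⁻¹ - 1‖ = ‖z - 1‖ := by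
  have hz0 : z ≠ 0 := by rintro rfl; simp at hz
  have : z⁻¹ - 1 = - (z⁻¹ * (z - 1)) := by field_simp; ring
  rw [this, norm_neg, norm_mul, norm_inv, hz]; simp

/-- Chang's lemma relative to a set `B`. -/
lemma chang (T B : Finset G) (hTB : T ⊆ B) (hT : T.Nonempty) (M : ℝ)
    (hM : (B.card : ℝ) ≤ M * T.card) (m : ℕ) (hm : 2 * M < Real.exp ((m + 1 : ℕ) / 8)) :
    ∃ Λ : Finset (AddChar G ℂ), Λ.card ≤ m ∧ ∀ (v : G) (κ ξ : ℝ), (∀ l ∈ Λ, ‖l v - 1‖ ≤ κ) →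
      0 ≤ κ → ((B.filter fun t => t + v ∉ B).card : ℝ) ≤ ξ * B.card →
      ∀ γ : AddChar G ℂ, (T.card : ℝ) / 2 ≤ ‖charSum T γ‖ →
        ‖γ v - 1‖ ≤ m * κ + 2 * Real.exp (m + 1 : ℕ) * ξ := by
  classical
  have hB : (0 : ℝ) < B.card := by exact_mod_cast (hT.mono hTB).card_pos
  set σ := Real.exp (-(m + 1 : ℕ)) with hσ
  let P : ℕ → Prop := fun n => ∃ l : Fin n → AddChar G ℂ, Dissociated B σ l ∧
    ∀ i, (T.card : ℝ) / 2 ≤ ‖charSum T (l i)‖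
  have hP0 : P 0 := ⟨fun i => i.elim0, fun ε _ hε => absurd (Subsingleton.elim _ _) hε,
    fun i => i.elim0⟩
  have hPm : ¬ P (m + 1) := by
    rintro ⟨l, hl, hspec⟩
    exact absurd (dissociated_card T B hTB hT M hM l hl hspec) (not_le.2 hm)
  have hex : ∃ n, n ≤ m ∧ P n ∧ ¬ P (n + 1) := by
    by_contra! hcon
    have : ∀ n ≤ m + 1, P n := by
      intro n
      induction n with
      | zero => exact fun _ => hP0
      | succ n ih => exact fun hn => hcon n (by omega) (ih (by omega))
    exact hPm (this _ le_rfl)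
  obtain ⟨n, hn, ⟨l, hl, hspec⟩, hnot⟩ := hex
  refine ⟨univ.image l, card_image_le.trans (by simpa using hn), ?_⟩
  intro v κ ξ hκ hκ0 hξ γ hγ
  have h1 : ¬ Dissociated B σ (Fin.cons γ l : Fin (n + 1) → AddChar G ℂ) := by
    intro h
    refine hnot ⟨_, h, fun i => ?_⟩
    refine Fin.cases ?_ (fun i => ?_) i
    · simpa using hγ
    · simpa using hspec i
  unfold Dissociated at h1
  push Not at h1
  obtain ⟨ε, hε, hε0, hlt⟩ := h1
  rw [Fintype.mem_piFinset] at hε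
  rw [Fin.sum_univ_succ] at hlt
  simp only [Fin.cons_zero, Fin.cons_succ] at hlt
  set φ : AddChar G ℂ := ∑ i : Fin n, ε i.succ • l i with hφ
  have hφv : ‖φ v - 1‖ ≤ m * κ := by
    rw [hφ, AddChar.sum_apply]
    refine (norm_prod_sub_one_le _ _ κ (fun i _ => ?_) (fun i _ => ?_)).trans ?_
    · simp
    · have hk := hκ (l i) (mem_image_of_mem _ (mem_univ i))
      have h2 := hε i.succ
      simp only [mem_insert, mem_singleton] at h2
      rw [AddChar.zsmul_apply]
      rcases h2 with h | h | h <;> rw [h]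
      · rw [zpow_neg_one, norm_inv_sub_one _ (by simp)]; exact hk
      · simpa using hκ0
      · simpa using hk
    · rw [card_univ, Fintype.card_fin]
      gcongr
  have hψ : ‖(ε 0 • γ + φ) v - 1‖ ≤ 2 * Real.exp (m + 1 : ℕ) * ξ := by
    have h2 := norm_charSum_mul_sub_le B (ε 0 • γ + φ) v
    have h3 : σ * B.card * ‖(ε 0 • γ + φ) v - 1‖ ≤ 2 * (ξ * B.card) := by
      refine le_trans ?_ (h2.trans (by linarith))
      gcongr
    have h4 : Real.exp (m + 1 : ℕ) * σ = 1 := by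
      rw [hσ, ← Real.exp_add, add_neg_cancel, Real.exp_zero]
    have h5 : ‖(ε 0 • γ + φ) v - 1‖ * B.card =
        Real.exp (m + 1 : ℕ) * (σ * B.card * ‖(ε 0 • γ + φ) v - 1‖) := by
      linear_combination (-(B.card * ‖(ε 0 • γ + φ) v - 1‖)) * h4
    refine le_of_mul_le_mul_right ?_ hB
    rw [h5]
    refine (mul_le_mul_of_nonneg_left h3 (Real.exp_pos _).le).trans (le_of_eq ?_)
    ring
  have key : ‖(ε 0 • γ) v - 1‖ ≤ m * κ + 2 * Real.exp (m + 1 : ℕ) * ξ := by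
    have e1 : (ε 0 • γ) v = (φ v)⁻¹ * (ε 0 • γ + φ) v := by
      rw [AddChar.add_apply]
      have : φ v ≠ 0 := by
        intro h; have := AddChar.norm_apply φ v; rw [h] at this; simp at this
      field_simp
    rw [e1]
    refine (norm_mul_sub_one_le _ _ (by simp)).trans ?_
    rw [norm_inv_sub_one _ (by simp)]
    linarith
  have h2 := hε 0
  simp only [mem_insert, mem_singleton] at h2
  rw [AddChar.zsmul_apply] at key
  rcases h2 with h | h | h <;> rw [h] at key
  · rwa [zpow_neg_one, norm_inv_sub_one _ (by simp)] at key
  · exfalso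
    have h3 : (fun i : Fin n => ε i.succ) ≠ 0 := by
      intro h4
      apply hε0
      funext i
      refine Fin.cases h (fun i => congrFun h4 i) i
    have h4 := hl _ (Fintype.mem_piFinset.2 fun i => hε i.succ) h3
    rw [h, zero_zsmul, zero_add] at hlt
    exact absurd h4 (not_le.2 hlt)
  · simpa using key

open Classical in
/-- The Bohr set of width `r` with frequency set `Γ`. -/
noncomputable def bohr (Γ : Finset (AddChar G ℂ)) (r : ℝ) : Finset G :=
  univ.filter fun x => ∀ γ ∈ Γ, ‖γ x - 1‖ ≤ r

lemma mem_bohr {Γ : Finset (AddChar G ℂ)} {r : ℝ} {x : G} :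
    x ∈ bohr Γ r ↔ ∀ γ ∈ Γ, ‖γ x - 1‖ ≤ r := by simp [bohr]

lemma zero_mem_bohr (Γ : Finset (AddChar G ℂ)) {r : ℝ} (hr : 0 ≤ r) : (0 : G) ∈ bohr Γ r := by
  rw [mem_bohr]; intro γ _; simpa using hr

lemma bohr_nonempty (Γ : Finset (AddChar G ℂ)) {r : ℝ} (hr : 0 ≤ r) : (bohr Γ r).Nonempty :=
  ⟨0, zero_mem_bohr Γ hr⟩

lemma neg_mem_bohr {Γ : Finset (AddChar G ℂ)} {r : ℝ} {x : G} (hx : x ∈ bohr Γ r) :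
    -x ∈ bohr Γ r := by
  rw [mem_bohr] at hx ⊢
  intro γ hγ
  rw [AddChar.map_neg_eq_inv, norm_inv_sub_one _ (by simp)]
  exact hx γ hγ

lemma add_mem_bohr {Γ : Finset (AddChar G ℂ)} {r s : ℝ} {x y : G} (hx : x ∈ bohr Γ r)
    (hy : y ∈ bohr Γ s) : x + y ∈ bohr Γ (r + s) := by
  rw [mem_bohr] at hx hy ⊢
  intro γ hγ
  rw [AddChar.map_add_eq_mul]
  exact (norm_mul_sub_one_le _ _ (by simp)).trans (add_le_add (hx γ hγ) (hy γ hγ))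

lemma sub_mem_bohr {Γ : Finset (AddChar G ℂ)} {r s : ℝ} {x y : G} (hx : x ∈ bohr Γ r)
    (hy : y ∈ bohr Γ s) : x - y ∈ bohr Γ (r + s) := by
  rw [sub_eq_add_neg]; exact add_mem_bohr hx (neg_mem_bohr hy)

lemma bohr_mono (Γ : Finset (AddChar G ℂ)) {r s : ℝ} (h : r ≤ s) : bohr Γ r ⊆ bohr Γ s := by
  intro x hx
  rw [mem_bohr] at hx ⊢
  exact fun γ hγ => (hx γ hγ).trans h

lemma bohr_anti {Γ Γ' : Finset (AddChar G ℂ)} (h : Γ ⊆ Γ') (r : ℝ) : bohr Γ' r ⊆ bohr Γ r := by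
  intro x hx
  rw [mem_bohr] at hx ⊢
  exact fun γ hγ => hx γ (h hγ)

lemma bohr_two (Γ : Finset (AddChar G ℂ)) : bohr Γ 2 = univ := by
  ext x
  rw [mem_bohr]
  simp only [mem_univ, iff_true]
  intro γ _
  refine (norm_sub_le _ _).trans ?_
  simp; norm_num

lemma bohr_sum_mem {Γ : Finset (AddChar G ℂ)} {r : ℝ} {n : ℕ} (s : Fin n → G)
    (hs : ∀ i, s i ∈ bohr Γ r) : ∑ i, s i ∈ bohr Γ (n * r) := by
  rw [mem_bohr]
  intro γ hγ
  rw [addChar_map_sum]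
  refine (norm_prod_sub_one_le _ _ r (by simp) fun i _ => mem_bohr.1 (hs i) γ hγ).trans ?_
  simp

lemma card_bohr_double (Γ : Finset (AddChar G ℂ)) {r : ℝ} (hr : 0 < r) :
    (bohr Γ (2 * r)).card ≤ 100 ^ Γ.card * (bohr Γ r).card := by
  classical
  let f : G → Γ → ℤ × ℤ := fun x γ => (⌊2 * ((γ.1 x - 1).re / r)⌋, ⌊2 * ((γ.1 x - 1).im / r)⌋)
  have h1 : (bohr Γ (2 * r)).card ≤ (bohr Γ r).card * ((bohr Γ (2 * r)).image f).card := by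
    refine card_le_mul_card_image _ _ ?_
    intro c hc
    obtain ⟨y, hy, rfl⟩ := mem_image.1 hc
    refine card_le_card_of_injOn (fun x => x - y) ?_ (by intro a _ b _ h; simpa using h)
    intro x hx
    rw [mem_coe, mem_filter] at hx
    rw [mem_coe, mem_bohr]
    intro γ hγ
    have h2 := congrFun hx.2 ⟨γ, hγ⟩
    simp only [f, Prod.mk.injEq] at h2
    have h3 := Int.abs_sub_lt_one_of_floor_eq_floor h2.1
    have h4 := Int.abs_sub_lt_one_of_floor_eq_floor h2.2
    have key : ∀ a b : ℝ, |2 * (a / r) - 2 * (b / r)| < 1 → (a - b) ^ 2 ≤ r ^ 2 / 4 := by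
      intro a b h
      have e : 2 * (a / r) - 2 * (b / r) = (a - b) * (2 / r) := by ring
      rw [e, abs_mul, abs_of_pos (by positivity : 0 < 2 / r)] at h
      have h5 : |a - b| < r / 2 := by
        rw [mul_div_assoc', div_lt_one hr] at h; linarith
      have h6 := sq_abs (a - b)
      nlinarith [abs_nonneg (a - b)]
    have h5 := key _ _ h3
    have h6 := key _ _ h4
    have h7 : ‖γ (x - y) - 1‖ = ‖γ x - γ y‖ := by
      have : γ x - γ y = γ y * (γ (x - y) - 1) := by
        rw [mul_sub, ← AddChar.map_add_eq_mul]; simp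
      rw [this, norm_mul]; simp
    rw [h7]
    refine abs_le_of_sq_le_sq' ?_ hr.le |>.2
    rw [Complex.sq_norm, Complex.normSq_apply]
    simp only [Complex.sub_re, Complex.sub_im] at h5 h6 ⊢
    nlinarith
  have h2 : ((bohr Γ (2 * r)).image f) ⊆
      Fintype.piFinset fun _ : Γ => (Icc (-4 : ℤ) 4 ×ˢ Icc (-4 : ℤ) 4) := by
    intro c hc
    obtain ⟨x, hx, rfl⟩ := mem_image.1 hc
    rw [Fintype.mem_piFinset]
    rintro ⟨γ, hγ⟩
    have h3 := mem_bohr.1 hx γ hγ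
    have key : ∀ a : ℝ, |a| ≤ 2 * r → ⌊2 * (a / r)⌋ ∈ Icc (-4 : ℤ) 4 := by
      intro a ha
      rw [abs_le] at ha
      have e1 : -2 ≤ a / r := by rw [le_div_iff₀ hr]; linarith
      have e2 : a / r ≤ 2 := by rw [div_le_iff₀ hr]; linarith
      rw [mem_Icc]
      constructor
      · rw [Int.le_floor]; push_cast; linarith
      · have : ⌊2 * (a / r)⌋ < 5 := by rw [Int.floor_lt]; push_cast; linarith
        omega
    rw [mem_product]
    exact ⟨key _ ((Complex.abs_re_le_norm _).trans h3), key _ ((Complex.abs_im_le_norm _).trans h3)⟩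
  have h3 := card_le_card h2
  rw [Fintype.card_piFinset] at h3
  simp only [card_product, Int.card_Icc, prod_const, card_univ, Fintype.card_coe] at h3
  have h4 : ((bohr Γ (2 * r)).image f).card ≤ 100 ^ Γ.card :=
    h3.trans (Nat.pow_le_pow_left (by decide) _)
  calc _ ≤ _ := h1
    _ ≤ (bohr Γ r).card * 100 ^ Γ.card := Nat.mul_le_mul_left _ h4
    _ = _ := mul_comm _ _

lemma card_le_bohr (Γ : Finset (AddChar G ℂ)) (n : ℕ) :
    Fintype.card G ≤ 100 ^ (Γ.card * n) * (bohr Γ (2 * (1 / 2) ^ n)).card := by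
  induction n with
  | zero => simp [bohr_two]
  | succ n ih =>
    have h := card_bohr_double Γ (r := 2 * (1 / 2) ^ (n + 1)) (by positivity)
    have e : (2 : ℝ) * (2 * (1 / 2) ^ (n + 1)) = 2 * (1 / 2) ^ n := by rw [pow_succ]; ring
    rw [e] at h
    calc _ ≤ _ := ih
      _ ≤ 100 ^ (Γ.card * n) * (100 ^ Γ.card * (bohr Γ (2 * (1 / 2) ^ (n + 1))).card) := by gcongr
      _ = _ := by rw [← mul_assoc, ← pow_add]; rfl

/-- Every Bohr set has a nearby width at which its size is stable. -/
lemma exists_regular (Γ : Finset (AddChar G ℂ)) (D q : ℕ) (hD : Γ.card < D) (hq : 0 < q)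
    {r : ℝ} (hr : 0 < r) : ∃ r', r / 2 ≤ r' ∧ r' ≤ r ∧
      ((bohr Γ (r' + r' / (14 * q * D))).card : ℝ) ≤ (1 + 1 / q) * (bohr Γ r').card := by
  by_contra! hcon
  have hD0 : 0 < D := by omega
  have hq' : (0 : ℝ) < q := by exact_mod_cast hq
  have hD' : (0 : ℝ) < D := by exact_mod_cast hD0
  have h1 : ∀ i ≤ 7 * q * D, (1 + 1 / (q : ℝ)) ^ i * (bohr Γ (r / 2)).card ≤
      (bohr Γ (r / 2 + i * (r / (14 * q * D)))).card := by
    intro i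
    induction i with
    | zero => intro _; simp
    | succ i ih =>
      intro hi
      have h2 := ih (by omega)
      have hi' : (i : ℝ) + 1 ≤ 7 * q * D := by exact_mod_cast hi
      have hle : r / 2 + i * (r / (14 * q * D)) ≤ r := by
        have : (i : ℝ) * (r / (14 * q * D)) ≤ (7 * q * D) * (r / (14 * q * D)) := by
          gcongr; linarith
        have e : (7 * q * D) * (r / (14 * q * D)) = r / 2 := by field_simp; ring
        linarith
      have hnn : 0 ≤ i * (r / (14 * q * D)) := by positivity
      have h3 := hcon (r / 2 + i * (r / (14 * q * D))) (by linarith) hle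
      have h4 : bohr Γ (r / 2 + i * (r / (14 * q * D)) +
          (r / 2 + i * (r / (14 * q * D))) / (14 * q * D)) ⊆
          bohr Γ (r / 2 + (i + 1 : ℕ) * (r / (14 * q * D))) := by
        refine bohr_mono Γ ?_
        have : (r / 2 + i * (r / (14 * q * D))) / (14 * q * D) ≤ r / (14 * q * D) := by gcongr
        push_cast; linarith
      have h5 : ((bohr Γ (r / 2 + i * (r / (14 * q * D)) +
          (r / 2 + i * (r / (14 * q * D))) / (14 * q * D))).card : ℝ) ≤
          (bohr Γ (r / 2 + (i + 1 : ℕ) * (r / (14 * q * D)))).card := by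
        exact_mod_cast card_le_card h4
      rw [pow_succ]
      have h6 := mul_le_mul_of_nonneg_left h2 (by positivity : 0 ≤ 1 + 1 / (q : ℝ))
      linarith
  have h2 := h1 _ le_rfl
  have e : r / 2 + (7 * q * D : ℕ) * (r / (14 * q * D)) = r := by push_cast; field_simp; ring
  rw [e] at h2
  have h3 : (2 : ℝ) ≤ (1 + 1 / (q : ℝ)) ^ q := by
    have h8 := one_add_mul_le_pow (a := 1 / (q : ℝ))
      (by linarith [show 0 ≤ 1 / (q : ℝ) by positivity]) q
    rw [mul_one_div_cancel hq'.ne'] at h8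
    linarith
  have h4 : (100 : ℝ) ^ D < (1 + 1 / (q : ℝ)) ^ (7 * q * D) := by
    calc (100 : ℝ) ^ D < (2 ^ 7) ^ D := pow_lt_pow_left₀ (by norm_num) (by norm_num) hD0.ne'
      _ ≤ (((1 + 1 / (q : ℝ)) ^ q) ^ 7) ^ D := by gcongr
      _ = _ := by rw [← pow_mul, ← pow_mul]; congr 1; ring
  have h5 := card_bohr_double Γ (r := r / 2) (by linarith)
  rw [mul_div_cancel₀ r (by norm_num : (2 : ℝ) ≠ 0)] at h5
  have h6 : ((bohr Γ r).card : ℝ) ≤ 100 ^ D * (bohr Γ (r / 2)).card := by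
    have : ((bohr Γ r).card : ℝ) ≤ 100 ^ Γ.card * (bohr Γ (r / 2)).card := by exact_mod_cast h5
    refine this.trans ?_
    gcongr
    · norm_num
  have h7 : (0 : ℝ) < (bohr Γ (r / 2)).card := by
    exact_mod_cast (bohr_nonempty Γ (by linarith : 0 ≤ r / 2)).card_pos
  nlinarith

/-- The frequency set of the dilate of a Bohr set by two. -/
lemma exists_dilate (hinj : Function.Injective fun c : G => c + c) (Γ : Finset (AddChar G ℂ)) :
    ∃ Γ' : Finset (AddChar G ℂ), Γ'.card ≤ Γ.card ∧
      ∀ r, bohr Γ' r = (bohr Γ r).image fun c => c + c := by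
  classical
  let d : G →+ G := AddMonoidHom.mk' (fun c => c + c) (fun a b => by abel)
  have hbij : Function.Bijective d := Finite.injective_iff_bijective.1 hinj
  let e : G ≃+ G := AddEquiv.ofBijective d hbij
  refine ⟨Γ.image fun γ => γ.compAddMonoidHom e.symm.toAddMonoidHom, card_image_le, fun r => ?_⟩
  ext y
  rw [mem_bohr, mem_image]
  constructor
  · intro h
    refine ⟨e.symm y, ?_, e.apply_symm_apply y⟩
    rw [mem_bohr]
    intro γ hγ
    exact h _ (mem_image_of_mem _ hγ)
  · rintro ⟨x, hx, rfl⟩ γ' hγ'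
    obtain ⟨γ, hγ, rfl⟩ := mem_image.1 hγ'
    have : e.symm (x + x) = x := e.symm_apply_apply x
    rw [AddChar.compAddMonoidHom_apply]
    change ‖γ (e.symm (x + x)) - 1‖ ≤ r
    rw [this]
    exact mem_bohr.1 hx γ hγ

lemma exists_regular_two (Γ : Finset (AddChar G ℂ)) (D : ℕ) (hD : Γ.card < D)
    {r : ℝ} (hr : 0 < r) : ∃ r', r / 2 ≤ r' ∧ r' ≤ r ∧
      ((bohr Γ (r' + r' / (14 * D))).card : ℝ) ≤ 2 * (bohr Γ r').card := by
  obtain ⟨r', h1, h2, h3⟩ := exists_regular Γ D 1 hD one_pos hr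
  refine ⟨r', h1, h2, ?_⟩
  norm_num at h3
  exact h3

/-- The number of steps in the iterated almost periodicity argument. -/
def stepCount (t : ℕ) : ℕ := t + 7

/-- The number of samples in the almost periodicity argument. -/
def sampleCount (t : ℕ) : ℕ := 2 ^ 26 * stepCount t ^ 2 * (t + 15 + stepCount t)

/-- The number of new frequencies needed in a density increment. -/
def rankCount (t : ℕ) : ℕ := 8 * ((t + 1) * sampleCount t + 2)

lemma sampleCount_exp_le (t : ℕ) : 2 * Real.exp (-(((1 / 2) ^ 12 / stepCount t : ℝ) ^ 2 *
    sampleCount t / 4)) ≤ ((1 / 2) ^ (t + 13) / stepCount t : ℝ) / 2 := by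
  set j := stepCount t with hj
  have hj0 : (0 : ℝ) < j := by rw [hj, stepCount]; positivity
  have h1 : (((1 / 2) ^ 12 / j : ℝ) ^ 2 * sampleCount t / 4) = (t + 15 + j : ℕ) := by
    rw [sampleCount, ← hj]; push_cast; field_simp; norm_num
  rw [h1]
  have h2 : Real.exp (-((t + 15 + j : ℕ) : ℝ)) ≤ (1 / 2) ^ (t + 15 + j) := by
    rw [Real.exp_neg, one_div, inv_pow]
    refine inv_anti₀ (by positivity) ?_
    rw [← mul_one ((t + 15 + j : ℕ) : ℝ), Real.exp_nat_mul]
    refine pow_le_pow_left₀ (by norm_num) ?_ _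
    have := Real.add_one_le_exp (1 : ℝ); linarith
  have h3 : (1 / 2 : ℝ) ^ j * j ≤ 1 := by
    have : (j : ℝ) ≤ 2 ^ j := by exact_mod_cast (Nat.lt_two_pow_self (n := j)).le
    calc (1 / 2 : ℝ) ^ j * j ≤ (1 / 2 : ℝ) ^ j * 2 ^ j := by gcongr
      _ = 1 := by rw [← mul_pow]; norm_num
  rw [div_div, le_div_iff₀ (by positivity)]
  have h4 : (1 / 2 : ℝ) ^ (t + 15 + j) * j ≤ (1 / 2) ^ (t + 15) := by
    rw [pow_add _ (t + 15), mul_assoc]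
    exact mul_le_of_le_one_right (by positivity) h3
  have h5 : (1 / 2 : ℝ) ^ (t + 13) = 4 * (1 / 2) ^ (t + 15) := by
    rw [pow_add, pow_add]; norm_num; ring
  have h6 := mul_le_mul_of_nonneg_right h2 hj0.le
  nlinarith

lemma rankCount_exp_lt (t : ℕ) : 2 * (2 * (2 ^ (t + 1) : ℝ) ^ sampleCount t) <
    Real.exp ((rankCount t + 1 : ℕ) / 8) := by
  have h1 : 2 * (2 * (2 ^ (t + 1) : ℝ) ^ sampleCount t) = 2 ^ ((t + 1) * sampleCount t + 2) := by
    rw [← pow_mul, pow_add]; ring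
  have h2 : (2 : ℝ) ≤ Real.exp 1 := by have := Real.add_one_le_exp (1 : ℝ); linarith
  rw [h1]
  calc (2 : ℝ) ^ ((t + 1) * sampleCount t + 2) ≤ Real.exp 1 ^ ((t + 1) * sampleCount t + 2) := by
        gcongr
    _ = Real.exp (((t + 1) * sampleCount t + 2 : ℕ) * 1) := by rw [Real.exp_nat_mul]
    _ < _ := by
        rw [Real.exp_lt_exp, rankCount]; push_cast; linarith

lemma spectrum_bound (T : Finset G) (v : G) (j : ℕ) (κ : ℝ) (hκ0 : 0 ≤ κ)
    (hκ : ∀ γ : AddChar G ℂ, (T.card : ℝ) / 2 ≤ ‖charSum T γ‖ → ‖γ v - 1‖ ≤ κ)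
    (γ : AddChar G ℂ) :
    ‖charSum T γ‖ ^ (2 * j) * ‖γ v - 1‖ ≤ (κ + 2 * (1 / 2) ^ (2 * j)) * T.card ^ (2 * j) := by
  have hT : (0 : ℝ) ≤ T.card := by positivity
  rw [add_mul]
  rcases le_or_gt ((T.card : ℝ) / 2) ‖charSum T γ‖ with h | h
  · have h1 := hκ γ h
    have h2 := pow_le_pow_left₀ (norm_nonneg _) (norm_charSum_le T γ) (2 * j)
    have h3 := mul_le_mul h2 h1 (norm_nonneg _) (by positivity)
    have h4 : 0 ≤ 2 * (1 / 2 : ℝ) ^ (2 * j) * T.card ^ (2 * j) := by positivity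
    linarith
  · have h1 : ‖γ v - 1‖ ≤ 2 := by
      refine (norm_sub_le _ _).trans ?_
      simp; norm_num
    have h2 := pow_le_pow_left₀ (norm_nonneg _) h.le (2 * j)
    have h3 := mul_le_mul h2 h1 (norm_nonneg _) (by positivity)
    have h4 : 0 ≤ κ * (T.card : ℝ) ^ (2 * j) := by positivity
    rw [div_eq_mul_inv, mul_pow] at h3
    rw [one_div]
    linarith

lemma card_not_mem_le (Γ : Finset (AddChar G ℂ)) {r s ξ : ℝ} (hs : 0 ≤ s)
    (h : ((bohr Γ (r + s)).card : ℝ) ≤ (1 + ξ) * (bohr Γ r).card) {v : G} (hv : v ∈ bohr Γ s) :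
    (((bohr Γ r).filter fun t => t + v ∉ bohr Γ r).card : ℝ) ≤ ξ * (bohr Γ r).card := by
  have h1 : ((bohr Γ r).filter fun t => t + v ∉ bohr Γ r).card ≤
      (bohr Γ (r + s) \ bohr Γ r).card := by
    refine card_le_card_of_injOn (fun t => t + v) ?_ (by intro a _ b _ h; simpa using h)
    intro t ht
    rw [mem_coe, mem_filter] at ht
    rw [mem_coe, mem_sdiff]
    exact ⟨add_mem_bohr ht.1 hv, ht.2⟩
  have h2 := card_sdiff_add_card_eq_card (bohr_mono Γ (by linarith : r ≤ r + s))
  have h3 : (((bohr Γ r).filter fun t => t + v ∉ bohr Γ r).card : ℝ) + (bohr Γ r).card ≤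
      (bohr Γ (r + s)).card := by
    exact_mod_cast (by omega)
  linarith

lemma le_rankCount (t : ℕ) : 8 * t + 24 ≤ rankCount t := by
  have h : 1 ≤ sampleCount t := by
    unfold sampleCount stepCount
    have : 0 < 2 ^ 26 * (t + 7) ^ 2 * (t + 15 + (t + 7)) := by positivity
    exact this
  have h2 := Nat.mul_le_mul_left (t + 1) h
  unfold rankCount
  omega

lemma div_two_pow_le_div {x y c : ℝ} {a b e : ℕ} (h : y / 2 ^ a ≤ x) (hc : 0 < c)
    (hcb : c ≤ 2 ^ b) (hy : 0 ≤ y) (he : a + b ≤ e) : y / 2 ^ e ≤ x / c := by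
  have hx : 0 ≤ x := le_trans (by positivity) h
  calc y / 2 ^ e ≤ y / 2 ^ (a + b) := by
        gcongr
        · norm_num
    _ = y / 2 ^ a / 2 ^ b := by rw [pow_add, div_div]
    _ ≤ x / 2 ^ b := by gcongr
    _ ≤ x / c := by gcongr

set_option maxHeartbeats 1000000 in
/-- A set of popular differences of two dense subsets of Bohr sets is dense on a translate
of a Bohr set of slightly larger rank. -/
lemma exists_bohr_translate_dense (Γ : Finset (AddChar G ℂ)) (D t : ℕ)
    (hD : Γ.card + rankCount t < D) (r₃ r₄ : ℝ) (hr₃ : 0 < r₃) (hr₄ : 0 < r₄)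
    (h₃ : ((bohr Γ (r₃ + r₃ / (14 * D))).card : ℝ) ≤ 2 * (bohr Γ r₃).card)
    (h₄ : ((bohr Γ (r₄ + r₄ / (14 * D))).card : ℝ) ≤ 2 * (bohr Γ r₄).card)
    (hr₄₃ : r₄ ≤ r₃ / (14 * D)) (z : G) (A₁ A₂ S : Finset G)
    (hA₁ : A₁ ⊆ (bohr Γ r₃).image fun d => d - z) (hA₂ : A₂ ⊆ bohr Γ r₄)
    (hA₁' : (1 / 2) ^ t * ((bohr Γ r₃).card : ℝ) ≤ A₁.card)
    (hA₂' : (1 / 2) ^ t * ((bohr Γ r₄).card : ℝ) ≤ A₂.card)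
    (hS : 512 * (∑ a ∈ A₁, ∑ b ∈ A₂, if a - b ∈ S then (0 : ℝ) else 1) ≤ A₁.card * A₂.card) :
    ∃ Λ : Finset (AddChar G ℂ), Λ.card ≤ rankCount t ∧ ∀ ρ, ρ ≤ r₄ / 2 ^ (10 * D) →
      ρ ≤ 1 / 2 ^ (2 * D) → ∃ w, 255 / 256 * ((bohr (Γ ∪ Λ) ρ).card : ℝ) ≤
        ∑ v ∈ bohr (Γ ∪ Λ) ρ, ind S (w + v) := by
  have hsc := sampleCount_exp_le t
  have hrc := rankCount_exp_lt t
  have hmt := le_rankCount t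
  have hk0 : 0 < sampleCount t := by unfold sampleCount stepCount; positivity
  obtain ⟨j, hj7, hj⟩ : ∃ j, j = t + 7 ∧ stepCount t = j := ⟨_, rfl, rfl⟩
  rw [hj] at hsc
  generalize rankCount t = m at *
  generalize sampleCount t = k at *
  have hDm : m < D := by omega
  have hD0 : (0 : ℝ) < D := by exact_mod_cast (by omega : 0 < D)
  have hj0 : (0 : ℝ) < j := by exact_mod_cast (by omega : 0 < j)
  have hm0 : (0 : ℝ) < m := by exact_mod_cast (by omega : 0 < m)
  have hDpow : (D : ℝ) ≤ 2 ^ D := by exact_mod_cast (Nat.lt_two_pow_self (n := D)).le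
  have h14D : (14 * D : ℝ) ≤ 2 ^ (2 * D) := by
    have : (14 : ℝ) ≤ 2 ^ D := by
      calc (14 : ℝ) ≤ 2 ^ 4 := by norm_num
        _ ≤ 2 ^ D := pow_le_pow_right₀ (by norm_num) (by omega)
    rw [two_mul, pow_add]
    exact mul_le_mul this hDpow hD0.le (by positivity)
  have h2j : (2 * j : ℝ) ≤ 2 ^ (2 * D) := by
    have : (j : ℝ) ≤ D := by exact_mod_cast (by omega : j ≤ D)
    linarith
  set τ₃ := r₃ / (14 * D) with hτ₃
  set τ₄ := r₄ / (14 * D) with hτ₄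
  have hτ₃0 : 0 < τ₃ := by positivity
  have hτ₄0 : 0 < τ₄ := by positivity
  have hτ₄r : τ₄ ≤ r₄ := by
    have : (1 : ℝ) ≤ D := by exact_mod_cast (by omega : 1 ≤ D)
    exact div_le_self hr₄.le (by linarith only [this])
  obtain ⟨q, hq0, hqm, hqD⟩ : ∃ q : ℕ, 0 < q ∧ (q : ℝ) = 2 * 4 ^ (m + 1) * 2 ^ (t + 13) ∧
      (q : ℝ) ≤ 2 ^ (3 * D) := by
    refine ⟨2 ^ (t + 2 * m + 16), Nat.two_pow_pos _, ?_, ?_⟩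
    · rw [(by norm_num : (4 : ℝ) = 2 ^ 2), ← pow_mul]; push_cast; ring
    · push_cast
      exact pow_le_pow_right₀ (by norm_num) (by omega)
  have hq0' : (0 : ℝ) < q := by exact_mod_cast hq0
  obtain ⟨r₅, hr₅, hr₅', hreg₅⟩ := exists_regular Γ D q (by omega) hq0
    (r := τ₄ / (2 * j)) (by positivity)
  have hr₅0 : 0 < r₅ := lt_of_lt_of_le (by positivity) hr₅
  set τ₅ := r₅ / (14 * q * D) with hτ₅
  have hτ₅0 : 0 < τ₅ := by positivity
  have hjr₅ : j * (r₅ + r₅) ≤ τ₄ := by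
    rw [le_div_iff₀ (by positivity)] at hr₅'
    linarith
  have hr₅τ₄ : r₅ ≤ τ₄ := by
    have h1 : (1 : ℝ) ≤ j := by exact_mod_cast (by omega : 1 ≤ j)
    have h2 := le_mul_of_one_le_left (by positivity : 0 ≤ r₅ + r₅) h1
    linarith only [h2, hjr₅, hr₅0]
  have hbig : r₄ / 2 ^ (10 * D) ≤ τ₅ := by
    have e1 : r₄ / 2 ^ (2 * D) ≤ τ₄ :=
      div_two_pow_le_div (a := 0) (by simp) (by positivity) h14D hr₄.le (by omega)
    have e2 : r₄ / 2 ^ (4 * D) ≤ τ₄ / (2 * j) :=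
      div_two_pow_le_div e1 (by positivity) h2j hr₄.le (by omega)
    have e3 : r₄ / 2 ^ (5 * D) ≤ τ₄ / (2 * j) / 2 :=
      div_two_pow_le_div (b := 1) e2 (by positivity) (by norm_num) hr₄.le (by omega)
    refine div_two_pow_le_div (b := 5 * D) (e3.trans hr₅) (by positivity) ?_ hr₄.le (by omega)
    calc (14 * q * D : ℝ) = (14 * D) * q := by ring
      _ ≤ 2 ^ (2 * D) * 2 ^ (3 * D) := by gcongr
      _ = 2 ^ (5 * D) := by rw [← pow_add]; congr 1; ring
  set T₀ := bohr Γ r₅ with hT₀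
  set Z := (bohr Γ (r₃ + τ₃)).image fun d => d - z with hZ
  have hZcard : (Z.card : ℝ) ≤ 2 * (bohr Γ r₃).card := by
    refine le_trans ?_ h₃
    exact_mod_cast card_image_le
  set S' := Z.filter fun x => x ∈ S with hS'
  have hB₃ : (0 : ℝ) < (bohr Γ r₃).card := by exact_mod_cast (bohr_nonempty Γ hr₃.le).card_pos
  have hB₄ : (0 : ℝ) < (bohr Γ r₄).card := by exact_mod_cast (bohr_nonempty Γ hr₄.le).card_pos
  have hA₁pos : (0 : ℝ) < A₁.card := lt_of_lt_of_le (by positivity) hA₁'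
  have hA₂pos : (0 : ℝ) < A₂.card := lt_of_lt_of_le (by positivity) hA₂'
  have hA₁ne : A₁.Nonempty := card_pos.1 (by exact_mod_cast hA₁pos)
  have hA₂ne : A₂.Nonempty := card_pos.1 (by exact_mod_cast hA₂pos)
  have hT₀ne : T₀.Nonempty := bohr_nonempty Γ hr₅0.le
  have hmemZ : ∀ a ∈ A₁, ∀ y ∈ bohr Γ τ₃, a + y ∈ Z := by
    intro a ha y hy
    obtain ⟨d, hd, rfl⟩ := mem_image.1 (hA₁ ha)
    exact mem_image.2 ⟨d + y, add_mem_bohr hd hy, by abel⟩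
  have htpow : (1 / 2 : ℝ) ^ t * 2 ^ t = 1 := by rw [← mul_pow]; norm_num
  have hratio : (Z.card : ℝ) / A₁.card ≤ 2 * 2 ^ t := by
    rw [div_le_iff₀ hA₁pos]
    have := mul_le_mul_of_nonneg_left hA₁' (by positivity : (0 : ℝ) ≤ 2 * 2 ^ t)
    have e : (2 * 2 ^ t : ℝ) * ((1 / 2) ^ t * (bohr Γ r₃).card) = 2 * (bohr Γ r₃).card := by
      linear_combination (2 * (bohr Γ r₃).card : ℝ) * htpow
    linarith
  obtain ⟨T, hTT₀, hTcard, hTap⟩ := croot_sisask (ind S') (ind_nonneg S') (ind_le_one S') A₂ T₀ Z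
    hA₂ne hT₀ne (2 ^ (t + 1)) (by
      have h1 : A₂ + T₀ ⊆ bohr Γ (r₄ + τ₄) := by
        intro x hx
        obtain ⟨a, ha, b, hb, rfl⟩ := mem_add.1 hx
        exact add_mem_bohr (hA₂ ha) (bohr_mono Γ hr₅τ₄ hb)
      have h2 : ((A₂ + T₀).card : ℝ) ≤ (bohr Γ (r₄ + τ₄)).card := by exact_mod_cast card_le_card h1
      have h3 := mul_le_mul_of_nonneg_left hA₂' (by positivity : (0 : ℝ) ≤ 2 ^ (t + 1))
      have e : (2 ^ (t + 1) : ℝ) * ((1 / 2) ^ t * (bohr Γ r₄).card) = 2 * (bohr Γ r₄).card := by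
        rw [pow_succ]
        linear_combination (2 * (bohr Γ r₄).card : ℝ) * htpow
      linarith)
    ((1 / 2) ^ 12 / j) ((1 / 2) ^ (t + 13) / j) (by positivity) (by
      rw [div_le_one hj0]
      have : (1 : ℝ) ≤ j := by exact_mod_cast (by omega : 1 ≤ j)
      have : (1 / 2 : ℝ) ^ 12 ≤ 1 := by norm_num
      linarith) (by positivity) k hk0 hsc
  have hTpos : (0 : ℝ) < T.card := by
    have h1 : (0 : ℝ) < T₀.card := by exact_mod_cast hT₀ne.card_pos
    by_contra! h
    have h2 : (T.card : ℝ) = 0 := le_antisymm h (by positivity)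
    rw [h2] at hTcard
    linarith
  have hTne : T.Nonempty := card_pos.1 (by exact_mod_cast hTpos)
  obtain ⟨Λ, hΛ, hΛ'⟩ := chang T T₀ hTT₀ hTne _ hTcard m hrc
  refine ⟨Λ, hΛ, fun ρ hρ₁ hρ₂ => ?_⟩
  set κ : ℝ := (1 / 2) ^ (t + 13) / m with hκ
  have hρκ : ρ ≤ κ := by
    refine hρ₂.trans (div_two_pow_le_div (y := 1) (a := D) (b := D) ?_ hm0 ?_ zero_le_one
      (by omega))
    · rw [one_div_pow]
      exact one_div_le_one_div_of_le (by positivity)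
        (pow_le_pow_right₀ (by norm_num) (by omega))
    · have : (m : ℝ) ≤ D := by exact_mod_cast hDm.le
      linarith
  have hξ : 2 * Real.exp (m + 1 : ℕ) * (1 / q) ≤ (1 / 2) ^ (t + 13) := by
    have h1 : Real.exp (m + 1 : ℕ) ≤ 4 ^ (m + 1) := by
      rw [← mul_one ((m + 1 : ℕ) : ℝ), Real.exp_nat_mul]
      refine pow_le_pow_left₀ (Real.exp_pos _).le ?_ _
      have := Real.exp_one_lt_d9; linarith
    rw [mul_one_div, div_le_iff₀ hq0', hqm]
    have h3 : (1 / 2 : ℝ) ^ (t + 13) * (2 * 4 ^ (m + 1) * 2 ^ (t + 13)) = 2 * 4 ^ (m + 1) := by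
      have : (1 / 2 : ℝ) ^ (t + 13) * 2 ^ (t + 13) = 1 := by rw [← mul_pow]; norm_num
      linear_combination (2 * 4 ^ (m + 1) : ℝ) * this
    rw [h3]; linarith
  obtain ⟨w, hw⟩ := exists_translate_dense S' A₁ A₂ T (bohr (Γ ∪ Λ) ρ) Z j ((1 / 2) ^ 12 / j)
    ((1 / 2) ^ (t + 13) / j) ((1 / 2) ^ (t + 12) + 2 * (1 / 2) ^ (2 * j)) (1 / 512)
    (by positivity) hA₁ne hA₂ne hTne hTap (by
      intro k hk s u hs hu a ha
      refine hmemZ a ha _ ?_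
      have h1 : ∑ i, (s i - u i) ∈ bohr Γ (k * (r₅ + r₅)) :=
        bohr_sum_mem _ fun i => sub_mem_bohr (hTT₀ (hs i)) (hTT₀ (hu i))
      refine bohr_mono Γ ?_ h1
      have h2 : (k : ℝ) ≤ j := by exact_mod_cast hk
      have h3 : (k : ℝ) * (r₅ + r₅) ≤ j * (r₅ + r₅) := by gcongr
      linarith) (by
      intro v hv
      refine spectrum_bound T v j _ (by positivity) fun γ hγ => ?_
      have h1 := hΛ' v κ (1 / q)
        (fun l hl => (mem_bohr.1 hv l (mem_union_right _ hl)).trans hρκ) (by positivity)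
        (card_not_mem_le Γ hτ₅0.le hreg₅ (bohr_mono Γ (hρ₁.trans hbig)
          (bohr_anti subset_union_left ρ hv))) γ hγ
      refine h1.trans ?_
      have h2 : m * κ = (1 / 2) ^ (t + 13) := by rw [hκ]; field_simp
      have h3 : (1 / 2 : ℝ) ^ (t + 12) = 2 * (1 / 2) ^ (t + 13) := by
        rw [pow_succ _ (t + 12)]; ring
      linarith) (by
      have h1 : ∀ a ∈ A₁, ∀ b ∈ A₂, ind S' (a - b) = 1 - if a - b ∈ S then (0 : ℝ) else 1 := by
        intro a ha b hb
        have h2 : a - b ∈ Z := by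
          rw [sub_eq_add_neg]
          exact hmemZ a ha _ (neg_mem_bohr (bohr_mono Γ hr₄₃ (hA₂ hb)))
        unfold ind
        simp only [hS', mem_filter, h2, true_and]
        split_ifs <;> simp
      rw [sum_congr rfl fun a ha => sum_congr rfl fun b hb => h1 a ha b hb]
      simp only [sum_sub_distrib, sum_const, nsmul_eq_mul, mul_one]
      linarith)
  refine ⟨w, ?_⟩
  have hmono : ∑ v ∈ bohr (Γ ∪ Λ) ρ, ind S' (w + v) ≤ ∑ v ∈ bohr (Γ ∪ Λ) ρ, ind S (w + v) := by
    refine sum_le_sum fun v _ => ?_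
    unfold ind
    simp only [hS', mem_filter]
    split_ifs with h1 h2 <;> simp_all
  refine le_trans (mul_le_mul_of_nonneg_right ?_ (by positivity)) (hw.trans hmono)
  have l1 : j * (2 * ((1 / 2) ^ 12 / j) + 2 * ((1 / 2) ^ (t + 13) / j) * (Z.card / A₁.card)) ≤
      (1 / 1024 : ℝ) := by
    have e1 : j * (2 * ((1 / 2) ^ 12 / j) + 2 * ((1 / 2) ^ (t + 13) / j) * (Z.card / A₁.card)) =
        (1 / 2048 : ℝ) + 2 * (1 / 2) ^ (t + 13) * (Z.card / A₁.card) := by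
      field_simp; ring
    have e2 : 2 * (1 / 2 : ℝ) ^ (t + 13) * (Z.card / A₁.card) ≤
        2 * (1 / 2 : ℝ) ^ (t + 13) * (2 * 2 ^ t) := by gcongr
    have e3 : 2 * (1 / 2 : ℝ) ^ (t + 13) * (2 * 2 ^ t) = 1 / 2048 := by
      rw [pow_add]
      linear_combination (1 / 2048 : ℝ) * htpow
    rw [e1]; linarith
  have l2 : ((1 / 2) ^ (t + 12) + 2 * (1 / 2) ^ (2 * j)) * √(S'.card / A₁.card) ≤
      (1 / 1024 : ℝ) := by
    have e1 : √((S'.card : ℝ) / A₁.card) ≤ 2 * 2 ^ t := by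
      rw [Real.sqrt_le_iff]
      refine ⟨by positivity, ?_⟩
      have h1 : (S'.card : ℝ) / A₁.card ≤ Z.card / A₁.card := by
        gcongr
        exact filter_subset _ _
      have h2 : (1 : ℝ) ≤ 2 ^ t := one_le_pow₀ (by norm_num)
      nlinarith only [h1, h2, hratio]
    have e2 : (2 : ℝ) * (1 / 2) ^ (2 * j) ≤ (1 / 2) ^ (t + 12) := by
      have : (1 / 2 : ℝ) ^ (2 * j) ≤ (1 / 2) ^ (t + 13) :=
        pow_le_pow_of_le_one (by norm_num) (by norm_num) (by omega)
      have h3 : (1 / 2 : ℝ) ^ (t + 12) = 2 * (1 / 2) ^ (t + 13) := by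
        rw [pow_succ _ (t + 12)]; ring
      linarith
    have e3 : ((1 / 2 : ℝ) ^ (t + 12) + (1 / 2) ^ (t + 12)) * (2 * 2 ^ t) = 1 / 1024 := by
      rw [pow_add]
      linear_combination (1 / 1024 : ℝ) * htpow
    rw [← e3]
    gcongr
  linarith

/-- If a set is dense on a translate of `B`, and `B` is nearly invariant under translation by
`B₁` and `B₂`, then the set is dense on average on a common translate of `B₁` and `B₂`. -/
lemma exists_common_translate (A B B₁ B₂ X : Finset G) (x₀ : G) (s : ℝ)
    (h₀ : s ≤ ((B.filter fun v => x₀ + v ∈ A).card : ℝ))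
    (hX₁ : ∀ b ∈ B, ∀ v ∈ B₁, b - v ∈ X) (hX₂ : ∀ b ∈ B, ∀ v ∈ B₂, b - v ∈ X)
    (hX : X.Nonempty) (hB₁ : B₁.Nonempty) (hB₂ : B₂.Nonempty) :
    ∃ x, 2 * s ≤ X.card * (((B₁.filter fun v => x + v ∈ A).card : ℝ) / B₁.card +
      ((B₂.filter fun v => x + v ∈ A).card : ℝ) / B₂.card) := by
  have key : ∀ T : Finset G, (∀ b ∈ B, ∀ v ∈ T, b - v ∈ X) → T.Nonempty →
      s ≤ ∑ x ∈ X, ((T.filter fun v => x₀ + x + v ∈ A).card : ℝ) / T.card := by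
    intro T hT hTne
    have hT0 : (0 : ℝ) < T.card := by exact_mod_cast hTne.card_pos
    rw [← sum_div, le_div_iff₀ hT0]
    have h1 : ∑ x ∈ X, (T.filter fun v => x₀ + x + v ∈ A).card =
        ∑ v ∈ T, (X.filter fun x => x₀ + x + v ∈ A).card := by
      simp only [card_filter]
      exact sum_comm
    have h2 : ∀ v ∈ T, (B.filter fun v => x₀ + v ∈ A).card ≤
        (X.filter fun x => x₀ + x + v ∈ A).card := by
      intro v hv
      refine card_le_card_of_injOn (fun b => b - v) ?_ (fun a _ b _ h => sub_left_injective h)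
      intro b hb
      rw [mem_coe, mem_filter] at hb
      rw [mem_coe, mem_filter]
      refine ⟨hT b hb.1 v hv, ?_⟩
      have : x₀ + (b - v) + v = x₀ + b := by abel
      rw [this]
      exact hb.2
    have h3 := sum_le_sum h2
    rw [sum_const, smul_eq_mul, ← h1] at h3
    have h4 : (T.card : ℝ) * ((B.filter fun v => x₀ + v ∈ A).card : ℝ) ≤
        ∑ x ∈ X, ((T.filter fun v => x₀ + x + v ∈ A).card : ℝ) := by exact_mod_cast h3
    nlinarith
  have h := add_le_add (key B₁ hX₁ hB₁) (key B₂ hX₂ hB₂)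
  rw [← sum_add_distrib] at h
  obtain ⟨x, -, hx⟩ := exists_le_of_sum_le (s := X) (f := fun _ => 2 * s / X.card)
    (g := fun x => ((B₁.filter fun v => x₀ + x + v ∈ A).card : ℝ) / B₁.card +
      ((B₂.filter fun v => x₀ + x + v ∈ A).card : ℝ) / B₂.card) hX (by
    rw [sum_const, nsmul_eq_mul, mul_div_cancel₀]
    · linarith
    · exact_mod_cast hX.card_pos.ne')
  refine ⟨x₀ + x, ?_⟩
  rw [div_le_iff₀ (by exact_mod_cast hX.card_pos)] at hx
  linarith

lemma card_bohr_dilate (hinj : Function.Injective fun c : G => c + c)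
    {Γ Γ' : Finset (AddChar G ℂ)} (h : ∀ r, bohr Γ' r = (bohr Γ r).image fun c => c + c) (r : ℝ) :
    (bohr Γ' r).card = (bohr Γ r).card := by
  rw [h, card_image_of_injective _ hinj]

lemma sifting_threshold (ℓ : ℕ) :
    2048 * (33 / 32 : ℝ) ^ (8 * (2 * ℓ + 24) + 1) ≤ 2 ^ (2 * ℓ + 24) / 2 := by
  have h1 : (33 / 32 : ℝ) ^ (8 * (2 * ℓ + 24) + 1) ≤ (33 / 32) * (4 / 3) ^ (2 * ℓ + 24) := by
    rw [pow_succ, mul_comm, pow_mul]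
    gcongr
    norm_num
  have h2 : (3 / 2 : ℝ) ^ 24 ≤ (3 / 2) ^ (2 * ℓ + 24) :=
    pow_le_pow_right₀ (by norm_num) (by omega)
  have h3 : (2 : ℝ) ^ (2 * ℓ + 24) = (3 / 2) ^ (2 * ℓ + 24) * (4 / 3) ^ (2 * ℓ + 24) := by
    rw [← mul_pow]; norm_num
  have h4 : (0 : ℝ) < (4 / 3) ^ (2 * ℓ + 24) := by positivity
  have h5 : (4224 : ℝ) ≤ (3 / 2) ^ (2 * ℓ + 24) := le_trans (by norm_num) h2
  rw [h3]
  nlinarith [mul_le_mul_of_nonneg_right h5 h4.le]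

set_option maxHeartbeats 1000000 in
/-- A pair of dense subsets of Bohr sets without solutions to `a + b = c + c` admits a density
increment on a Bohr set of slightly larger rank. -/
lemma exists_increment (hinj : Function.Injective fun c : G => c + c)
    (Γ : Finset (AddChar G ℂ)) (D ℓ p m t : ℕ) (hp : p = 2 * ℓ + 24) (hm : m = 8 * p + 1)
    (ht : t = (ℓ + 1) * m + 2) (hD : Γ.card + rankCount t < D)
    (r₁ r₂ : ℝ) (hr₂ : 0 < r₂) (hr₂1 : r₂ ≤ 1) (A C P : Finset G) (hA : A ⊆ bohr Γ r₁)
    (hC : C ⊆ bohr Γ r₂) (hP : bohr Γ (r₁ + 2 * r₂) ⊆ P)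
    (hreg : ((bohr Γ (r₂ + r₂ / (3584 * D))).card : ℝ) ≤ 2 * (bohr Γ r₂).card)
    (hA' : (1 / 2) ^ (ℓ + 1) * (P.card : ℝ) ≤ A.card)
    (hC' : (1 / 2) ^ (ℓ + 1) * ((bohr Γ r₂).card : ℝ) ≤ C.card)
    (hAne : A.Nonempty) (hfree : ∀ a ∈ A, ∀ b ∈ A, ∀ c ∈ C, a + b = c + c → a = c)
    (hW : 2 * (P.card : ℝ) ≤ (A.card : ℝ) ^ 2) :
    ∃ Γ' : Finset (AddChar G ℂ), Γ'.card ≤ Γ.card + rankCount t ∧ ∀ ρ, ρ ≤ r₂ / 2 ^ (15 * D) →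
      ∃ x, 255 / 256 * (33 / 32) * ((bohr Γ' ρ).card : ℝ) * A.card ≤
        P.card * (((bohr Γ' ρ).filter fun v => x + v ∈ A).card : ℝ) := by
  have hmt := le_rankCount t
  have hD24 : 24 < D := by omega
  have hD0 : (0 : ℝ) < D := by exact_mod_cast (by omega : 0 < D)
  have hD1 : (1 : ℝ) ≤ D := by exact_mod_cast (by omega : 1 ≤ D)
  have hDpow : (D : ℝ) ≤ 2 ^ D := by exact_mod_cast (Nat.lt_two_pow_self (n := D)).le
  have h3584 : (3584 * D : ℝ) ≤ 2 ^ (2 * D) := by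
    have : (3584 : ℝ) ≤ 2 ^ D := by
      calc (3584 : ℝ) ≤ 2 ^ 24 := by norm_num
        _ ≤ 2 ^ D := pow_le_pow_right₀ (by norm_num) (by omega)
    rw [two_mul, pow_add]
    exact mul_le_mul this hDpow hD0.le (by positivity)
  have h14 : (14 * D : ℝ) ≤ 2 ^ (2 * D) := by linarith only [h3584, hD0]
  obtain ⟨Γ₂, hΓ₂, hdil⟩ := exists_dilate hinj Γ
  have hcard : ∀ r, (bohr Γ₂ r).card = (bohr Γ r).card := card_bohr_dilate hinj hdil
  have hΓ₂sub : ∀ r, bohr Γ₂ r ⊆ bohr Γ (2 * r) := by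
    intro r x hx
    rw [hdil] at hx
    obtain ⟨c, hc, rfl⟩ := mem_image.1 hx
    rw [two_mul]
    exact add_mem_bohr hc hc
  set τ₂ := r₂ / (3584 * D) with hτ₂
  have hτ₂0 : 0 < τ₂ := by positivity
  have hτ₂r : τ₂ ≤ r₂ := div_le_self hr₂.le (by linarith only [hD1])
  obtain ⟨r₃, hr₃, hr₃', hreg₃⟩ := exists_regular_two Γ₂ D (by omega) (r := τ₂ / 2) (by positivity)
  have hr₃0 : 0 < r₃ := lt_of_lt_of_le (by positivity) hr₃
  set τ₃ := r₃ / (14 * D) with hτ₃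
  have hτ₃0 : 0 < τ₃ := by positivity
  obtain ⟨r₄, hr₄, hr₄', hreg₄⟩ := exists_regular_two Γ₂ D (by omega) (r := τ₃) hτ₃0
  have hr₄0 : 0 < r₄ := lt_of_lt_of_le (by positivity) hr₄
  have hA0 : (0 : ℝ) < A.card := by exact_mod_cast hAne.card_pos
  have hP0 : (0 : ℝ) < P.card := by
    obtain ⟨a, ha⟩ := hAne
    exact_mod_cast (card_pos.2 ⟨a, hP (bohr_mono Γ (by linarith only [hr₂]) (hA ha))⟩)
  have hB₂0 : (0 : ℝ) < (bohr Γ r₂).card := by exact_mod_cast (bohr_nonempty Γ hr₂.le).card_pos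
  have hC0 : (0 : ℝ) < C.card := lt_of_lt_of_le (by positivity) hC'
  have hCne : C.Nonempty := card_pos.1 (by exact_mod_cast hC0)
  have hmom := moment_of_free A P C (bohr Γ₂ r₂) (bohr Γ₂ r₃) (bohr Γ₂ (r₂ + τ₂))
    ((1 / 2) ^ (ℓ + 1)) p (by rw [hp]; exact ⟨ℓ + 12, by ring⟩) (by positivity) hinj hAne hCne
    (fun c hc => by rw [hdil]; exact mem_image_of_mem _ (hC hc))
    (fun a ha x hx => hP (bohr_mono Γ (by rw [add_comm])
      (sub_mem_bohr (hΓ₂sub _ hx) (hA ha))))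
    (fun a ha d₁ hd₁ d₂ hd₂ => hP (bohr_mono Γ (by linarith only [hr₃', hτ₂r])
      (add_mem_bohr (hA ha) (sub_mem_bohr (hΓ₂sub _ hd₁) (hΓ₂sub _ hd₂)))))
    (fun x hx d₁ hd₁ d₂ hd₂ => bohr_mono Γ₂ (by linarith only [hr₃'])
      (add_mem_bohr (sub_mem_bohr hx hd₁) hd₂))
    (by rw [hcard, hcard]; exact_mod_cast hreg) (by rw [hcard]; exact hC') hfree hW
    (by
      rw [hp, one_div_pow, div_div_eq_mul_div, div_one]
      calc (2 * 2 ^ (ℓ + 1) : ℝ) = 2 ^ (ℓ + 2) := by ring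
        _ ≤ _ := pow_le_pow_right₀ (by norm_num) (by omega))
  rw [← hm] at hmom
  obtain ⟨z, hz⟩ := moment_translate (fun x => P.card * rep A x / (A.card : ℝ) ^ 2)
    (fun x => by positivity) (bohr Γ₂ r₃) (bohr Γ₂ (r₃ + τ₃)) (bohr Γ₂ r₄) m (2 ^ p)
    (bohr_nonempty Γ₂ hr₃0.le)
    (fun d hd b hb => bohr_mono Γ₂ (by linarith only [hr₄']) (sub_mem_bohr hd hb))
    (by exact_mod_cast hreg₃) hmom (by positivity)
  have hinjz : Function.Injective fun d : G => d - z := sub_left_injective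
  obtain ⟨A₁, hA₁, A₂, hA₂, hA₁', hA₂', hS⟩ := sifting A ((bohr Γ₂ r₃).image fun d => d - z)
    (bohr Γ₂ r₄) m P.card (33 / 32) (2 ^ p / 2) hP0 hAne
    ((bohr_nonempty Γ₂ hr₃0.le).image _) (bohr_nonempty Γ₂ hr₄0.le) (by norm_num)
    (by
      have : (2 : ℝ) ^ 1 ≤ 2 ^ p := pow_le_pow_right₀ (by norm_num) (by omega)
      linarith only [this])
    (by rw [hm, hp]; exact sifting_threshold ℓ)
    (by
      rw [sum_image (fun a _ b _ h => hinjz h), card_image_of_injective _ hinjz]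
      exact hz)
  have hratio : (1 / 2 : ℝ) ^ t ≤ 1 / 4 * (A.card / P.card : ℝ) ^ m := by
    have h1 : (1 / 2 : ℝ) ^ (ℓ + 1) ≤ A.card / P.card := by rwa [le_div_iff₀ hP0]
    have h2 := pow_le_pow_left₀ (by positivity) h1 m
    rw [← pow_mul] at h2
    rw [ht, pow_add]
    linarith only [h2]
  rw [card_image_of_injective _ hinjz] at hA₁'
  obtain ⟨Λ, hΛ, hΛ'⟩ := exists_bohr_translate_dense Γ₂ D t (by omega) r₃ r₄ hr₃0 hr₄0 hreg₃ hreg₄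
    hr₄' z A₁ A₂ (univ.filter fun x => 33 / 32 * ((A.card : ℝ) ^ 2 / P.card) ≤ rep A x) hA₁ hA₂
    (le_trans (by gcongr) hA₁') (le_trans (by gcongr) hA₂')
    (by simpa only [mem_filter, mem_univ, true_and] using hS)
  refine ⟨Γ₂ ∪ Λ, (card_union_le _ _).trans (by omega), fun ρ hρ => ?_⟩
  have e1 : r₂ / 2 ^ (2 * D) ≤ τ₂ :=
    div_two_pow_le_div (a := 0) (by simp) (by positivity) h3584 hr₂.le (by omega)
  have e2 : r₂ / 2 ^ (2 * D + 1) ≤ τ₂ / 2 :=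
    div_two_pow_le_div (b := 1) e1 (by norm_num) (by norm_num) hr₂.le (by omega)
  have e3 : r₂ / 2 ^ (2 * D + 2) ≤ τ₂ / 2 / 2 :=
    div_two_pow_le_div (b := 1) e2 (by norm_num) (by norm_num) hr₂.le (by omega)
  have e4 : r₂ / 2 ^ (4 * D + 2) ≤ τ₃ :=
    div_two_pow_le_div (e3.trans hr₃) (by positivity) h14 hr₂.le (by omega)
  have e5 : r₂ / 2 ^ (4 * D + 3) ≤ τ₃ / 2 :=
    div_two_pow_le_div (b := 1) e4 (by norm_num) (by norm_num) hr₂.le (by omega)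
  have e6 : r₂ / 2 ^ (15 * D) ≤ r₄ / 2 ^ (10 * D) :=
    div_two_pow_le_div (e5.trans hr₄) (by positivity) le_rfl hr₂.le (by omega)
  have e7 : r₂ / 2 ^ (15 * D) ≤ 1 / 2 ^ (2 * D) :=
    div_le_div₀ zero_le_one hr₂1 (by positivity) (pow_le_pow_right₀ (by norm_num) (by omega))
  obtain ⟨w, hw⟩ := hΛ' ρ (hρ.trans e6) (hρ.trans e7)
  obtain ⟨x, hx⟩ := exists_dense_translate A (bohr (Γ₂ ∪ Λ) ρ) w
    (33 / 32 * ((A.card : ℝ) ^ 2 / P.card)) (255 / 256) hAne (by positivity) hw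
  refine ⟨x, ?_⟩
  have h1 : 255 / 256 * ((bohr (Γ₂ ∪ Λ) ρ).card : ℝ) * (33 / 32 * ((A.card : ℝ) ^ 2 / P.card)) =
      A.card * ((255 / 256 * (33 / 32) * ((bohr (Γ₂ ∪ Λ) ρ).card : ℝ) * A.card) / P.card) := by
    ring
  rw [h1] at hx
  have h2 := le_of_mul_le_mul_left hx hA0
  rw [div_le_iff₀ hP0] at h2
  linarith only [h2]

/-- The set `A` has density at least `α` on some translate of the Bohr set, whose radius is
regular. -/
def DenseOnBohr (A : Finset G) (Γ : Finset (AddChar G ℂ)) (D : ℕ) (r α : ℝ) : Prop :=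
  ((bohr Γ (r + r / (3584 * D))).card : ℝ) ≤ 257 / 256 * (bohr Γ r).card ∧
    ∃ x, α * (bohr Γ r).card ≤ (((bohr Γ r).filter fun v => x + v ∈ A).card : ℝ)

lemma exists_regular_fine (Γ : Finset (AddChar G ℂ)) (D : ℕ) (hD : Γ.card < D)
    {r : ℝ} (hr : 0 < r) : ∃ r', r / 2 ≤ r' ∧ r' ≤ r ∧
      ((bohr Γ (r' + r' / (3584 * D))).card : ℝ) ≤ 257 / 256 * (bohr Γ r').card := by
  obtain ⟨r', h1, h2, h3⟩ := exists_regular Γ D 256 hD (by norm_num) hr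
  refine ⟨r', h1, h2, ?_⟩
  have e1 : (14 * (256 : ℕ) * D : ℝ) = 3584 * D := by push_cast; ring
  have e2 : (1 + 1 / (256 : ℕ) : ℝ) = 257 / 256 := by norm_num
  rwa [e1, e2] at h3

set_option maxHeartbeats 1000000 in
/-- One step of the density increment: a dense set without solutions to `a + b = c + c` either gets
denser on a smaller Bohr set, or the Bohr set is already small. -/
lemma density_step (hinj : Function.Injective fun c : G => c + c)
    (A : Finset G) (hfree : ∀ a ∈ A, ∀ b ∈ A, ∀ c ∈ A, a + b = c + c → a = c)
    (Γ : Finset (AddChar G ℂ)) (D ℓ t : ℕ) (ht : t = (ℓ + 1) * (8 * (2 * ℓ + 24) + 1) + 2)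
    (hD : Γ.card + rankCount t < D) (ρ α : ℝ) (hρ : 0 < ρ) (hρ2 : ρ ≤ 2)
    (hα : (1 / 2) ^ ℓ ≤ α) (hA : DenseOnBohr A Γ D ρ α) :
    (∃ r, ρ / 2 ^ (20 * D) ≤ r ∧ ((bohr Γ r).card : ℝ) ≤ 2 ^ (2 * ℓ + 3)) ∨
      ∃ Γ' : Finset (AddChar G ℂ), ∃ r, Γ'.card ≤ Γ.card + rankCount t ∧ ρ / 2 ^ (20 * D) ≤ r ∧
        r ≤ 2 ∧ DenseOnBohr A Γ' D r (257 / 256 * α) := by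
  obtain ⟨hreg, x₀, hx₀⟩ := hA
  have hmt := le_rankCount t
  have hD24 : 24 < D := by omega
  have hD0 : (0 : ℝ) < D := by exact_mod_cast (by omega : 0 < D)
  have hD1 : (1 : ℝ) ≤ D := by exact_mod_cast (by omega : 1 ≤ D)
  have hDpow : (D : ℝ) ≤ 2 ^ D := by exact_mod_cast (Nat.lt_two_pow_self (n := D)).le
  have h3584 : (3584 * D : ℝ) ≤ 2 ^ (2 * D) := by
    have : (3584 : ℝ) ≤ 2 ^ D := by
      calc (3584 : ℝ) ≤ 2 ^ 24 := by norm_num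
        _ ≤ 2 ^ D := pow_le_pow_right₀ (by norm_num) (by omega)
    rw [two_mul, pow_add]
    exact mul_le_mul this hDpow hD0.le (by positivity)
  have hα0 : 0 < α := lt_of_lt_of_le (by positivity) hα
  set τ := ρ / (3584 * D) with hτ
  have hτ0 : 0 < τ := by positivity
  have hτ1 : τ ≤ 1 := by
    rw [hτ, div_le_one (by positivity)]
    linarith only [hρ2, hD1]
  obtain ⟨r₁, hr₁, hr₁', hreg₁⟩ := exists_regular_fine Γ D (by omega) hτ0
  have hr₁0 : 0 < r₁ := lt_of_lt_of_le (by positivity) hr₁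
  set τ₁ := r₁ / (3584 * D) with hτ₁
  have hτ₁0 : 0 < τ₁ := by positivity
  have hτ₁r : τ₁ ≤ r₁ := div_le_self hr₁0.le (by linarith only [hD1])
  obtain ⟨r₂, hr₂, hr₂', hreg₂⟩ := exists_regular_fine Γ D (by omega)
    (r := τ₁ / 2) (by positivity)
  have hr₂0 : 0 < r₂ := lt_of_lt_of_le (by positivity) hr₂
  have e1 : ρ / 2 ^ (2 * D) ≤ τ :=
    div_two_pow_le_div (a := 0) (by simp) (by positivity) h3584 hρ.le (by omega)
  have e2 : ρ / 2 ^ (2 * D + 1) ≤ r₁ :=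
    (div_two_pow_le_div (b := 1) e1 (by norm_num) (by norm_num) hρ.le (by omega)).trans hr₁
  have e3 : ρ / 2 ^ (4 * D + 1) ≤ τ₁ :=
    div_two_pow_le_div e2 (by positivity) h3584 hρ.le (by omega)
  have e4 : ρ / 2 ^ (4 * D + 2) ≤ τ₁ / 2 :=
    div_two_pow_le_div (b := 1) e3 (by norm_num) (by norm_num) hρ.le (by omega)
  have e5 : ρ / 2 ^ (4 * D + 3) ≤ r₂ :=
    (div_two_pow_le_div (b := 1) e4 (by norm_num) (by norm_num) hρ.le (by omega)).trans hr₂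
  have e6 : ρ / 2 ^ (19 * D + 3) ≤ r₂ / 2 ^ (15 * D) :=
    div_two_pow_le_div e5 (by positivity) le_rfl hρ.le (by omega)
  have e7 : ρ / 2 ^ (20 * D) ≤ r₂ / 2 ^ (15 * D) / 2 :=
    div_two_pow_le_div (b := 1) e6 (by norm_num) (by norm_num) hρ.le (by omega)
  have hmono : ∀ {a b : ℕ} {y : ℝ}, ρ / 2 ^ a ≤ y → a ≤ b → ρ / 2 ^ b ≤ y := by
    intro a b y h hab
    refine le_trans ?_ h
    exact div_le_div_of_nonneg_left hρ.le (by positivity)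
      (pow_le_pow_right₀ (by norm_num) hab)
  have hB : (0 : ℝ) < (bohr Γ ρ).card := by exact_mod_cast (bohr_nonempty Γ hρ.le).card_pos
  have hB₁ : (0 : ℝ) < (bohr Γ r₁).card := by exact_mod_cast (bohr_nonempty Γ hr₁0.le).card_pos
  have hB₂ : (0 : ℝ) < (bohr Γ r₂).card := by exact_mod_cast (bohr_nonempty Γ hr₂0.le).card_pos
  obtain ⟨x, hx⟩ := exists_common_translate A (bohr Γ ρ) (bohr Γ r₁) (bohr Γ r₂) (bohr Γ (ρ + τ))
    x₀ (α * (bohr Γ ρ).card) hx₀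
    (fun b hb v hv => bohr_mono Γ (by linarith only [hr₁']) (sub_mem_bohr hb hv))
    (fun b hb v hv => bohr_mono Γ (by linarith only [hr₁', hr₂', hτ₁r, hτ₁0]) (sub_mem_bohr hb hv))
    (bohr_nonempty Γ (by positivity)) (bohr_nonempty Γ hr₁0.le) (bohr_nonempty Γ hr₂0.le)
  obtain ⟨A', hA'⟩ : ∃ A', A' = (bohr Γ r₁).filter fun v => x + v ∈ A := ⟨_, rfl⟩
  obtain ⟨C, hC⟩ : ∃ C, C = (bohr Γ r₂).filter fun v => x + v ∈ A := ⟨_, rfl⟩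
  rw [← hA', ← hC] at hx
  have hsum : 2 * α ≤ 257 / 256 * ((A'.card : ℝ) / (bohr Γ r₁).card +
      (C.card : ℝ) / (bohr Γ r₂).card) := by
    refine le_of_mul_le_mul_right ?_ hB
    calc 2 * α * (bohr Γ ρ).card = 2 * (α * (bohr Γ ρ).card) := by ring
      _ ≤ _ := hx
      _ ≤ 257 / 256 * (bohr Γ ρ).card * _ := by gcongr
      _ = _ := by ring
  by_cases h₁ : 257 / 256 * α ≤ (A'.card : ℝ) / (bohr Γ r₁).card
  · refine Or.inr ⟨Γ, r₁, by omega, hmono e2 (by omega), by linarith only [hr₁', hτ1], hreg₁, x, ?_⟩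
    rw [← hA']
    exact (le_div_iff₀ hB₁).1 h₁
  by_cases h₂ : 257 / 256 * α ≤ (C.card : ℝ) / (bohr Γ r₂).card
  · refine Or.inr ⟨Γ, r₂, by omega, hmono e5 (by omega),
      by linarith only [hr₁', hτ1, hr₂', hτ₁r, hτ₁0], hreg₂, x, ?_⟩
    rw [← hC]
    exact (le_div_iff₀ hB₂).1 h₂
  push Not at h₁ h₂
  have h₃ : 253 / 256 * α ≤ (A'.card : ℝ) / (bohr Γ r₁).card := by
    linarith only [hsum, h₂, hα0]
  have h₄ : 253 / 256 * α ≤ (C.card : ℝ) / (bohr Γ r₂).card := by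
    linarith only [hsum, h₁, hα0]
  rw [le_div_iff₀ hB₁] at h₃
  rw [le_div_iff₀ hB₂] at h₄
  obtain ⟨P, hP⟩ : ∃ P, P = bohr Γ (r₁ + τ₁) := ⟨_, rfl⟩
  rw [← hP] at hreg₁
  have hB₁P : ((bohr Γ r₁).card : ℝ) ≤ P.card := by
    rw [hP]
    exact_mod_cast card_le_card (bohr_mono Γ (by linarith only [hτ₁0]))
  have hP0 : (0 : ℝ) < P.card := hB₁.trans_le hB₁P
  have h₅ : 253 / 257 * α * P.card ≤ A'.card := by
    have := mul_le_mul_of_nonneg_left hreg₁ hα0.le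
    linarith only [this, h₃]
  have h₆ : (1 / 2) ^ (ℓ + 1) * (P.card : ℝ) ≤ A'.card := by
    have h := mul_le_mul_of_nonneg_right hα hP0.le
    rw [pow_succ]
    linarith only [h, h₅, mul_pos hα0 hP0]
  have h₇ : (1 / 2) ^ (ℓ + 1) * ((bohr Γ r₂).card : ℝ) ≤ C.card := by
    have h := mul_le_mul_of_nonneg_right hα hB₂.le
    rw [pow_succ]
    linarith only [h, h₄, mul_pos hα0 hB₂]
  have hA'0 : (0 : ℝ) < A'.card := lt_of_lt_of_le (by positivity) h₆
  by_cases hW : 2 * (P.card : ℝ) ≤ (A'.card : ℝ) ^ 2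
  · right
    obtain ⟨Γ', hΓ', h⟩ := exists_increment hinj Γ D ℓ _ _ t rfl rfl ht hD r₁ r₂ hr₂0
      (by linarith only [hr₁', hτ1, hr₂', hτ₁r, hτ₁0]) A' C P (hA' ▸ filter_subset _ _)
      (hC ▸ filter_subset _ _) (hP ▸ bohr_mono Γ (by linarith only [hr₂']))
      (hreg₂.trans (by linarith only [hB₂])) h₆ h₇ (card_pos.1 (by exact_mod_cast hA'0))
      (by
        intro a ha b hb c hc habc
        rw [hA', mem_filter] at ha hb
        rw [hC, mem_filter] at hc
        refine add_left_cancel (a := x) (hfree _ ha.2 _ hb.2 _ hc.2 ?_)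
        rw [add_add_add_comm, habc, add_add_add_comm]) hW
    obtain ⟨r, hr, hr', hregr⟩ := exists_regular_fine Γ' D (by omega)
      (r := r₂ / 2 ^ (15 * D)) (by positivity)
    refine ⟨Γ', r, hΓ', e7.trans hr, ?_, hregr, ?_⟩
    · have : r₂ / 2 ^ (15 * D) ≤ r₂ := div_le_self hr₂0.le (one_le_pow₀ (by norm_num))
      linarith only [hr₁', hτ1, hr₂', hτ₁r, hτ₁0, this, hr']
    · obtain ⟨y, hy⟩ := h r hr'
      refine ⟨x + y, ?_⟩
      have h8 : (((bohr Γ' r).filter fun v => y + v ∈ A').card : ℝ) ≤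
          (((bohr Γ' r).filter fun v => x + y + v ∈ A).card : ℝ) := by
        have : ((bohr Γ' r).filter fun v => y + v ∈ A') ⊆
            (bohr Γ' r).filter fun v => x + y + v ∈ A := by
          refine monotone_filter_right _ fun v _ hv => ?_
          rw [hA', mem_filter] at hv
          rw [add_assoc]
          exact hv.2
        exact_mod_cast card_le_card this
      refine le_trans ?_ h8
      refine le_of_mul_le_mul_left (le_trans ?_ hy) hP0
      have h9 := mul_le_mul_of_nonneg_left h₅
        (by positivity : (0 : ℝ) ≤ 255 / 256 * (33 / 32) * ((bohr Γ' r).card : ℝ))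
      have h10 : 0 ≤ α * P.card * ((bohr Γ' r).card : ℝ) := by positivity
      linarith only [h9, h10]
  · left
    refine ⟨r₁, hmono e2 (by omega), hB₁P.trans ?_⟩
    push Not at hW
    by_contra! hcon
    have h8 : ((1 / 2) ^ (ℓ + 1) * (P.card : ℝ)) ^ 2 < 2 * P.card :=
      lt_of_le_of_lt (pow_le_pow_left₀ (by positivity) h₆ 2) hW
    have h9 : ((1 / 2 : ℝ) ^ (ℓ + 1)) ^ 2 * 2 ^ (2 * ℓ + 3) = 2 := by
      rw [← pow_mul, (by ring : 2 * ℓ + 3 = (ℓ + 1) * 2 + 1), pow_succ, ← mul_assoc, ← mul_pow]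
      norm_num
    have h10 : ((1 / 2 : ℝ) ^ (ℓ + 1)) ^ 2 * 2 ^ (2 * ℓ + 3) * P.card ≤
        ((1 / 2 : ℝ) ^ (ℓ + 1)) ^ 2 * P.card * P.card := by gcongr
    rw [h9] at h10
    have h11 : ((1 / 2) ^ (ℓ + 1) * (P.card : ℝ)) ^ 2 =
      ((1 / 2 : ℝ) ^ (ℓ + 1)) ^ 2 * P.card * P.card := by ring
    linarith only [h8, h10, h11]

/-- The rank gained in one density increment at density `2 ^ (-ℓ)`. -/
def rankGain (ℓ : ℕ) : ℕ := rankCount ((ℓ + 1) * (8 * (2 * ℓ + 24) + 1) + 2)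

/-- A strict bound for the ranks of all Bohr sets in the density increment. -/
def rankBound (ℓ : ℕ) : ℕ := 256 * (ℓ + 1) * rankGain ℓ + 1

/-- The logarithm of the largest possible order of the group. -/
def logBound (ℓ : ℕ) : ℕ :=
  rankBound ℓ * (20 * rankBound ℓ * (256 * (ℓ + 1)) + 1) + (2 * ℓ + 3)

lemma density_iterate (hinj : Function.Injective fun c : G => c + c)
    (A : Finset G) (hfree : ∀ a ∈ A, ∀ b ∈ A, ∀ c ∈ A, a + b = c + c → a = c)
    (K D ℓ : ℕ) (hD : K * rankGain ℓ < D) (α : ℝ) (hα : (1 / 2) ^ ℓ ≤ α)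
    (hA : α * Fintype.card G ≤ A.card) (i : ℕ) (hi : i ≤ K) :
    (∃ Γ : Finset (AddChar G ℂ), ∃ r, Γ.card < D ∧ 1 / 2 ^ (20 * D * K) ≤ r ∧
      ((bohr Γ r).card : ℝ) ≤ 2 ^ (2 * ℓ + 3)) ∨
    ∃ Γ : Finset (AddChar G ℂ), ∃ r, Γ.card ≤ i * rankGain ℓ ∧ 1 / 2 ^ (20 * D * i) ≤ r ∧
      r ≤ 2 ∧ DenseOnBohr A Γ D r ((257 / 256) ^ i * α) := by
  induction i with
  | zero =>
    right
    have h : ∀ r, bohr (∅ : Finset (AddChar G ℂ)) r = univ := fun r => by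
      ext x
      simp [mem_bohr]
    refine ⟨∅, 1, by simp, by simp, by norm_num, ?_, 0, ?_⟩
    · rw [h, h]
      have : (0 : ℝ) ≤ (univ : Finset G).card := by positivity
      linarith
    · simp only [h, zero_add, filter_mem_eq_inter, univ_inter, card_univ, pow_zero, one_mul]
      exact hA
  | succ i ih =>
    rcases ih (by omega) with h | ⟨Γ, r, hΓ, hr, hr2, hdense⟩
    · exact Or.inl h
    · have h1 : (i + 1) * rankGain ℓ ≤ K * rankGain ℓ := Nat.mul_le_mul_right _ hi
      have h2 : (i + 1) * rankGain ℓ = i * rankGain ℓ + rankGain ℓ := by ring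
      have hr0 : 0 < r := lt_of_lt_of_le (by positivity) hr
      have hα0 : 0 < α := lt_of_lt_of_le (by positivity) hα
      have h3 : (1 : ℝ) / 2 ^ (20 * D * (i + 1)) ≤ r / 2 ^ (20 * D) := by
        rw [mul_add, pow_add, mul_one, ← div_div]
        gcongr
      have h4 : (1 / 2) ^ ℓ ≤ (257 / 256) ^ i * α :=
        hα.trans (le_mul_of_one_le_left hα0.le (one_le_pow₀ (by norm_num)))
      rcases density_step hinj A hfree Γ D ℓ _ rfl
        (by change Γ.card + rankGain ℓ < D; omega) r _ hr0 hr2 h4 hdense with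
        ⟨s, hs, hcard⟩ | ⟨Γ', s, hΓ', hs, hs2, hdense'⟩
      · refine Or.inl ⟨Γ, s, by omega, (h3.trans hs).trans' ?_, hcard⟩
        exact one_div_le_one_div_of_le (by positivity)
          (pow_le_pow_right₀ (by norm_num) (Nat.mul_le_mul_left _ hi))
      · refine Or.inr ⟨Γ', s, ?_, h3.trans hs, hs2, ?_⟩
        · change Γ'.card ≤ Γ.card + rankGain ℓ at hΓ'
          omega
        · rwa [← mul_assoc, ← pow_succ'] at hdense'

/-- A finite abelian group of odd order that contains a dense set without nontrivial solutions
to `a + b = c + c` is small. -/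
theorem card_le_of_free (hinj : Function.Injective fun c : G => c + c)
    (A : Finset G) (hfree : ∀ a ∈ A, ∀ b ∈ A, ∀ c ∈ A, a + b = c + c → a = c) (ℓ : ℕ)
    (hA : (1 / 2) ^ ℓ * (Fintype.card G : ℝ) ≤ A.card) :
    (Fintype.card G : ℝ) ≤ 100 ^ logBound ℓ := by
  rcases density_iterate hinj A hfree (256 * (ℓ + 1)) (rankBound ℓ) ℓ (Nat.lt_succ_self _)
    ((1 / 2) ^ ℓ) le_rfl hA _ le_rfl with ⟨Γ, r, hΓ, hr, hcard⟩ | ⟨Γ, r, -, hr, -, -, x, hx⟩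
  · have h1 := card_le_bohr Γ (20 * rankBound ℓ * (256 * (ℓ + 1)) + 1)
    have h2 : bohr Γ (2 * (1 / 2) ^ (20 * rankBound ℓ * (256 * (ℓ + 1)) + 1)) ⊆ bohr Γ r := by
      refine bohr_mono Γ (le_trans (le_of_eq ?_) hr)
      rw [pow_succ, one_div_pow]
      ring
    calc (Fintype.card G : ℝ)
        ≤ 100 ^ (Γ.card * (20 * rankBound ℓ * (256 * (ℓ + 1)) + 1)) * (bohr Γ r).card := by
          refine le_trans ?_ (mul_le_mul_of_nonneg_left
            (Nat.cast_le.2 (card_le_card h2)) (by positivity))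
          exact_mod_cast h1
      _ ≤ 100 ^ (rankBound ℓ * (20 * rankBound ℓ * (256 * (ℓ + 1)) + 1)) *
          100 ^ (2 * ℓ + 3) := by
          gcongr
          · norm_num
          · exact hcard.trans (pow_le_pow_left₀ (by norm_num) (by norm_num) _)
      _ = 100 ^ logBound ℓ := by rw [← pow_add]; rfl
  · exfalso
    have hr0 : 0 ≤ r := le_trans (by positivity) hr
    have hB : (0 : ℝ) < (bohr Γ r).card := by exact_mod_cast (bohr_nonempty Γ hr0).card_pos
    have h1 : (2 : ℝ) ≤ (257 / 256) ^ 256 := by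
      have := one_add_mul_le_pow (a := (1 / 256 : ℝ)) (by norm_num) 256
      norm_num at this ⊢
    have h2 : (2 : ℝ) ^ (ℓ + 1) ≤ (257 / 256) ^ (256 * (ℓ + 1)) := by
      rw [pow_mul]
      exact pow_le_pow_left₀ (by norm_num) h1 _
    have h3 : (2 : ℝ) ≤ (257 / 256) ^ (256 * (ℓ + 1)) * (1 / 2) ^ ℓ := by
      have h4 : (2 : ℝ) ^ (ℓ + 1) * (1 / 2) ^ ℓ = 2 := by
        rw [pow_succ', mul_assoc, ← mul_pow]; norm_num
      exact h4.symm.le.trans (mul_le_mul_of_nonneg_right h2 (by positivity))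
    have h5 : (((bohr Γ r).filter fun v => x + v ∈ A).card : ℝ) ≤ (bohr Γ r).card := by
      exact_mod_cast card_filter_le _ _
    have h6 := mul_le_mul_of_nonneg_right h3 hB.le
    linarith

open Polynomial in
lemma exists_logBound_le : ∃ C : ℝ, 0 < C ∧ ∀ ℓ : ℕ, (5 * logBound ℓ : ℝ) ^ 2 ≤ C * 2 ^ ℓ := by
  obtain ⟨P, hP⟩ : ∃ P : ℝ[X], ∀ ℓ : ℕ, (5 * logBound ℓ : ℝ) ^ 2 = P.eval (ℓ : ℝ) := by
    let t : ℝ[X] := (X + 1) * (8 * (2 * X + 24) + 1) + 2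
    let R : ℝ[X] := 8 * ((t + 1) * (2 ^ 26 * (t + 7) ^ 2 * (t + 15 + (t + 7))) + 2)
    let D : ℝ[X] := 256 * (X + 1) * R + 1
    refine ⟨(5 * (D * (20 * D * (256 * (X + 1)) + 1) + (2 * X + 3))) ^ 2, fun ℓ => ?_⟩
    simp [D, R, t, logBound, rankBound, rankGain, rankCount, sampleCount, stepCount]
    norm_num
  have hlog : (0 : ℝ) < Real.log 2 := Real.log_pos (by norm_num)
  have h1 := (Polynomial.tendsto_div_exp_atTop (P.comp (Polynomial.C (Real.log 2)⁻¹ * X))).comp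
    ((tendsto_natCast_atTop_atTop (R := ℝ)).atTop_mul_const hlog)
  obtain ⟨C, hC⟩ := h1.bddAbove_range
  refine ⟨max C 1, by positivity, fun ℓ => ?_⟩
  have h2 := hC ⟨ℓ, rfl⟩
  have h3 : Real.exp (ℓ * Real.log 2) = 2 ^ ℓ := by
    rw [Real.exp_nat_mul, Real.exp_log (by norm_num)]
  have h4 : (Real.log 2)⁻¹ * (ℓ * Real.log 2) = ℓ := by field_simp
  simp only [Function.comp_apply, eval_comp, eval_mul, eval_C, eval_X, h3, h4] at h2
  rw [← hP, div_le_iff₀ (by positivity)] at h2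
  exact h2.trans (by gcongr; exact le_max_left _ _)

end KelleyMeka

/-- Bloom–Sisask: `r₃(N) = O(N / (log N)^{1+c})` for some absolute `c > 0`. -/
theorem bloom_sisask :
    ∃ c C : ℝ, 0 < c ∧ 0 < C ∧ ∀ N : ℕ, 2 ≤ N → ∀ A : Finset ℤ, A ⊆ Finset.Icc 1 (N : ℤ) →
      (¬ ∃ x y : ℤ, y ≠ 0 ∧ x ∈ A ∧ x + y ∈ A ∧ x + 2 * y ∈ A) →
      (A.card : ℝ) ≤ C * N / (Real.log N) ^ (1 + c : ℝ) := by
  obtain ⟨C, hC, hlogC⟩ := KelleyMeka.exists_logBound_le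
  refine ⟨1, 6 * C, one_pos, by positivity, fun N hN A hAN hfree => ?_⟩
  have hN0 : (2 : ℝ) ≤ N := by exact_mod_cast hN
  have hlogN : 0 < Real.log N := Real.log_pos (by linarith)
  have hpow : Real.log N ^ (1 + 1 : ℝ) = Real.log N ^ 2 := by
    rw [(by norm_num : (1 + 1 : ℝ) = (2 : ℕ)), Real.rpow_natCast]
  rw [hpow, le_div_iff₀ (by positivity)]
  rcases A.eq_empty_or_nonempty with rfl | hne
  · simp only [Finset.card_empty, Nat.cast_zero, zero_mul]
    positivity
  have hA0 : (0 : ℝ) < A.card := by exact_mod_cast hne.card_pos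
  have hAcard : A.card ≤ N := by
    have := Finset.card_le_card hAN
    rw [Int.card_Icc] at this
    omega
  have hM : (0 : ℝ) < (2 * N + 1 : ℕ) := by positivity
  obtain ⟨n, hn, hn'⟩ := exists_nat_pow_near_of_lt_one
    (x := (A.card : ℝ) / (2 * N + 1 : ℕ)) (y := 1 / 2) (by positivity)
    (by
      rw [div_le_one hM]
      exact_mod_cast (by omega : A.card ≤ 2 * N + 1)) (by norm_num) (by norm_num)
  rw [lt_div_iff₀ hM] at hn
  rw [div_le_iff₀ hM] at hn'
  have hcast : ∀ a ∈ A, ∀ b ∈ A, ∀ c ∈ A, ∀ d ∈ A,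
      ((a : ZMod (2 * N + 1)) + b = c + d) → a + b = c + d := by
    intro a ha b hb c hc d hd h
    have ha' := Finset.mem_Icc.1 (hAN ha)
    have hb' := Finset.mem_Icc.1 (hAN hb)
    have hc' := Finset.mem_Icc.1 (hAN hc)
    have hd' := Finset.mem_Icc.1 (hAN hd)
    have h1 : ((a + b : ℤ) : ZMod (2 * N + 1)) = ((c + d : ℤ) : ZMod (2 * N + 1)) := by
      push_cast; exact h
    rw [ZMod.intCast_eq_intCast_iff_dvd_sub] at h1
    have h2 := Int.eq_zero_of_abs_lt_dvd h1 (by rw [abs_lt]; push_cast; constructor <;> omega)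
    omega
  have hinjA : Set.InjOn (fun a : ℤ => (a : ZMod (2 * N + 1))) A := by
    intro a ha b hb h
    have := hcast a ha a ha b hb b hb (by simp only at h; rw [h])
    omega
  have hinj : Function.Injective fun c : ZMod (2 * N + 1) => c + c := by
    intro c d h
    have h0 : (2 * N + 1 : ZMod (2 * N + 1)) = 0 := by
      have := ZMod.natCast_self (2 * N + 1)
      push_cast at this
      exact this
    simp only at h
    linear_combination (N + 1 : ZMod (2 * N + 1)) * h - (c - d) * h0
  have key := KelleyMeka.card_le_of_free hinj (A.image fun a : ℤ => (a : ZMod (2 * N + 1)))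
    (by
      intro a' ha' b' hb' c' hc' h
      obtain ⟨a, ha, rfl⟩ := Finset.mem_image.1 ha'
      obtain ⟨b, hb, rfl⟩ := Finset.mem_image.1 hb'
      obtain ⟨c, hc, rfl⟩ := Finset.mem_image.1 hc'
      have h1 := hcast a ha b hb c hc c hc h
      by_contra hac
      refine hfree ⟨a, c - a, fun h0 => hac ?_, ha, ?_, ?_⟩
      · rw [sub_eq_zero.1 h0]
      · rwa [add_sub_cancel]
      · rwa [(by linarith : a + 2 * (c - a) = b)]) (n + 1)
    (by
      rw [Finset.card_image_of_injOn hinjA, ZMod.card]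
      exact hn.le)
  rw [ZMod.card] at key
  have h1 : Real.log N ≤ 5 * KelleyMeka.logBound (n + 1) := by
    have h2 : (N : ℝ) ≤ 100 ^ KelleyMeka.logBound (n + 1) := by
      refine le_trans ?_ key
      exact_mod_cast (by omega : N ≤ 2 * N + 1)
    have h3 := Real.log_le_log (by linarith) h2
    rw [Real.log_pow] at h3
    have h4 : Real.log 100 ≤ 5 := by
      rw [Real.log_le_iff_le_exp (by norm_num), ← mul_one (5 : ℝ),
        (by norm_num : (5 : ℝ) = (5 : ℕ)), Real.exp_nat_mul]
      have h5 : (2.7 : ℝ) ≤ Real.exp 1 := by have := Real.exp_one_gt_d9; linarith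
      exact le_trans (by norm_num) (pow_le_pow_left₀ (by norm_num) h5 5)
    have h6 : (0 : ℝ) ≤ KelleyMeka.logBound (n + 1) := by positivity
    nlinarith
  have h2 : Real.log N ^ 2 ≤ C * 2 ^ (n + 1) :=
    (pow_le_pow_left₀ hlogN.le h1 2).trans (hlogC (n + 1))
  calc (A.card : ℝ) * Real.log N ^ 2
      ≤ ((1 / 2) ^ n * (2 * N + 1 : ℕ)) * (C * 2 ^ (n + 1)) := by gcongr
    _ = 2 * C * (2 * N + 1) * ((1 / 2) ^ n * 2 ^ n) := by push_cast; ring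
    _ = 2 * C * (2 * N + 1) := by rw [← mul_pow]; norm_num
    _ ≤ 6 * C * N := by nlinarith
end
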